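/- Let n ≥ 2 and let s > 2. Then there exists b₀ ∈ (0, 2/(3√3)) such that the Cauchy problem for P is not locally solvable at the origin in the Gevrey class γ^(s): there exist u₀, u₁, u₂ ∈ γ^(s)(ℝⁿ) such that for every neighborhood U of the origin in ℝ^{n+1} there is no u ∈ C^∞(U) with Pu = 0 in U and D₀^j u(0, x') = u_j(x') for j = 0, 1, 2 whenever (0, x') ∈ U. -/

import Mathlib

open Complex

/-- Partial derivative in the `j`-th coordinate direction. -/
noncomputable def pd {N : ℕ} (j : Fin N) (f : (Fin N → ℝ) → ℂ) : (Fin N → ℝ) → ℂ :=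
  fun x => fderiv ℝ f x (Pi.single j 1)

/-- `D_j = -i ∂/∂x_j`. -/
noncomputable def Dop {N : ℕ} (j : Fin N) (f : (Fin N → ℝ) → ℂ) : (Fin N → ℝ) → ℂ :=
  fun x => -Complex.I * pd j f x

/-- Iterated mixed partial derivative `∂^α`. -/
noncomputable def pdMulti {N : ℕ} (α : Fin N → ℕ) (f : (Fin N → ℝ) → ℂ) : (Fin N → ℝ) → ℂ :=
  (List.finRange N).foldr (fun j g => (pd j)^[α j] g) f

/-- The Gevrey class `γ^(s)(ℝ^N)`. -/
def GevreyOn (s : ℝ) {N : ℕ} (f : (Fin N → ℝ) → ℂ) : Prop :=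
  ContDiff ℝ (⊤ : ℕ∞) f ∧ ∀ K : Set (Fin N → ℝ), IsCompact K →
    ∃ C > (0:ℝ), ∃ h > (0:ℝ), ∀ x ∈ K, ∀ α : Fin N → ℕ,
      ‖pdMulti α f x‖ ≤ C * h ^ (∑ j, α j) * ((Nat.factorial (∑ j, α j) : ℝ)) ^ s

/-- The operator `P u = D₀³u − (D₁² + x₁²Dₙ²)D₀u − b₀ x₁³ Dₙ³ u` on `ℝ^{n+1}`. -/
noncomputable def Pop (n : ℕ) (b₀ : ℝ) (u : (Fin (n+1) → ℝ) → ℂ) : (Fin (n+1) → ℝ) → ℂ :=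
  fun x =>
    Dop 0 (Dop 0 (Dop 0 u)) x
      - (Dop 1 (Dop 1 (Dop 0 u)) x
         + (↑(x 1) : ℂ)^2 * Dop (Fin.last n) (Dop (Fin.last n) (Dop 0 u)) x)
      - (b₀ : ℂ) * (↑(x 1) : ℂ)^3 *
          Dop (Fin.last n) (Dop (Fin.last n) (Dop (Fin.last n) u)) x

/-- Taylor coefficients at `0` of the solution of `w'' = lam * (z ^ 2 + b * z ^ 3 - 1) * w`
with `w 0 = a`, `w' 0 = e`. -/
noncomputable def oscCoeff (a e lam : ℂ) (b : ℝ) : ℕ → ℂ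
  | 0 => a
  | 1 => e
  | 2 => -(lam * a) / 2
  | 3 => -(lam * e) / 6
  | 4 => lam * (a + lam * a / 2) / 12
  | (n + 5) => lam * (oscCoeff a e lam b (n + 1) + b * oscCoeff a e lam b n
      - oscCoeff a e lam b (n + 3)) / ((n + 4) * (n + 5))

/-- The potential `lam * (z ^ 2 + b * z ^ 3 - 1)`. -/
noncomputable def oscPot (lam : ℂ) (b : ℝ) (z : ℂ) : ℂ := lam * (z ^ 2 + b * z ^ 3 - 1)

/-- The solution of `w'' = lam * (z ^ 2 + b * z ^ 3 - 1) * w` with `w 0 = a`, `w' 0 = e`. -/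
noncomputable def oscSol (a e lam : ℂ) (b : ℝ) (z : ℂ) : ℂ :=
  ∑' n, oscCoeff a e lam b n * z ^ n

/-- The derivative of `oscSol`. -/
noncomputable def oscSol' (a e lam : ℂ) (b : ℝ) (z : ℂ) : ℂ :=
  ∑' n : ℕ, ((n + 1 : ℕ) : ℂ) * oscCoeff a e lam b (n + 1) * z ^ n

section
variable {a e lam : ℂ} {b : ℝ}

lemma oscCoeff_succ5_norm_le (hl : ‖lam‖ ≤ 2) (hb : |b| ≤ 2) (n : ℕ) :
    ‖oscCoeff a e lam b (n + 5)‖ ≤ 2 * (‖oscCoeff a e lam b (n + 1)‖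
      + 2 * ‖oscCoeff a e lam b n‖ + ‖oscCoeff a e lam b (n + 3)‖) / ((n + 4) * (n + 5)) := by
  have h1 : ‖((n : ℂ) + 4) * (n + 5)‖ = ((n : ℝ) + 4) * (n + 5) := by
    have : ((n : ℂ) + 4) * (n + 5) = ((((n : ℝ) + 4) * (n + 5) : ℝ) : ℂ) := by push_cast; ring
    rw [this, Complex.norm_real, Real.norm_of_nonneg (by positivity)]
  rw [oscCoeff, norm_div, h1, norm_mul]
  gcongr
  refine (norm_sub_le _ _).trans ?_
  gcongr
  refine (norm_add_le _ _).trans ?_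
  gcongr
  rw [norm_mul, Complex.norm_real, Real.norm_eq_abs]
  gcongr

lemma oscCoeff_norm_le_one (ha : ‖a‖ ≤ 1) (he : ‖e‖ ≤ 1) (hl : ‖lam‖ ≤ 2) (hb : |b| ≤ 2) :
    ∀ n, ‖oscCoeff a e lam b n‖ ≤ 1 := by
  intro n
  induction n using Nat.strong_induction_on with
  | _ n ih =>
    match n with
    | 0 => simpa [oscCoeff] using ha
    | 1 => simpa [oscCoeff] using he
    | 2 =>
      have : ‖lam‖ * ‖a‖ ≤ 2 * 1 := by gcongr
      simp only [oscCoeff, norm_div, norm_neg, norm_mul, Complex.norm_ofNat]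
      linarith
    | 3 =>
      have : ‖lam‖ * ‖e‖ ≤ 2 * 1 := by gcongr
      simp only [oscCoeff, norm_div, norm_neg, norm_mul, Complex.norm_ofNat]
      linarith
    | 4 =>
      have h1 : ‖lam‖ * ‖a‖ ≤ 2 * 1 := by gcongr
      have h2 : ‖a + lam * a / 2‖ ≤ 2 := by
        refine (norm_add_le _ _).trans ?_
        rw [norm_div, norm_mul, Complex.norm_ofNat]
        linarith
      have : ‖lam‖ * ‖a + lam * a / 2‖ ≤ 2 * 2 := by gcongr
      simp only [oscCoeff, norm_div, norm_mul, Complex.norm_ofNat]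
      linarith
    | (n + 5) =>
      refine (oscCoeff_succ5_norm_le hl hb n).trans ?_
      rw [div_le_one (by positivity)]
      have h1 := ih (n + 1) (by omega)
      have h2 := ih n (by omega)
      have h3 := ih (n + 3) (by omega)
      have : (0 : ℝ) ≤ n := by positivity
      nlinarith

lemma exists_oscCoeff_bound (r : ℝ) (hr : 1 ≤ r) : ∃ D : ℝ, 0 < D ∧ ∀ (a e lam : ℂ) (b : ℝ),
    ‖a‖ ≤ 1 → ‖e‖ ≤ 1 → ‖lam‖ ≤ 2 → |b| ≤ 2 → ∀ n, ‖oscCoeff a e lam b n‖ * r ^ n ≤ D := by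
  have hr0 : 0 < r := by linarith
  obtain ⟨N, hN⟩ := exists_nat_ge (8 * r ^ 5)
  refine ⟨r ^ (N + 5), by positivity, fun a e lam b ha he hl hb n => ?_⟩
  induction n using Nat.strong_induction_on with
  | _ n ih =>
    by_cases hn : n < N + 5
    · calc ‖oscCoeff a e lam b n‖ * r ^ n ≤ 1 * r ^ (N + 5) := by
            gcongr
            · exact oscCoeff_norm_le_one ha he hl hb n
        _ = _ := one_mul _
    · obtain ⟨m, rfl⟩ : ∃ m, n = m + 5 := ⟨n - 5, by omega⟩
      have hm : (N : ℝ) ≤ m := by exact_mod_cast (by omega : N ≤ m)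
      set D := r ^ (N + 5) with hD
      have hDp : 0 < D := by positivity
      have h1 := ih (m + 1) (by omega)
      have h2 := ih m (by omega)
      have h3 := ih (m + 3) (by omega)
      have hm4 : 0 < ((m : ℝ) + 4) * (m + 5) := by positivity
      calc ‖oscCoeff a e lam b (m + 5)‖ * r ^ (m + 5)
          ≤ (2 * (‖oscCoeff a e lam b (m + 1)‖
      + 2 * ‖oscCoeff a e lam b m‖ + ‖oscCoeff a e lam b (m + 3)‖) / ((m + 4) * (m + 5)))
        * r ^ (m + 5) := by
            gcongr
            exact oscCoeff_succ5_norm_le hl hb m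
        _ = 2 * (r ^ 4 * (‖oscCoeff a e lam b (m + 1)‖ * r ^ (m + 1))
      + 2 * (r ^ 5 * (‖oscCoeff a e lam b m‖ * r ^ m)) +
          r ^ 2 * (‖oscCoeff a e lam b (m + 3)‖ * r ^ (m + 3))) / ((m + 4) * (m + 5)) := by
            ring
        _ ≤ 2 * (r ^ 5 * D + 2 * (r ^ 5 * D) + r ^ 5 * D) / ((m + 4) * (m + 5)) := by
            gcongr 2 * (?_ * ?_ + 2 * (?_ * ?_) + ?_ * ?_) / _
            · exact pow_le_pow_right₀ hr (by norm_num)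
            · exact pow_le_pow_right₀ hr (by norm_num)
        _ ≤ D := by
            rw [div_le_iff₀ hm4]
            have h0 : (0 : ℝ) ≤ m := by positivity
            have h8 : 8 * r ^ 5 ≤ (m + 4) * (m + 5) := by nlinarith
            nlinarith [mul_le_mul_of_nonneg_left h8 hDp.le]

lemma hasDerivAt_tsum_powers {c : ℕ → ℂ} (hc : ∀ r : ℝ, 1 ≤ r → ∃ D, ∀ n, ‖c n‖ * r ^ n ≤ D)
    (z : ℂ) : HasDerivAt (fun z => ∑' n, c n * z ^ n)
      (∑' n : ℕ, ((n + 1 : ℕ) : ℂ) * c (n + 1) * z ^ n) z := by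
  set R : ℝ := ‖z‖ + 1 with hR
  have hR1 : 1 ≤ R := by rw [hR]; linarith [norm_nonneg z]
  have hR0 : 0 < R := by linarith
  obtain ⟨D, hD⟩ := hc (4 * R) (by linarith)
  have hu : Summable (fun n : ℕ => D * (1 / 2 : ℝ) ^ n) :=
    (summable_geometric_of_lt_one (by norm_num) (by norm_num)).mul_left D
  have key : ∀ n : ℕ, ∀ y ∈ Metric.ball (0 : ℂ) R, ‖(n : ℂ) * c n * y ^ (n - 1)‖ ≤
      D * (1 / 2 : ℝ) ^ n := by
    intro n y hy
    have hy' : ‖y‖ ≤ R := by simpa using (Metric.mem_ball.1 hy).le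
    have h2 : ‖y‖ ^ (n - 1) ≤ R ^ n :=
      (pow_le_pow_left₀ (norm_nonneg _) hy' _).trans (pow_le_pow_right₀ hR1 (by omega))
    have h3 : (n : ℝ) ≤ 2 ^ n := by exact_mod_cast Nat.lt_two_pow_self.le
    rw [norm_mul, norm_mul, norm_pow, Complex.norm_natCast]
    calc (n : ℝ) * ‖c n‖ * ‖y‖ ^ (n - 1) ≤ 2 ^ n * ‖c n‖ * R ^ n := by gcongr
      _ = (‖c n‖ * (4 * R) ^ n) * (1 / 2) ^ n := by
        rw [mul_pow, show (4 : ℝ) = 2 * 2 by norm_num, mul_pow, one_div, inv_pow]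
        field_simp
      _ ≤ _ := by gcongr; exact hD n
  have hz : z ∈ Metric.ball (0 : ℂ) R := by simp [hR]
  have h := hasDerivAt_tsum_of_isPreconnected (g := fun n (z : ℂ) => c n * z ^ n)
    (g' := fun n (y : ℂ) => (n : ℂ) * c n * y ^ (n - 1)) (y₀ := 0) hu Metric.isOpen_ball
    (convex_ball (0 : ℂ) R).isPreconnected
    (fun n y _ => by
      have := (hasDerivAt_pow n y).const_mul (c n)
      convert! this using 1; ring) key
    (by simp [hR0]) (summable_of_ne_finset_zero (s := {0}) (by
      intro n hn; simp at hn; simp [hn])) hz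
  refine h.congr_deriv ?_
  have hs : Summable (fun n : ℕ => (n : ℂ) * c n * z ^ (n - 1)) :=
    Summable.of_norm_bounded hu (fun n => key n z hz)
  rw [hs.tsum_eq_zero_add]
  simp

lemma powers_bound_shift {c : ℕ → ℂ} (hc : ∀ r : ℝ, 1 ≤ r → ∃ D, ∀ n, ‖c n‖ * r ^ n ≤ D) :
    ∀ r : ℝ, 1 ≤ r → ∃ D, ∀ n : ℕ, ‖((n + 1 : ℕ) : ℂ) * c (n + 1)‖ * r ^ n ≤ D := by
  intro r hr
  obtain ⟨D, hD⟩ := hc (2 * r) (by linarith)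
  refine ⟨D, fun n => (le_trans ?_ (hD (n + 1)))⟩
  have h3 : ((n + 1 : ℕ) : ℝ) ≤ 2 ^ (n + 1) := by exact_mod_cast Nat.lt_two_pow_self.le
  rw [norm_mul, Complex.norm_natCast, mul_pow]
  have : r ^ n ≤ r ^ (n + 1) := pow_le_pow_right₀ hr (by omega)
  calc _ ≤ 2 ^ (n + 1) * ‖c (n + 1)‖ * r ^ (n + 1) := by gcongr
    _ = _ := by ring

lemma summable_powers {c : ℕ → ℂ} (hc : ∀ r : ℝ, 1 ≤ r → ∃ D, ∀ n, ‖c n‖ * r ^ n ≤ D) (z : ℂ) :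
    Summable (fun n => c n * z ^ n) := by
  obtain ⟨D, hD⟩ := hc (2 * (‖z‖ + 1)) (by linarith [norm_nonneg z])
  refine Summable.of_norm_bounded (g := fun n : ℕ => D * (1 / 2 : ℝ) ^ n)
    ((summable_geometric_of_lt_one (by norm_num) (by norm_num)).mul_left D) fun n => ?_
  rw [norm_mul, norm_pow]
  have h0 := norm_nonneg z
  calc ‖c n‖ * ‖z‖ ^ n ≤ ‖c n‖ * (‖z‖ + 1) ^ n := by gcongr; linarith
    _ = (‖c n‖ * (2 * (‖z‖ + 1)) ^ n) * (1 / 2) ^ n := by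
      rw [mul_pow, one_div, inv_pow]; field_simp
    _ ≤ _ := by gcongr; exact hD n

end

section
variable {a e lam : ℂ} {b : ℝ}

lemma oscCoeff_growth (ha : ‖a‖ ≤ 1) (he : ‖e‖ ≤ 1) (hl : ‖lam‖ ≤ 2) (hb : |b| ≤ 2) :
    ∀ r : ℝ, 1 ≤ r → ∃ D, ∀ n, ‖oscCoeff a e lam b n‖ * r ^ n ≤ D := fun r hr =>
  let ⟨D, _, h⟩ := exists_oscCoeff_bound r hr
  ⟨D, h a e lam b ha he hl hb⟩

lemma hasDerivAt_oscSol (ha : ‖a‖ ≤ 1) (he : ‖e‖ ≤ 1) (hl : ‖lam‖ ≤ 2) (hb : |b| ≤ 2) (z : ℂ) :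
    HasDerivAt (oscSol a e lam b) (oscSol' a e lam b z) z :=
  hasDerivAt_tsum_powers (oscCoeff_growth ha he hl hb) z

lemma tsum_powers_second_deriv {c : ℕ → ℂ}
    (hc : ∀ r : ℝ, 1 ≤ r → ∃ D, ∀ n, ‖c n‖ * r ^ n ≤ D)
    (f2 : c 2 = -(lam * c 0) / 2) (f3 : c 3 = -(lam * c 1) / 6)
    (f4 : c 4 = lam * (c 0 + lam * c 0 / 2) / 12)
    (f5 : ∀ n : ℕ, c (n + 5) = lam * (c (n + 1) + b * c n - c (n + 3)) / ((n + 4) * (n + 5)))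
    (z : ℂ) :
    ∑' n : ℕ, ((n + 1 : ℕ) : ℂ) * (((n + 1 + 1 : ℕ) : ℂ) * c (n + 1 + 1)) * z ^ n =
      lam * (z ^ 2 + b * z ^ 3 - 1) * ∑' n, c n * z ^ n := by
  have hc2 := powers_bound_shift (powers_bound_shift hc)
  have s0 := summable_powers hc z
  have s2 := summable_powers hc2 z
  have t0 : Summable (fun n => c (n + 3) * z ^ (n + 3)) :=
    (summable_nat_add_iff (f := fun n => c n * z ^ n) 3).2 s0
  have t1 : Summable (fun n => c (n + 1) * z ^ (n + 1)) :=
    (summable_nat_add_iff (f := fun n => c n * z ^ n) 1).2 s0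
  have g0 : ∑' n, c (n + 3) * z ^ (n + 3) =
      ∑' n, c n * z ^ n - (c 0 + c 1 * z + c 2 * z ^ 2) := by
    rw [← s0.sum_add_tsum_nat_add 3]
    simp [Finset.sum_range_succ]
  have g1 : ∑' n, c (n + 1) * z ^ (n + 1) = ∑' n, c n * z ^ n - c 0 := by
    rw [← s0.sum_add_tsum_nat_add 1]
    simp
  have e2 : ∀ n : ℕ, ((n + 3 + 1 : ℕ) : ℂ) * (((n + 3 + 1 + 1 : ℕ) : ℂ) * c (n + 3 + 1 + 1)) *
      z ^ (n + 3) = lam * (z ^ 2 * (c (n + 1) * z ^ (n + 1)) + b * z ^ 3 * (c n * z ^ n) -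
        c (n + 3) * z ^ (n + 3)) := by
    intro n
    rw [show n + 3 + 1 + 1 = n + 5 by ring, f5]
    have h4 : (n : ℂ) + 4 ≠ 0 := by exact_mod_cast (by omega : n + 4 ≠ 0)
    have h5 : (n : ℂ) + 5 ≠ 0 := by exact_mod_cast (by omega : n + 5 ≠ 0)
    push_cast
    field_simp
    ring
  rw [← s2.sum_add_tsum_nat_add 3]
  simp only [e2]
  rw [tsum_mul_left, Summable.tsum_sub ((t1.mul_left _).add (s0.mul_left _)) t0,
    Summable.tsum_add (t1.mul_left _) (s0.mul_left _), tsum_mul_left, tsum_mul_left, g1, g0]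
  simp only [Finset.sum_range_succ, Finset.sum_range_zero, Nat.reduceAdd, f2, f3, f4]
  push_cast
  ring

lemma hasDerivAt_oscSol' (ha : ‖a‖ ≤ 1) (he : ‖e‖ ≤ 1) (hl : ‖lam‖ ≤ 2) (hb : |b| ≤ 2) (z : ℂ) :
    HasDerivAt (oscSol' a e lam b) (oscPot lam b z * oscSol a e lam b z) z := by
  have hc := oscCoeff_growth ha he hl hb
  refine (hasDerivAt_tsum_powers (powers_bound_shift hc) z).congr_deriv ?_
  refine tsum_powers_second_deriv hc ?_ ?_ ?_ ?_ z
  · simp only [oscCoeff]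
  · simp only [oscCoeff]
  · simp only [oscCoeff]
  · intro n
    rw [oscCoeff]

lemma oscSol_zero : oscSol a e lam b 0 = a := by
  rw [oscSol, tsum_eq_single 0 (by intro n hn; simp [hn])]
  simp [oscCoeff]

lemma oscSol'_zero : oscSol' a e lam b 0 = e := by
  rw [oscSol', tsum_eq_single 0 (by intro n hn; simp [hn])]
  simp [oscCoeff]

end

lemma continuous_oscCoeff (a e : ℂ) (n : ℕ) :
    Continuous fun p : ℂ × ℝ => oscCoeff a e p.1 p.2 n := by
  induction n using Nat.strong_induction_on with
  | _ n ih =>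
    match n with
    | 0 => simp only [oscCoeff]; fun_prop
    | 1 => simp only [oscCoeff]; fun_prop
    | 2 => simp only [oscCoeff]; fun_prop
    | 3 => simp only [oscCoeff]; fun_prop
    | 4 => simp only [oscCoeff]; fun_prop
    | (n + 5) =>
      have h1 := ih (n + 1) (by omega)
      have h2 := ih n (by omega)
      have h3 := ih (n + 3) (by omega)
      simp only [oscCoeff]
      fun_prop

lemma differentiable_oscCoeff (a e : ℂ) (b : ℝ) (n : ℕ) :
    Differentiable ℂ fun lam : ℂ => oscCoeff a e lam b n := by
  induction n using Nat.strong_induction_on with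
  | _ n ih =>
    match n with
    | 0 => simp only [oscCoeff]; fun_prop
    | 1 => simp only [oscCoeff]; fun_prop
    | 2 => simp only [oscCoeff]; fun_prop
    | 3 => simp only [oscCoeff]; fun_prop
    | 4 => simp only [oscCoeff]; fun_prop
    | (n + 5) =>
      have h1 := ih (n + 1) (by omega)
      have h2 := ih n (by omega)
      have h3 := ih (n + 3) (by omega)
      simp only [oscCoeff]
      fun_prop

lemma summable_geom_half (D : ℝ) : Summable (fun n : ℕ => D * (1 / 2 : ℝ) ^ n) :=
  (summable_geometric_of_lt_one (by norm_num) (by norm_num)).mul_left D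

lemma exists_oscTerm_bound (z : ℂ) : ∃ D : ℝ, ∀ (a e lam : ℂ) (b : ℝ),
    ‖a‖ ≤ 1 → ‖e‖ ≤ 1 → ‖lam‖ ≤ 2 → |b| ≤ 2 → ∀ n : ℕ,
      ‖oscCoeff a e lam b n * z ^ n‖ ≤ D * (1 / 2 : ℝ) ^ n ∧
      ‖((n + 1 : ℕ) : ℂ) * oscCoeff a e lam b (n + 1) * z ^ n‖ ≤ D * (1 / 2 : ℝ) ^ n := by
  have h0 := norm_nonneg z
  obtain ⟨D, hD0, hD⟩ := exists_oscCoeff_bound (4 * (‖z‖ + 1)) (by linarith)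
  refine ⟨D, fun a e lam b ha he hl hb n => ?_⟩
  have h := hD a e lam b ha he hl hb
  constructor
  · rw [norm_mul, norm_pow]
    calc ‖oscCoeff a e lam b n‖ * ‖z‖ ^ n
        ≤ ‖oscCoeff a e lam b n‖ * (2 * (‖z‖ + 1)) ^ n := by gcongr; linarith
      _ = (‖oscCoeff a e lam b n‖ * (4 * (‖z‖ + 1)) ^ n) * (1 / 2) ^ n := by
        rw [mul_assoc, ← mul_pow]; ring_nf
      _ ≤ _ := by gcongr; exact h n
  · have h3 : ((n + 1 : ℕ) : ℝ) ≤ 2 ^ (n + 1) := by exact_mod_cast Nat.lt_two_pow_self.le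
    rw [norm_mul, norm_mul, norm_pow, Complex.norm_natCast]
    have : ‖z‖ ^ n ≤ (‖z‖ + 1) ^ (n + 1) :=
      (pow_le_pow_left₀ h0 (by linarith) _).trans (pow_le_pow_right₀ (by linarith) (by omega))
    calc ((n + 1 : ℕ) : ℝ) * ‖oscCoeff a e lam b (n + 1)‖ * ‖z‖ ^ n
        ≤ 2 ^ (n + 1) * ‖oscCoeff a e lam b (n + 1)‖ * (‖z‖ + 1) ^ (n + 1) := by gcongr
      _ = (‖oscCoeff a e lam b (n + 1)‖ * (4 * (‖z‖ + 1)) ^ (n + 1)) * (1 / 2) ^ (n + 1) := by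
        rw [mul_assoc, mul_assoc, ← mul_pow, mul_left_comm, ← mul_pow]; ring_nf
      _ ≤ D * (1 / 2) ^ (n + 1) := by gcongr; exact h (n + 1)
      _ ≤ _ := by
        gcongr ?_ * ?_
        exact pow_le_pow_of_le_one (by norm_num) (by norm_num) (by omega)

lemma continuousOn_oscSol {a e : ℂ} (ha : ‖a‖ ≤ 1) (he : ‖e‖ ≤ 1) (z : ℂ) :
    ContinuousOn (fun p : ℂ × ℝ => oscSol a e p.1 p.2 z) {p | ‖p.1‖ ≤ 2 ∧ |p.2| ≤ 2} := by
  obtain ⟨D, hD⟩ := exists_oscTerm_bound z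
  exact continuousOn_tsum (fun n => ((continuous_oscCoeff a e n).mul continuous_const).continuousOn)
    (summable_geom_half D) fun n p hp => (hD a e p.1 p.2 ha he hp.1 hp.2 n).1

lemma differentiableOn_oscSol {a e : ℂ} (ha : ‖a‖ ≤ 1) (he : ‖e‖ ≤ 1) {b : ℝ} (hb : |b| ≤ 2)
    (z : ℂ) :
    DifferentiableOn ℂ (fun lam => oscSol a e lam b z) (Metric.ball 0 2) := by
  obtain ⟨D, hD⟩ := exists_oscTerm_bound z
  exact differentiableOn_tsum_of_summable_norm (summable_geom_half D)
    (fun n => ((differentiable_oscCoeff a e b n).mul_const _).differentiableOn)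
    Metric.isOpen_ball fun n p hp => (hD a e p b ha he (le_of_lt (by simpa using hp)) hb n).1

/-- `w` solves `w'' = Q * w` on the complex plane, with derivative `w'`. -/
structure SolPair (Q w w' : ℂ → ℂ) : Prop where
  deriv_fst : ∀ z, HasDerivAt w (w' z) z
  deriv_snd : ∀ z, HasDerivAt w' (Q z * w z) z

/-- `u` solves `u'' = V * u` on the real line, with derivative `v`. -/
structure RaySol (V u v : ℝ → ℂ) : Prop where
  deriv_fst : ∀ r, HasDerivAt u (v r) r
  deriv_snd : ∀ r, HasDerivAt v (V r * u r) r

lemma SolPair.ray {Q w w' : ℂ → ℂ} (h : SolPair Q w w') (z₀ ω : ℂ) :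
    RaySol (fun r => ω ^ 2 * Q (z₀ + ω * r)) (fun r => w (z₀ + ω * r))
      (fun r => ω * w' (z₀ + ω * r)) := by
  have hg : ∀ r : ℝ, HasDerivAt (fun r : ℝ => z₀ + ω * (r : ℂ)) ω r := fun r => by
    simpa using (((hasDerivAt_id r).ofReal_comp).const_mul ω).const_add z₀
  refine ⟨fun r => ?_, fun r => ?_⟩
  · refine ((h.deriv_fst (z₀ + ω * r)).comp_of_eq r (hg r) rfl).congr_deriv ?_
    ring
  · refine (((h.deriv_snd (z₀ + ω * r)).comp_of_eq r (hg r) rfl).const_mul ω).congr_deriv ?_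
    ring

lemma SolPair.lin {Q w w' v v' : ℂ → ℂ} (h : SolPair Q w w') (k : SolPair Q v v') (a e : ℂ) :
    SolPair Q (fun z => a * w z + e * v z) (fun z => a * w' z + e * v' z) := by
  refine ⟨fun z => ((h.deriv_fst z).const_mul a).add ((k.deriv_fst z).const_mul e), fun z => ?_⟩
  refine (((h.deriv_snd z).const_mul a).add ((k.deriv_snd z).const_mul e)).congr_deriv ?_
  ring

lemma SolPair.wronskian {Q w w' v v' : ℂ → ℂ} (h : SolPair Q w w') (k : SolPair Q v v')
    (z z₀ : ℂ) : w z * v' z - w' z * v z = w z₀ * v' z₀ - w' z₀ * v z₀ := by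
  have hd : ∀ z, HasDerivAt (fun z => w z * v' z - w' z * v z) 0 z := fun z => by
    refine (((h.deriv_fst z).mul (k.deriv_snd z)).sub
      ((h.deriv_snd z).mul (k.deriv_fst z))).congr_deriv ?_
    ring
  exact is_const_of_deriv_eq_zero (fun z => (hd z).differentiableAt) (fun z => (hd z).deriv) z z₀

lemma solPair_oscSol {a e lam : ℂ} {b : ℝ} (ha : ‖a‖ ≤ 1) (he : ‖e‖ ≤ 1) (hl : ‖lam‖ ≤ 2)
    (hb : |b| ≤ 2) : SolPair (oscPot lam b) (oscSol a e lam b) (oscSol' a e lam b) :=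
  ⟨hasDerivAt_oscSol ha he hl hb, hasDerivAt_oscSol' ha he hl hb⟩

section
variable {lam : ℂ} {b : ℝ} (hl : ‖lam‖ ≤ 2) (hb : |b| ≤ 2)
include hl hb

lemma solPair_cos : SolPair (oscPot lam b) (oscSol 1 0 lam b) (oscSol' 1 0 lam b) :=
  solPair_oscSol (by simp) (by simp) hl hb

lemma solPair_sin : SolPair (oscPot lam b) (oscSol 0 1 lam b) (oscSol' 0 1 lam b) :=
  solPair_oscSol (by simp) (by simp) hl hb

lemma osc_wronskian (z : ℂ) : oscSol 1 0 lam b z * oscSol' 0 1 lam b z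
    - oscSol' 1 0 lam b z * oscSol 0 1 lam b z = 1 := by
  rw [(solPair_cos hl hb).wronskian (solPair_sin hl hb) z 0]
  simp [oscSol_zero, oscSol'_zero]

lemma SolPair.eq_comb {w w' : ℂ → ℂ} (h : SolPair (oscPot lam b) w w') (z : ℂ) :
    w z = w 0 * oscSol 1 0 lam b z + w' 0 * oscSol 0 1 lam b z := by
  have h1 := h.wronskian (solPair_cos hl hb) z 0
  have h2 := h.wronskian (solPair_sin hl hb) z 0
  have h3 := osc_wronskian hl hb z
  simp only [oscSol_zero, oscSol'_zero] at h1 h2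
  linear_combination (-w z) * h3 + oscSol 1 0 lam b z * h2 - oscSol 0 1 lam b z * h1

lemma SolPair.eq_zero_of_point {w w' : ℂ → ℂ} (h : SolPair (oscPot lam b) w w') {z₀ : ℂ}
    (h0 : w z₀ = 0) (h0' : w' z₀ = 0) : ∀ z, w z = 0 := by
  intro z
  have h1 := h.wronskian (solPair_cos hl hb) z z₀
  have h2 := h.wronskian (solPair_sin hl hb) z z₀
  have h3 := osc_wronskian hl hb z
  simp only [h0, h0', zero_mul, sub_zero] at h1 h2
  linear_combination (-w z) * h3 + oscSol 1 0 lam b z * h2 - oscSol 0 1 lam b z * h1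

lemma comb_eq_zero {a e : ℂ} {z₀ : ℂ}
    (h0 : a * oscSol 1 0 lam b z₀ + e * oscSol 0 1 lam b z₀ = 0)
    (h0' : a * oscSol' 1 0 lam b z₀ + e * oscSol' 0 1 lam b z₀ = 0) : a = 0 ∧ e = 0 := by
  have h3 := osc_wronskian hl hb z₀
  constructor
  · linear_combination (-a) * h3 + oscSol' 0 1 lam b z₀ * h0 - oscSol 0 1 lam b z₀ * h0'
  · linear_combination (-e) * h3 + oscSol 1 0 lam b z₀ * h0' - oscSol' 1 0 lam b z₀ * h0

end

lemma RaySol.hasDerivAt_energy {V u v : ℝ → ℂ} (h : RaySol V u v) (β : ℂ) (r : ℝ) :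
    HasDerivAt (fun r => (β * (starRingEnd ℂ (u r) * v r)).re)
      (β.re * ‖v r‖ ^ 2 + (β * V r).re * ‖u r‖ ^ 2) r := by
  have h1 : HasDerivAt (fun r => starRingEnd ℂ (u r)) (starRingEnd ℂ (v r)) r := by
    simpa using (h.deriv_fst r).star
  have h2 := ((h1.mul (h.deriv_snd r)).const_mul β)
  have h3 := (Complex.reCLM.hasFDerivAt.comp_hasDerivAt r h2)
  refine h3.congr_deriv ?_
  simp only [Complex.reCLM_apply, ← Complex.normSq_eq_norm_sq, Complex.normSq_apply,
    Complex.mul_re, Complex.mul_im, Complex.add_re, Complex.add_im, Complex.conj_re,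
    Complex.conj_im]
  ring

lemma RaySol.hasDerivAt_normSq {V u v : ℝ → ℂ} (h : RaySol V u v) (r : ℝ) :
    HasDerivAt (fun r => ‖u r‖ ^ 2) (2 * (starRingEnd ℂ (u r) * v r).re) r := by
  have h1 : HasDerivAt (fun r => starRingEnd ℂ (u r)) (starRingEnd ℂ (v r)) r := by
    simpa using (h.deriv_fst r).star
  have h2 := h1.mul (h.deriv_fst r)
  have h3 := (Complex.reCLM.hasFDerivAt.comp_hasDerivAt r h2)
  have h4 : (Complex.reCLM ∘ ((fun r => starRingEnd ℂ (u r)) * u)) = fun r => ‖u r‖ ^ 2 := by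
    funext r
    simp [← Complex.normSq_eq_norm_sq, Complex.normSq_apply]
  rw [h4] at h3
  refine h3.congr_deriv ?_
  simp only [Complex.reCLM_apply, Complex.mul_re, Complex.add_re, Complex.conj_re, Complex.conj_im]
  ring

lemma abs_re_conj_mul_le (x y : ℂ) : |(starRingEnd ℂ x * y).re| ≤ ‖x‖ * ‖y‖ := by
  refine (Complex.abs_re_le_norm _).trans ?_
  simp

section
variable {V u v : ℝ → ℂ} {L : ℝ}

lemma RaySol.energy_monotoneOn (h : RaySol V u v) {β : ℂ} (hβ : 0 ≤ β.re)
    (hV : ∀ r, L ≤ r → 0 ≤ (β * V r).re) :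
    MonotoneOn (fun r => (β * (starRingEnd ℂ (u r) * v r)).re) (Set.Ici L) := by
  refine monotoneOn_of_hasDerivWithinAt_nonneg (convex_Ici L)
    (fun r _ => (h.hasDerivAt_energy β r).continuousAt.continuousWithinAt)
    (fun r _ => (h.hasDerivAt_energy β r).hasDerivWithinAt) fun r hr => ?_
  rw [interior_Ici] at hr
  have := hV r (le_of_lt hr)
  positivity

lemma RaySol.energy_mono_one (h : RaySol V u v) (hV : ∀ r, L ≤ r → 1 ≤ (V r).re) :
    MonotoneOn (fun r => (starRingEnd ℂ (u r) * v r).re) (Set.Ici L) := by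
  simpa using h.energy_monotoneOn (β := 1) (by simp)
    (fun r hr => by rw [one_mul]; linarith [hV r hr])

lemma RaySol.energy_nonpos (h : RaySol V u v) (hV : ∀ r, L ≤ r → 1 ≤ (V r).re) {B : ℝ}
    (hB : ∀ r, L ≤ r → ‖u r‖ ≤ B) {r : ℝ} (hr : L ≤ r) : (starRingEnd ℂ (u r) * v r).re ≤ 0 := by
  by_contra! hc
  set η := (starRingEnd ℂ (u r) * v r).re with hη
  have hmono := h.energy_mono_one hV
  have key : ∀ x, r ≤ x → 2 * η * (x - r) ≤ ‖u x‖ ^ 2 - ‖u r‖ ^ 2 := by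
    intro x hx
    refine (convex_Ici r).mul_sub_le_image_sub_of_le_deriv
      (f := fun r => ‖u r‖ ^ 2)
      (fun y _ => (h.hasDerivAt_normSq y).continuousAt.continuousWithinAt)
      (fun y _ => (h.hasDerivAt_normSq y).differentiableAt.differentiableWithinAt)
      (fun y hy => ?_) r Set.self_mem_Ici x hx hx
    rw [interior_Ici] at hy
    rw [(h.hasDerivAt_normSq y).deriv]
    have := hmono (Set.mem_Ici.2 hr) (Set.mem_Ici.2 (hr.trans (le_of_lt hy))) (le_of_lt hy)
    simp only at this
    linarith
  have hB0 : 0 ≤ B := (norm_nonneg _).trans (hB r hr)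
  set x := r + (B ^ 2 + 1) / (2 * η) with hx
  have hxr : r ≤ x := by rw [hx]; have : 0 ≤ (B ^ 2 + 1) / (2 * η) := by positivity
                         linarith
  have h1 := key x hxr
  have h2 : 2 * η * (x - r) = B ^ 2 + 1 := by rw [hx]; field_simp; ring
  have h3 := hB x (hr.trans hxr)
  have h4 : ‖u x‖ ^ 2 ≤ B ^ 2 := by gcongr
  nlinarith [sq_nonneg ‖u r‖]

lemma RaySol.norm_anti (h : RaySol V u v) {R : ℝ}
    (hN : ∀ r, L ≤ r → r ≤ R → (starRingEnd ℂ (u r) * v r).re ≤ 0) {r : ℝ} (hr : L ≤ r)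
    (hR : r ≤ R) : ‖u r‖ ≤ ‖u L‖ := by
  have : AntitoneOn (fun r => ‖u r‖ ^ 2) (Set.Icc L R) := by
    refine antitoneOn_of_hasDerivWithinAt_nonpos (convex_Icc L R)
      (fun r _ => (h.hasDerivAt_normSq r).continuousAt.continuousWithinAt)
      (fun r _ => (h.hasDerivAt_normSq r).hasDerivWithinAt) fun r hr => ?_
    rw [interior_Icc] at hr
    linarith [hN r hr.1.le hr.2.le]
  have h2 := this (Set.mem_Icc.2 ⟨le_rfl, hr.trans hR⟩) (Set.mem_Icc.2 ⟨hr, hR⟩) hr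
  exact (sq_le_sq₀ (norm_nonneg _) (norm_nonneg _)).1 h2

lemma RaySol.eq_zero_of_norm (h : RaySol V u v) {R : ℝ} (hLR : L < R)
    (hz : ∀ r, L ≤ r → r ≤ R → u r = 0) : v L = 0 := by
  have h1 : HasDerivWithinAt u (v L) (Set.Ici L) L := (h.deriv_fst L).hasDerivWithinAt
  have h2 : HasDerivWithinAt u 0 (Set.Ici L) L :=
    (hasDerivWithinAt_const L _ (0 : ℂ)).congr_of_eventuallyEq_of_mem
      (Filter.eventually_of_mem (Icc_mem_nhdsGE hLR) fun r hr => hz r hr.1 hr.2) Set.self_mem_Ici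
  exact (uniqueDiffOn_Ici L L Set.self_mem_Ici).eq_deriv _ h1 h2

lemma RaySol.energy_nonpos_of_zero (h : RaySol V u v) (hV : ∀ r, L ≤ r → 1 ≤ (V r).re) {R : ℝ}
    (hR : u R = 0) {r : ℝ} (hr : L ≤ r) (hrR : r ≤ R) : (starRingEnd ℂ (u r) * v r).re ≤ 0 := by
  have := h.energy_mono_one hV (Set.mem_Ici.2 hr) (Set.mem_Ici.2 (hr.trans hrR)) hrR
  simpa [hR] using this

lemma RaySol.zero_of_bounded (h : RaySol V u v) (hV : ∀ r, L ≤ r → 1 ≤ (V r).re) {B : ℝ}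
    (hB : ∀ r, L ≤ r → ‖u r‖ ≤ B) (h0 : u L = 0) : v L = 0 := by
  refine h.eq_zero_of_norm (lt_add_one L) fun r hr hr' => ?_
  have := h.norm_anti (R := L + 1) (fun r hr _ => h.energy_nonpos hV hB hr) hr hr'
  simpa [h0] using this

lemma RaySol.zero_of_zeros (h : RaySol V u v) (hV : ∀ r, L ≤ r → 1 ≤ (V r).re) {R : ℝ}
    (hLR : L < R) (hR : u R = 0) (h0 : u L = 0) : v L = 0 := by
  refine h.eq_zero_of_norm hLR fun r hr hr' => ?_
  have := h.norm_anti (R := R) (fun r hr hr' => h.energy_nonpos_of_zero hV hR hr hr') hr hr'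
  simpa [h0] using this

lemma RaySol.deriv_bound (h : RaySol V u v) {M B : ℝ}
    (hM : ∀ r, L ≤ r → r ≤ L + 1 → ‖V r‖ ≤ M) (hB : ∀ r, L ≤ r → r ≤ L + 1 → ‖u r‖ ≤ B) :
    ‖v L‖ ≤ (2 + M) * B := by
  have hB0 : 0 ≤ B := (norm_nonneg _).trans (hB L le_rfl (by linarith))
  have hM0 : 0 ≤ M := (norm_nonneg _).trans (hM L le_rfl (by linarith))
  have h1 : ∀ r ∈ Set.Icc L (L + 1), ‖v r - v L‖ ≤ M * B := by
    intro r hr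
    have := (convex_Icc L (L + 1)).norm_image_sub_le_of_norm_hasDerivWithin_le (f := v)
      (f' := fun r => V r * u r) (C := M * B) (fun y _ => (h.deriv_snd y).hasDerivWithinAt)
      (fun y hy => by
        rw [norm_mul]
        exact mul_le_mul (hM y hy.1 hy.2) (hB y hy.1 hy.2) (norm_nonneg _) hM0)
      (Set.left_mem_Icc.2 (by linarith)) hr
    refine this.trans ?_
    have : ‖r - L‖ ≤ 1 := by
      rw [Real.norm_of_nonneg (by linarith [hr.1])]; linarith [hr.2]
    have hMB : 0 ≤ M * B := by positivity
    nlinarith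
  have h2 : ‖(u (L + 1) - v L * ((L + 1 : ℝ) : ℂ)) - (u L - v L * (L : ℂ))‖ ≤ M * B := by
    have := (convex_Icc L (L + 1)).norm_image_sub_le_of_norm_hasDerivWithin_le
      (f := fun r : ℝ => u r - v L * (r : ℂ))
      (f' := fun r => v r - v L) (C := M * B) (fun y _ => by
        have := (h.deriv_fst y).sub (((hasDerivAt_id y).ofReal_comp).const_mul (v L))
        exact (this.congr_deriv (by simp)).hasDerivWithinAt)
      h1 (Set.left_mem_Icc.2 (by linarith)) (Set.right_mem_Icc.2 (by linarith : L ≤ L + 1))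
    simpa using this
  have h3 : v L = u (L + 1) - u L -
      ((u (L + 1) - v L * ((L + 1 : ℝ) : ℂ)) - (u L - v L * (L : ℂ))) := by
    push_cast; ring
  rw [h3]
  refine (norm_sub_le _ _).trans ?_
  have h4 := norm_sub_le (u (L + 1)) (u L)
  linarith [hB L le_rfl (by linarith), hB (L + 1) (by linarith) le_rfl]

end

open Filter Topology in
lemma tendsto_oscSol {ι : Type*} {l : Filter ι} {lam : ι → ℂ} {b : ι → ℝ} {lam₁ : ℂ} {b₁ : ℝ}
    (hlam : Tendsto lam l (𝓝 lam₁)) (hb : Tendsto b l (𝓝 b₁))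
    (h : ∀ᶠ i in l, ‖lam i‖ ≤ 2 ∧ |b i| ≤ 2) (h₁ : ‖lam₁‖ ≤ 2 ∧ |b₁| ≤ 2) {a e : ℂ}
    (ha : ‖a‖ ≤ 1) (he : ‖e‖ ≤ 1) (z : ℂ) :
    Tendsto (fun i => oscSol a e (lam i) (b i) z) l (𝓝 (oscSol a e lam₁ b₁ z)) :=
  ((continuousOn_oscSol ha he z) (lam₁, b₁) h₁).tendsto.comp
    (tendsto_nhdsWithin_iff.2 ⟨hlam.prodMk_nhds hb, h⟩)

lemma exists_oscSol_bound (z : ℂ) : ∃ K : ℝ, 0 ≤ K ∧ ∀ (a e lam : ℂ) (b : ℝ),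
    ‖a‖ ≤ 1 → ‖e‖ ≤ 1 → ‖lam‖ ≤ 2 → |b| ≤ 2 →
      ‖oscSol a e lam b z‖ ≤ K ∧ ‖oscSol' a e lam b z‖ ≤ K := by
  obtain ⟨D, hD⟩ := exists_oscTerm_bound z
  have key : ∀ (a e lam : ℂ) (b : ℝ),
    ‖a‖ ≤ 1 → ‖e‖ ≤ 1 → ‖lam‖ ≤ 2 → |b| ≤ 2 →
      ‖oscSol a e lam b z‖ ≤ ∑' n : ℕ, D * (1 / 2 : ℝ) ^ n ∧
      ‖oscSol' a e lam b z‖ ≤ ∑' n : ℕ, D * (1 / 2 : ℝ) ^ n := by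
    intro a e lam b ha he hl hb
    exact ⟨tsum_of_norm_bounded (summable_geom_half D).hasSum fun n =>
        (hD a e lam b ha he hl hb n).1,
      tsum_of_norm_bounded (summable_geom_half D).hasSum fun n => (hD a e lam b ha he hl hb n).2⟩
  refine ⟨_, ?_, key⟩
  exact (norm_nonneg _).trans (key 0 0 0 0 (by simp) (by simp) (by simp) (by simp)).1

/-- The linear combination of the fundamental solutions with initial data `a`, `e`. -/
noncomputable def oscComb (a e lam : ℂ) (b : ℝ) (z : ℂ) : ℂ :=
  a * oscSol 1 0 lam b z + e * oscSol 0 1 lam b z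

/-- The derivative of `oscComb`. -/
noncomputable def oscComb' (a e lam : ℂ) (b : ℝ) (z : ℂ) : ℂ :=
  a * oscSol' 1 0 lam b z + e * oscSol' 0 1 lam b z

lemma solPair_oscComb {lam : ℂ} {b : ℝ} (hl : ‖lam‖ ≤ 2) (hb : |b| ≤ 2) (a e : ℂ) :
    SolPair (oscPot lam b) (oscComb a e lam b) (oscComb' a e lam b) :=
  (solPair_cos hl hb).lin (solPair_sin hl hb) a e

lemma SolPair.ray_zero {Q w w' : ℂ → ℂ} (h : SolPair Q w w') (ω : ℂ) :
    RaySol (fun r => ω ^ 2 * Q (ω * r)) (fun r => w (ω * r)) (fun r => ω * w' (ω * r)) := by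
  simpa using h.ray 0 ω

/-- A convex neighbourhood of `[1/4, 1]` of admissible spectral parameters. -/
def oscDom : Set ℂ := {lam | 1 / 8 < lam.re ∧ |lam.im| < lam.re / 100 ∧ ‖lam‖ < 2}

/-- On the ray in direction `ω` the potential has real part at least `1` beyond `L`. -/
def GoodDir (ω : ℂ) (L : ℝ) : Prop := ∀ lam ∈ oscDom, ∀ b ∈ Set.Icc (0 : ℝ) 1, ∀ r, L ≤ r →
  1 ≤ (ω ^ 2 * oscPot lam b (ω * r)).re

/-- Normalized bounded solutions on a ray. -/
def BddNorm (ω : ℂ) (L : ℝ) (lam : ℂ) (b : ℝ) (a e : ℂ) : Prop :=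
  oscComb a e lam b (ω * L) = 1 ∧ ∀ r : ℝ, L ≤ r → ‖oscComb a e lam b (ω * r)‖ ≤ 1

/-- Denominator in the truncated Dirichlet problem. -/
noncomputable def dirDen (ω : ℂ) (L R : ℝ) (lam : ℂ) (b : ℝ) : ℂ :=
  oscSol 1 0 lam b (ω * R) * oscSol 0 1 lam b (ω * L)
    - oscSol 0 1 lam b (ω * R) * oscSol 1 0 lam b (ω * L)

/-- First coefficient of the solution equal to `1` at `ω * L` and `0` at `ω * R`. -/
noncomputable def dirA (ω : ℂ) (L R : ℝ) (lam : ℂ) (b : ℝ) : ℂ :=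
  -oscSol 0 1 lam b (ω * R) / dirDen ω L R lam b

/-- Second coefficient of the solution equal to `1` at `ω * L` and `0` at `ω * R`. -/
noncomputable def dirE (ω : ℂ) (L R : ℝ) (lam : ℂ) (b : ℝ) : ℂ :=
  oscSol 1 0 lam b (ω * R) / dirDen ω L R lam b

lemma oscDom_norm {lam : ℂ} (h : lam ∈ oscDom) : ‖lam‖ ≤ 2 := h.2.2.le

lemma abs_le_two_of_mem {b : ℝ} (hb : b ∈ Set.Icc (0 : ℝ) 1) : |b| ≤ 2 := by
  rw [abs_of_nonneg hb.1]; linarith [hb.2]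

section
variable {ω : ℂ} {L : ℝ} (hω : ω ≠ 0) (hG : GoodDir ω L)
include hω hG

lemma dirDen_ne {R : ℝ} (hR : L < R) {lam : ℂ} (hl : lam ∈ oscDom) {b : ℝ}
    (hb : b ∈ Set.Icc (0 : ℝ) 1) : dirDen ω L R lam b ≠ 0 := by
  intro h0
  have hl2 := oscDom_norm hl
  have hb2 := abs_le_two_of_mem hb
  set a := -oscSol 0 1 lam b (ω * R) with ha
  set e := oscSol 1 0 lam b (ω * R) with he
  have hray := (solPair_oscComb hl2 hb2 a e).ray_zero ω
  have hz := hray.zero_of_zeros (hG lam hl b hb) hR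
    (by simp only [oscComb, ha, he]; ring) (by
      simp only [oscComb, ha, he]; simp only [dirDen] at h0; linear_combination h0)
  have h1 : oscComb' a e lam b (ω * L) = 0 := (mul_eq_zero.1 hz).resolve_left hω
  have h2 := comb_eq_zero hl2 hb2 (a := a) (e := e) (z₀ := ω * L)
    (by simp only [ha, he]; simp only [dirDen] at h0; linear_combination h0) h1
  have h3 := osc_wronskian hl2 hb2 (ω * R)
  rw [← he, h2.2, show oscSol 0 1 lam b (ω * R) = 0 by
    have := h2.1; rw [ha] at this; exact neg_eq_zero.1 this] at h3
  simp at h3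

lemma dir_start {R : ℝ} (hR : L < R) {lam : ℂ} (hl : lam ∈ oscDom) {b : ℝ}
    (hb : b ∈ Set.Icc (0 : ℝ) 1) :
    oscComb (dirA ω L R lam b) (dirE ω L R lam b) lam b (ω * L) = 1 := by
  have h := dirDen_ne hω hG hR hl hb
  rw [oscComb, dirA, dirE]
  field_simp
  rw [dirDen]; ring

lemma dir_norm_le {R : ℝ} (hR : L < R) {lam : ℂ} (hl : lam ∈ oscDom) {b : ℝ}
    (hb : b ∈ Set.Icc (0 : ℝ) 1) {r : ℝ} (hr : L ≤ r) (hrR : r ≤ R) :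
    ‖oscComb (dirA ω L R lam b) (dirE ω L R lam b) lam b (ω * r)‖ ≤ 1 := by
  have h1 := dir_start hω hG hR hl hb
  have h2 : oscComb (dirA ω L R lam b) (dirE ω L R lam b) lam b (ω * R) = 0 := by
    rw [oscComb, dirA, dirE]; ring
  have hray := (solPair_oscComb (oscDom_norm hl) (abs_le_two_of_mem hb)
    (dirA ω L R lam b) (dirE ω L R lam b)).ray_zero ω
  have := hray.norm_anti
    (fun r hr hr' => hray.energy_nonpos_of_zero (hG lam hl b hb) h2 hr hr') hr hrR
  simpa [h1] using this

lemma dir_bound : ∃ B : ℝ, ∀ lam ∈ oscDom, ∀ b ∈ Set.Icc (0 : ℝ) 1, ∀ R, L + 1 ≤ R →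
    ‖dirA ω L R lam b‖ ≤ B ∧ ‖dirE ω L R lam b‖ ≤ B := by
  obtain ⟨K, hK0, hK⟩ := exists_oscSol_bound (ω * L)
  set T := ‖ω‖ * (|L| + 1) with hT
  set M := ‖ω‖ ^ 2 * (2 * (T ^ 2 + T ^ 3 + 1)) with hM
  refine ⟨K + (2 + M) / ‖ω‖ * K, fun lam hl b hb R hR => ?_⟩
  have hl2 := oscDom_norm hl
  have hb2 := abs_le_two_of_mem hb
  set a := dirA ω L R lam b with ha
  set e := dirE ω L R lam b with he
  have hp := solPair_oscComb hl2 hb2 a e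
  have h1 : oscComb a e lam b (ω * L) = 1 := dir_start hω hG (by linarith) hl hb
  have hω0 : 0 < ‖ω‖ := norm_pos_iff.2 hω
  have h2 : ‖ω * oscComb' a e lam b (ω * L)‖ ≤ (2 + M) * 1 := by
    refine (hp.ray_zero ω).deriv_bound (fun r hr hr' => ?_)
      (fun r hr hr' => dir_norm_le hω hG (by linarith) hl hb hr (by linarith))
    have hrT : ‖ω * (r : ℂ)‖ ≤ T := by
      rw [norm_mul, Complex.norm_real, Real.norm_eq_abs, hT]
      gcongr
      rw [abs_le]
      constructor
      · linarith [neg_abs_le L]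
      · linarith [le_abs_self L]
    have hb1 : ‖(b : ℂ)‖ ≤ 1 := by
      rw [Complex.norm_real, Real.norm_of_nonneg hb.1]; exact hb.2
    rw [norm_mul, norm_pow, oscPot, norm_mul, hM]
    gcongr
    refine (norm_sub_le _ _).trans ?_
    rw [norm_one]
    gcongr
    refine (norm_add_le _ _).trans ?_
    rw [norm_pow, norm_mul (b : ℂ), norm_pow]
    have hT0 : 0 ≤ T := by positivity
    calc ‖ω * (r : ℂ)‖ ^ 2 + ‖(b : ℂ)‖ * ‖ω * (r : ℂ)‖ ^ 3 ≤ T ^ 2 + 1 * T ^ 3 := by gcongr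
      _ = _ := by ring
  have h3 : ‖oscComb' a e lam b (ω * L)‖ ≤ (2 + M) / ‖ω‖ := by
    rw [le_div_iff₀ hω0, mul_comm, ← norm_mul]; linarith
  have hc := hK 1 0 lam b (by simp) (by simp) hl2 hb2
  have hs := hK 0 1 lam b (by simp) (by simp) hl2 hb2
  have hw := osc_wronskian hl2 hb2 (ω * L)
  have h1' := h1
  rw [oscComb] at h1'
  constructor
  · have : a = 1 * oscSol' 0 1 lam b (ω * L)
        - oscComb' a e lam b (ω * L) * oscSol 0 1 lam b (ω * L) := by
      rw [oscComb']
      linear_combination (-a) * hw + oscSol' 0 1 lam b (ω * L) * h1'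
    rw [this]
    refine (norm_sub_le _ _).trans ?_
    rw [one_mul, norm_mul]
    gcongr
    · exact hs.2
    · exact hs.1
  · have : e = oscComb' a e lam b (ω * L) * oscSol 1 0 lam b (ω * L)
        - 1 * oscSol' 1 0 lam b (ω * L) := by
      rw [oscComb']
      linear_combination (-e) * hw - oscSol' 1 0 lam b (ω * L) * h1'
    rw [this, add_comm]
    refine (norm_sub_le _ _).trans ?_
    rw [one_mul, norm_mul]
    gcongr
    · exact hc.1
    · exact hc.2

lemma BddNorm.unique {lam : ℂ} (hl : lam ∈ oscDom) {b : ℝ}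
    (hb : b ∈ Set.Icc (0 : ℝ) 1) {a e a' e' : ℂ} (h : BddNorm ω L lam b a e)
    (h' : BddNorm ω L lam b a' e') : a = a' ∧ e = e' := by
  have hl2 := oscDom_norm hl
  have hb2 := abs_le_two_of_mem hb
  have hsub : ∀ z, oscComb (a - a') (e - e') lam b z =
      oscComb a e lam b z - oscComb a' e' lam b z := fun z => by simp only [oscComb]; ring
  have h0 : oscComb (a - a') (e - e') lam b (ω * L) = 0 := by rw [hsub, h.1, h'.1, sub_self]
  have hz := ((solPair_oscComb hl2 hb2 (a - a') (e - e')).ray_zero ω).zero_of_bounded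
    (hG lam hl b hb) (B := 2) (fun r hr => by
      rw [hsub]
      exact (norm_sub_le _ _).trans (by linarith [h.2 r hr, h'.2 r hr])) h0
  have h1 := comb_eq_zero hl2 hb2 h0 ((mul_eq_zero.1 hz).resolve_left hω)
  exact ⟨sub_eq_zero.1 h1.1, sub_eq_zero.1 h1.2⟩

open Filter Topology in
lemma dir_ultrafilter_limit {ι : Type*} (g : Ultrafilter ι) {R b : ι → ℝ} {lam : ι → ℂ}
    {lam₁ : ℂ} {b₁ : ℝ} (hR : Tendsto R g atTop) (hb : Tendsto b g (𝓝 b₁))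
    (hlam : Tendsto lam g (𝓝 lam₁)) (hb' : ∀ᶠ i in (g : Filter ι), b i ∈ Set.Icc (0 : ℝ) 1)
    (hlam' : ∀ᶠ i in (g : Filter ι), lam i ∈ oscDom) (hl₁ : lam₁ ∈ oscDom)
    (hb₁ : b₁ ∈ Set.Icc (0 : ℝ) 1) :
    ∃ a₁ e₁, Tendsto (fun i => dirA ω L (R i) (lam i) (b i)) g (𝓝 a₁) ∧
      Tendsto (fun i => dirE ω L (R i) (lam i) (b i)) g (𝓝 e₁) ∧ BddNorm ω L lam₁ b₁ a₁ e₁ := by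
  obtain ⟨B, hB⟩ := dir_bound hω hG
  have hRL : ∀ᶠ i in (g : Filter ι), L + 1 ≤ R i := hR.eventually_ge_atTop _
  have hcpt := isCompact_closedBall (0 : ℂ) B
  have hA : ∀ᶠ i in (g : Filter ι), dirA ω L (R i) (lam i) (b i) ∈ Metric.closedBall (0 : ℂ) B := by
    filter_upwards [hRL, hb', hlam'] with i h1 h2 h3
    simpa using (hB _ h3 _ h2 _ h1).1
  have hE : ∀ᶠ i in (g : Filter ι), dirE ω L (R i) (lam i) (b i) ∈ Metric.closedBall (0 : ℂ) B := by
    filter_upwards [hRL, hb', hlam'] with i h1 h2 h3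
    simpa using (hB _ h3 _ h2 _ h1).2
  obtain ⟨a₁, -, ha⟩ := hcpt.ultrafilter_le_nhds'
    (g.map (fun i => dirA ω L (R i) (lam i) (b i))) hA
  obtain ⟨e₁, -, he⟩ := hcpt.ultrafilter_le_nhds'
    (g.map (fun i => dirE ω L (R i) (lam i) (b i))) hE
  have ha' : Tendsto (fun i => dirA ω L (R i) (lam i) (b i)) g (𝓝 a₁) := ha
  have he' : Tendsto (fun i => dirE ω L (R i) (lam i) (b i)) g (𝓝 e₁) := he
  have hev : ∀ᶠ i in (g : Filter ι), ‖lam i‖ ≤ 2 ∧ |b i| ≤ 2 := by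
    filter_upwards [hb', hlam'] with i h1 h2
    exact ⟨oscDom_norm h2, abs_le_two_of_mem h1⟩
  have hlim : ∀ z, Tendsto (fun i => oscComb (dirA ω L (R i) (lam i) (b i))
      (dirE ω L (R i) (lam i) (b i)) (lam i) (b i) z) g (𝓝 (oscComb a₁ e₁ lam₁ b₁ z)) := fun z =>
    (ha'.mul (tendsto_oscSol hlam hb hev ⟨oscDom_norm hl₁, abs_le_two_of_mem hb₁⟩
      (by simp) (by simp) z)).add
    (he'.mul (tendsto_oscSol hlam hb hev ⟨oscDom_norm hl₁, abs_le_two_of_mem hb₁⟩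
      (by simp) (by simp) z))
  refine ⟨a₁, e₁, ha', he', ?_, fun r hr => ?_⟩
  · refine tendsto_nhds_unique (hlim (ω * L)) (tendsto_const_nhds.congr' ?_)
    filter_upwards [hRL, hb', hlam'] with i h1 h2 h3
    exact (dir_start hω hG (by linarith) h3 h2).symm
  · refine le_of_tendsto (hlim (ω * r)).norm ?_
    filter_upwards [hRL, hb', hlam', hR.eventually_ge_atTop r] with i h1 h2 h3 h4
    exact dir_norm_le hω hG (by linarith) h3 h2 hr h4

open Filter Topology in
lemma dir_tendsto {ι : Type*} {l : Filter ι} {R b : ι → ℝ} {lam : ι → ℂ}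
    {lam₁ : ℂ} {b₁ : ℝ} (hR : Tendsto R l atTop) (hb : Tendsto b l (𝓝 b₁))
    (hlam : Tendsto lam l (𝓝 lam₁)) (hb' : ∀ᶠ i in l, b i ∈ Set.Icc (0 : ℝ) 1)
    (hlam' : ∀ᶠ i in l, lam i ∈ oscDom) (hl₁ : lam₁ ∈ oscDom)
    (hb₁ : b₁ ∈ Set.Icc (0 : ℝ) 1) {a₁ e₁ : ℂ} (h : BddNorm ω L lam₁ b₁ a₁ e₁) :
    Tendsto (fun i => dirA ω L (R i) (lam i) (b i)) l (𝓝 a₁) ∧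
      Tendsto (fun i => dirE ω L (R i) (lam i) (b i)) l (𝓝 e₁) := by
  have key : ∀ g : Ultrafilter ι, (g : Filter ι) ≤ l →
      Tendsto (fun i => dirA ω L (R i) (lam i) (b i)) g (𝓝 a₁) ∧
      Tendsto (fun i => dirE ω L (R i) (lam i) (b i)) g (𝓝 e₁) := by
    intro g hg
    obtain ⟨a, e, ha, he, hae⟩ := dir_ultrafilter_limit hω hG g (hR.mono_left hg) (hb.mono_left hg)
      (hlam.mono_left hg) (hg hb') (hg hlam') hl₁ hb₁
    obtain ⟨rfl, rfl⟩ := hae.unique hω hG hl₁ hb₁ h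
    exact ⟨ha, he⟩
  exact ⟨tendsto_iff_ultrafilter _ _ _ |>.2 fun g hg => (key g hg).1,
    tendsto_iff_ultrafilter _ _ _ |>.2 fun g hg => (key g hg).2⟩

open Filter Topology in
lemma exists_bddNorm {lam : ℂ} (hl : lam ∈ oscDom) {b : ℝ}
    (hb : b ∈ Set.Icc (0 : ℝ) 1) : ∃ a e, BddNorm ω L lam b a e := by
  obtain ⟨a, e, -, -, h⟩ := dir_ultrafilter_limit hω hG (Ultrafilter.of (atTop : Filter ℝ))
    (R := id) (b := fun _ => b) (lam := fun _ => lam) (Ultrafilter.of_le _) tendsto_const_nhds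
    tendsto_const_nhds (Eventually.of_forall fun _ => hb) (Eventually.of_forall fun _ => hl) hl hb
  exact ⟨a, e, h⟩

lemma dir_differentiableOn {R : ℝ} (hR : L < R) {b : ℝ} (hb : b ∈ Set.Icc (0 : ℝ) 1) :
    DifferentiableOn ℂ (fun lam => dirA ω L R lam b) oscDom ∧
    DifferentiableOn ℂ (fun lam => dirE ω L R lam b) oscDom := by
  have hb2 := abs_le_two_of_mem hb
  have hsub : oscDom ⊆ Metric.ball 0 2 := fun x hx => by simpa using hx.2.2
  have hc : ∀ z, DifferentiableOn ℂ (fun lam => oscSol 1 0 lam b z) oscDom := fun z =>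
    (differentiableOn_oscSol (by simp) (by simp) hb2 z).mono hsub
  have hs : ∀ z, DifferentiableOn ℂ (fun lam => oscSol 0 1 lam b z) oscDom := fun z =>
    (differentiableOn_oscSol (by simp) (by simp) hb2 z).mono hsub
  have hd : DifferentiableOn ℂ (fun lam => dirDen ω L R lam b) oscDom :=
    ((hc _).mul (hs _)).sub ((hs _).mul (hc _))
  exact ⟨(hs _).neg.div hd fun lam hl => dirDen_ne hω hG hR hl hb,
    (hc _).div hd fun lam hl => dirDen_ne hω hG hR hl hb⟩

end

lemma goodDir_right : GoodDir 1 3 := by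
  intro lam hl b hb r hr
  have h1 : (1 : ℂ) ^ 2 * oscPot lam b (1 * r) = ((r ^ 2 + b * r ^ 3 - 1 : ℝ) : ℂ) * lam := by
    rw [oscPot]; push_cast; ring
  rw [h1, Complex.re_ofReal_mul]
  have h2 : 8 ≤ r ^ 2 + b * r ^ 3 - 1 := by
    have : 0 ≤ b * r ^ 3 := mul_nonneg hb.1 (by positivity)
    nlinarith
  nlinarith [hl.1]

/-- The direction of the left ray is `-oscDir`. -/
noncomputable def oscDir : ℂ := 8 + 3 * I

lemma oscDir_pot (lam : ℂ) (b r : ℝ) : (-oscDir) ^ 2 * oscPot lam b (-oscDir * r) =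
    lam * (((721 : ℝ) + (5280 : ℝ) * I) * ((r ^ 2 : ℝ) : ℂ) - ((55 : ℝ) + (48 : ℝ) * I)
      + ((10072 : ℝ) - (44403 : ℝ) * I) * ((b * r ^ 3 : ℝ) : ℂ)) := by
  have hI := Complex.I_sq
  rw [oscPot, oscDir]
  push_cast
  have h2 : (8 + 3 * I) ^ 2 = 55 + 48 * I := by linear_combination 9 * hI
  have h4 : (8 + 3 * I) ^ 4 = 721 + 5280 * I := by
    rw [show (4 : ℕ) = 2 * 2 by norm_num, pow_mul, h2]; linear_combination 2304 * hI
  have h5 : (8 + 3 * I) ^ 5 = -10072 + 44403 * I := by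
    rw [pow_succ, h4]; linear_combination 15840 * hI
  calc (-(8 + 3 * I)) ^ 2 * (lam * ((-(8 + 3 * I) * (r : ℂ)) ^ 2
        + b * (-(8 + 3 * I) * (r : ℂ)) ^ 3 - 1))
      = lam * ((8 + 3 * I) ^ 4 * r ^ 2 - (8 + 3 * I) ^ 2 - (8 + 3 * I) ^ 5 * (b * r ^ 3)) := by ring
    _ = _ := by rw [h2, h4, h5]; ring

lemma goodDir_left : GoodDir (-oscDir) 3 := by
  intro lam hl b hb r hr
  rw [oscDir_pot]
  obtain ⟨h1, h2, -⟩ := hl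
  rw [abs_lt] at h2
  simp only [Complex.mul_re, Complex.sub_re, Complex.add_re, Complex.ofReal_re, Complex.ofReal_im,
    Complex.I_re, Complex.I_im, Complex.mul_im, Complex.sub_im, Complex.add_im]
  have h3 : 0 ≤ b * r ^ 3 := mul_nonneg hb.1 (by positivity)
  have h4 : 9 ≤ r ^ 2 := by nlinarith
  have e1 : 668 * lam.re ≤ 721 * lam.re - 5280 * lam.im := by linarith
  have e2 : 55 * lam.re - 48 * lam.im ≤ 56 * lam.re := by linarith
  have e3 : 0 ≤ 10072 * lam.re + 44403 * lam.im := by linarith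
  nlinarith [mul_nonneg e3 h3, mul_le_mul_of_nonneg_right e1 (sq_nonneg r)]

section
variable {V u v : ℝ → ℂ} {L : ℝ}

lemma RaySol.exists_small (h : RaySol V u v) {c : ℝ} (hc : 0 < c) (hc1 : c ≤ 1)
    (hV : ∀ r, L ≤ r → 1 ≤ (V r).re) (hV' : ∀ r, L ≤ r → c * r ^ 2 ≤ (V r).re) {B : ℝ}
    (hB : ∀ r, L ≤ r → ‖u r‖ ≤ B) {ε : ℝ} (hε : 0 < ε) :
    ∃ r, L ≤ r ∧ ‖v r‖ ^ 2 + r ^ 2 * ‖u r‖ ^ 2 < ε := by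
  by_contra! hcon
  have hN : ∀ r, HasDerivAt (fun r => (starRingEnd ℂ (u r) * v r).re)
      (‖v r‖ ^ 2 + (V r).re * ‖u r‖ ^ 2) r := fun r => by
    simpa using h.hasDerivAt_energy 1 r
  set N := fun r => (starRingEnd ℂ (u r) * v r).re with hNdef
  have key : ∀ x, L ≤ x → c * ε * (x - L) ≤ N x - N L := by
    intro x hx
    refine (convex_Ici L).mul_sub_le_image_sub_of_le_deriv
      (fun y _ => (hN y).continuousAt.continuousWithinAt)
      (fun y _ => (hN y).differentiableAt.differentiableWithinAt)
      (fun y hy => ?_) L Set.self_mem_Ici x hx hx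
    rw [interior_Ici] at hy
    rw [(hN y).deriv]
    have h1 := hcon y (le_of_lt hy)
    have h2 := mul_le_mul_of_nonneg_right (hV' y (le_of_lt hy)) (sq_nonneg ‖u y‖)
    have h3 : c * ‖v y‖ ^ 2 ≤ ‖v y‖ ^ 2 := by nlinarith [sq_nonneg ‖v y‖]
    nlinarith
  have hx : L ≤ L + (1 + |N L|) / (c * ε) := by
    have : 0 ≤ (1 + |N L|) / (c * ε) := by positivity
    linarith
  have h1 := key _ hx
  have h2 : c * ε * (L + (1 + |N L|) / (c * ε) - L) = 1 + |N L| := by field_simp; ring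
  have h3 : N (L + (1 + |N L|) / (c * ε)) ≤ 0 := h.energy_nonpos hV hB hx
  have h4 := neg_abs_le (N L)
  linarith

lemma RaySol.hasDerivAt_weighted (h : RaySol V u v) (β : ℂ) (κ : ℝ) (r : ℝ) :
    HasDerivAt (fun r => (β * (starRingEnd ℂ (u r) * v r)).re + κ * r * ‖u r‖ ^ 2)
      (β.re * ‖v r‖ ^ 2 + ((β * V r).re + κ) * ‖u r‖ ^ 2
        + 2 * κ * r * (starRingEnd ℂ (u r) * v r).re) r := by
  have h1 : HasDerivAt (fun r : ℝ => κ * r) κ r := by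
    simpa using (hasDerivAt_id r).const_mul κ
  refine ((h.hasDerivAt_energy β r).add (h1.mul (h.hasDerivAt_normSq r))).congr_deriv ?_
  ring

lemma RaySol.weighted_nonpos (h : RaySol V u v) {c : ℝ} (hc : 0 < c) (hc1 : c ≤ 1)
    (hV : ∀ r, L ≤ r → 1 ≤ (V r).re) (hV' : ∀ r, L ≤ r → c * r ^ 2 ≤ (V r).re) {B : ℝ}
    (hB : ∀ r, L ≤ r → ‖u r‖ ≤ B) {β : ℂ} {κ η : ℝ} (hη : 0 < η)
    (hpos : ∀ r, 0 ≤ r → η * ‖u r‖ ^ 2 ≤ β.re * ‖v r‖ ^ 2 + ((β * V r).re + κ) * ‖u r‖ ^ 2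
        + 2 * κ * r * (starRingEnd ℂ (u r) * v r).re) :
    MonotoneOn (fun r => (β * (starRingEnd ℂ (u r) * v r)).re + κ * r * ‖u r‖ ^ 2) (Set.Ici 0) ∧
    ∀ r, 0 ≤ r → (β * (starRingEnd ℂ (u r) * v r)).re + κ * r * ‖u r‖ ^ 2 ≤ 0 := by
  have hmono : MonotoneOn (fun r => (β * (starRingEnd ℂ (u r) * v r)).re + κ * r * ‖u r‖ ^ 2)
      (Set.Ici 0) := by
    refine monotoneOn_of_hasDerivWithinAt_nonneg (convex_Ici 0)
      (fun r _ => (h.hasDerivAt_weighted β κ r).continuousAt.continuousWithinAt)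
      (fun r _ => (h.hasDerivAt_weighted β κ r).hasDerivWithinAt) fun r hr => ?_
    rw [interior_Ici] at hr
    have := hpos r (le_of_lt hr)
    have : 0 ≤ η * ‖u r‖ ^ 2 := by positivity
    linarith
  refine ⟨hmono, fun r hr => ?_⟩
  by_contra! hc0
  set H := fun r => (β * (starRingEnd ℂ (u r) * v r)).re + κ * r * ‖u r‖ ^ 2 with hH
  set L' := max L (max r 1) with hL'
  have hL1 : L ≤ L' := le_max_left _ _
  have hL2 : r ≤ L' := (le_max_left _ _).trans (le_max_right _ _)
  have hL3 : 1 ≤ L' := (le_max_right _ _).trans (le_max_right _ _)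
  set ε := H r / (‖β‖ + |κ| + 1) with hε
  have hε0 : 0 < ε := by
    have : 0 < H r := hc0
    positivity
  obtain ⟨x, hx, hxε⟩ := h.exists_small (L := L') hc hc1 (fun r hr => hV r (hL1.trans hr))
    (fun r hr => hV' r (hL1.trans hr)) (fun r hr => hB r (hL1.trans hr)) hε0
  have h1 : H r ≤ H x := hmono (Set.mem_Ici.2 hr) (Set.mem_Ici.2 (hr.trans (hL2.trans hx)))
    (hL2.trans hx)
  have hx1 : 1 ≤ x := hL3.trans hx
  set E := ‖v x‖ ^ 2 + x ^ 2 * ‖u x‖ ^ 2 with hE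
  have hu2 : ‖u x‖ ^ 2 ≤ x ^ 2 * ‖u x‖ ^ 2 := by
    have : 1 ≤ x ^ 2 := by nlinarith
    nlinarith [sq_nonneg ‖u x‖]
  have hxu : x * ‖u x‖ ^ 2 ≤ x ^ 2 * ‖u x‖ ^ 2 := by
    have : x ≤ x ^ 2 := by nlinarith
    nlinarith [sq_nonneg ‖u x‖]
  have h2 : (β * (starRingEnd ℂ (u x) * v x)).re ≤ ‖β‖ * E := by
    refine (Complex.re_le_norm _).trans ?_
    rw [norm_mul, norm_mul, RCLike.norm_conj]
    gcongr
    nlinarith [sq_nonneg (‖u x‖ - ‖v x‖), sq_nonneg ‖u x‖, sq_nonneg ‖v x‖]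
  have h3 : κ * x * ‖u x‖ ^ 2 ≤ |κ| * E := by
    have h5 : 0 ≤ x * ‖u x‖ ^ 2 := by positivity
    have h6 : x * ‖u x‖ ^ 2 ≤ E := by rw [hE]; nlinarith [sq_nonneg ‖v x‖]
    calc κ * x * ‖u x‖ ^ 2 = κ * (x * ‖u x‖ ^ 2) := by ring
      _ ≤ |κ| * (x * ‖u x‖ ^ 2) := by gcongr; exact le_abs_self κ
      _ ≤ _ := by gcongr
  have h4 : H x ≤ (‖β‖ + |κ|) * E := by
    have : H x = (β * (starRingEnd ℂ (u x) * v x)).re + κ * x * ‖u x‖ ^ 2 := rfl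
    rw [this, add_mul]; exact add_le_add h2 h3
  have h7 : (‖β‖ + |κ|) * E ≤ (‖β‖ + |κ| + 1) * E := by
    have : 0 ≤ E := by positivity
    linarith
  have h8 : (‖β‖ + |κ| + 1) * E < H r := by
    have hp : 0 < ‖β‖ + |κ| + 1 := by positivity
    rw [hε, lt_div_iff₀ hp] at hxε
    linarith
  linarith

end

lemma quarter_mem_oscDom : (1 / 4 : ℂ) ∈ oscDom := by
  have h : (1 / 4 : ℂ) = ((1 / 4 : ℝ) : ℂ) := by push_cast; ring
  rw [h]
  refine ⟨?_, ?_, ?_⟩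
  · rw [Complex.ofReal_re]; norm_num
  · rw [Complex.ofReal_re, Complex.ofReal_im]; norm_num
  · rw [Complex.norm_real]; norm_num

lemma one_mem_oscDom : (1 : ℂ) ∈ oscDom := by
  refine ⟨?_, ?_, ?_⟩ <;> norm_num

lemma quarter_pot_right (r : ℝ) :
    (1 : ℂ) ^ 2 * oscPot (1 / 4) 0 (1 * r) = (((r ^ 2 - 1) / 4 : ℝ) : ℂ) := by
  rw [oscPot]; push_cast; ring

lemma oscDir_inv_quarter_pot (r : ℝ) :
    (((8 - 3 * I) / 73) * ((-oscDir) ^ 2 * oscPot (1 / 4) 0 (-oscDir * r))).re =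
      74 * r ^ 2 - 2 := by
  rw [oscDir_pot]
  have hI := Complex.I_sq
  have : ((8 - 3 * I) / 73) * (1 / 4 * (((721 : ℝ) + (5280 : ℝ) * I) * ((r ^ 2 : ℝ) : ℂ)
      - ((55 : ℝ) + (48 : ℝ) * I) + ((10072 : ℝ) - (44403 : ℝ) * I) * ((0 * r ^ 3 : ℝ) : ℂ)))
      = ((74 * r ^ 2 - 2 : ℝ) : ℂ) + ((549 / 4 * r ^ 2 - 3 / 4 : ℝ) : ℂ) * I := by
    push_cast
    linear_combination (-(15840 * (r : ℂ) ^ 2 - 144) / 292) * hI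
  rw [this, Complex.add_re, Complex.ofReal_re, Complex.re_ofReal_mul, Complex.I_re]
  ring

lemma quarter_not_bounded {a e : ℂ} {B B' : ℝ}
    (hB : ∀ r : ℝ, 3 ≤ r → ‖oscComb a e (1 / 4) 0 (1 * r)‖ ≤ B)
    (hB' : ∀ r : ℝ, 3 ≤ r → ‖oscComb a e (1 / 4) 0 (-oscDir * r)‖ ≤ B') :
    ∀ z, oscComb a e (1 / 4) 0 z = 0 := by
  have hl2 := oscDom_norm quarter_mem_oscDom
  have hb0 : (0 : ℝ) ∈ Set.Icc (0 : ℝ) 1 := by simp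
  have hb2 : |(0 : ℝ)| ≤ 2 := by simp
  have hp := solPair_oscComb hl2 hb2 a e
  have hr := hp.ray_zero 1
  have hl := hp.ray_zero (-oscDir)
  obtain ⟨-, hL⟩ := hl.weighted_nonpos (c := 1) (L := 3) one_pos le_rfl
    (goodDir_left _ quarter_mem_oscDom 0 hb0) (fun r hr => by
      rw [oscDir_pot]
      have : (1 / 4 : ℂ) = ((1 / 4 : ℝ) : ℂ) := by push_cast; ring
      rw [this, Complex.re_ofReal_mul]
      simp only [Complex.mul_re, Complex.sub_re, Complex.add_re, Complex.ofReal_re,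
        Complex.ofReal_im, Complex.I_re, Complex.I_im, Complex.mul_im, Complex.sub_im,
        Complex.add_im]
      nlinarith) hB' (β := (8 - 3 * I) / 73) (κ := 9 / 4) (η := 1 / 4)
    (by norm_num) (fun r hr => by
      rw [oscDir_inv_quarter_pot]
      have hre : ((8 - 3 * I) / 73 : ℂ).re = 8 / 73 := by
        have : ((8 - 3 * I) / 73 : ℂ) = ((8 / 73 : ℝ) : ℂ) + ((-3 / 73 : ℝ) : ℂ) * I := by
          push_cast; ring
        rw [this]; simp
      rw [hre]
      generalize oscComb a e (1 / 4) 0 (-oscDir * r) = x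
      generalize -oscDir * oscComb' a e (1 / 4) 0 (-oscDir * r) = y
      have h1 := (abs_le.1 (abs_re_conj_mul_le x y)).1
      have h2 := mul_le_mul_of_nonneg_left h1 hr
      nlinarith [sq_nonneg (‖y‖ / 4 - 9 * r * ‖x‖), sq_nonneg (‖y‖), sq_nonneg (r * ‖x‖)])
  obtain ⟨hmono, hR⟩ := hr.weighted_nonpos (c := 1 / 8) (L := 3) (by norm_num) (by norm_num)
    (goodDir_right _ quarter_mem_oscDom 0 hb0) (fun r hr => by
      rw [quarter_pot_right, Complex.ofReal_re]
      nlinarith) hB (β := 1) (κ := 1 / 2) (η := 1 / 4)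
    (by norm_num) (fun r hr => by
      rw [quarter_pot_right, one_mul ((((r ^ 2 - 1) / 4 : ℝ)) : ℂ), Complex.ofReal_re,
        Complex.one_re]
      generalize oscComb a e (1 / 4) 0 (1 * r) = x
      generalize 1 * oscComb' a e (1 / 4) 0 (1 * r) = y
      have h1 := (abs_le.1 (abs_re_conj_mul_le x y)).1
      have h2 := mul_le_mul_of_nonneg_left h1 hr
      nlinarith [sq_nonneg (‖y‖ - r * ‖x‖ / 2)])
  have hz : ∀ r : ℝ, 1 ≤ r → r ≤ 2 → oscComb a e (1 / 4) 0 (1 * r) = 0 := by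
    have hL0 := hL 0 le_rfl
    have hd0 : (8 - 3 * I) / 73 * -oscDir = -1 := by
      rw [oscDir]
      linear_combination (9 / 73) * Complex.I_sq
    have h0 : 0 ≤ (1 * (starRingEnd ℂ (oscComb a e (1 / 4) 0 (1 * (0 : ℝ))) *
        (1 * oscComb' a e (1 / 4) 0 (1 * (0 : ℝ))))).re := by
      simp only [ofReal_zero, mul_zero, zero_mul, add_zero, one_mul] at hL0 ⊢
      have : (8 - 3 * I) / 73 * ((starRingEnd ℂ) (oscComb a e (1 / 4) 0 0) *
          (-oscDir * oscComb' a e (1 / 4) 0 0)) = -((starRingEnd ℂ) (oscComb a e (1 / 4) 0 0) *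
          oscComb' a e (1 / 4) 0 0) := by
        linear_combination ((starRingEnd ℂ) (oscComb a e (1 / 4) 0 0) *
          oscComb' a e (1 / 4) 0 0) * hd0
      rw [this, Complex.neg_re] at hL0
      linarith
    set H := fun r : ℝ => (1 * ((starRingEnd ℂ) (oscComb a e (1 / 4) 0 (1 * r)) *
      (1 * oscComb' a e (1 / 4) 0 (1 * r)))).re +
        1 / 2 * r * ‖oscComb a e (1 / 4) 0 (1 * r)‖ ^ 2 with hH
    have hH0 : ∀ r : ℝ, 0 ≤ r → H r = 0 := by
      intro r hr0
      refine le_antisymm (hR r hr0) ?_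
      refine le_trans ?_ (hmono Set.self_mem_Ici (Set.mem_Ici.2 hr0) hr0)
      simpa [hH] using h0
    intro r h1 h2
    have hd := hr.hasDerivAt_weighted 1 (1 / 2) r
    have hd' : HasDerivAt H 0 r := (hasDerivAt_const r (0 : ℝ)).congr_of_eventuallyEq
      (Filter.eventually_of_mem (Ici_mem_nhds (by linarith : 0 < r)) fun y hy => hH0 y hy)
    have heq := hd.unique hd'
    rw [quarter_pot_right, one_mul ((((r ^ 2 - 1) / 4 : ℝ)) : ℂ), Complex.ofReal_re,
        Complex.one_re] at heq
    rw [← norm_eq_zero]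
    generalize oscComb a e (1 / 4) 0 (1 * r) = x at *
    generalize 1 * oscComb' a e (1 / 4) 0 (1 * r) = y at *
    have h1 := (abs_le.1 (abs_re_conj_mul_le x y)).1
    have h2 := mul_le_mul_of_nonneg_left h1 (by linarith : 0 ≤ r)
    nlinarith [sq_nonneg (‖y‖ - r * ‖x‖ / 2), sq_nonneg ‖x‖]
  have hv := hr.eq_zero_of_norm (by norm_num : (1 : ℝ) < 2) hz
  exact hp.eq_zero_of_point hl2 hb2 (z₀ := 1 * (1 : ℝ)) (hz 1 le_rfl (by norm_num))
    (by simpa using hv)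

lemma solPair_gaussian : SolPair (oscPot 1 0) (fun z => Complex.exp (-z ^ 2 / 2))
    (fun z => -z * Complex.exp (-z ^ 2 / 2)) := by
  have h1 : ∀ z : ℂ, HasDerivAt (fun z : ℂ => Complex.exp (-z ^ 2 / 2))
      (-z * Complex.exp (-z ^ 2 / 2)) z := fun z => by
    have h2 : HasDerivAt (fun z : ℂ => -z ^ 2 / 2) (-z) z := by
      refine (((hasDerivAt_pow 2 z).neg).div_const 2).congr_deriv ?_
      simp; ring
    refine h2.cexp.congr_deriv (by ring)
  refine ⟨h1, fun z => ?_⟩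
  refine ((hasDerivAt_neg z).mul (h1 z)).congr_deriv ?_
  rw [oscPot]
  push_cast
  ring

lemma bddNorm_gaussian {ω : ℂ} {L : ℝ} (hω : 0 ≤ (ω ^ 2).re) (hL : 0 ≤ L) :
    BddNorm ω L 1 0 (1 / oscSol 1 0 1 0 (ω * L)) 0 := by
  have hC : ∀ z, oscSol 1 0 1 0 z = Complex.exp (-z ^ 2 / 2) := fun z => by
    have := solPair_gaussian.eq_comb (by simp) (by simp) z
    simpa using this.symm
  have hne : oscSol 1 0 1 0 (ω * L) ≠ 0 := by rw [hC]; exact Complex.exp_ne_zero _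
  refine ⟨?_, fun r hr => ?_⟩
  · rw [oscComb]; field_simp; ring
  · rw [oscComb, zero_mul, add_zero, norm_mul, norm_div, norm_one, hC, hC, Complex.norm_exp,
      Complex.norm_exp, one_div, ← Real.exp_neg, ← Real.exp_add, Real.exp_le_one_iff]
    have h : ∀ x : ℝ, (-(ω * x) ^ 2 / 2).re = -(ω ^ 2).re * x ^ 2 / 2 := fun x => by
      have : -(ω * (x : ℂ)) ^ 2 / 2 = ((-x ^ 2 / 2 : ℝ) : ℂ) * ω ^ 2 := by push_cast; ring
      rw [this, Complex.re_ofReal_mul]; ring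
    rw [h, h]
    have : L ^ 2 ≤ r ^ 2 := by gcongr
    nlinarith

section Hurwitz
open Filter Topology

lemma limit_continuousOn_of_joint {ι : Type*} {l : Filter ι} [l.NeBot] {F : ι → ℂ → ℂ}
    {f : ℂ → ℂ} {U : Set ℂ}
    (hlim : ∀ x ∈ U, Tendsto (fun y : ι × ℂ => F y.1 y.2) (l ×ˢ 𝓝[U] x) (𝓝 (f x))) :
    ContinuousOn f U := by
  intro x hx
  rw [ContinuousWithinAt, Metric.tendsto_nhds]
  intro ε hε
  have h1 := (Metric.tendsto_nhds.1 (hlim x hx)) (ε / 2) (by positivity)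
  rw [prod_comm, eventually_map] at h1
  filter_upwards [h1.curry, self_mem_nhdsWithin] with y hy hyU
  have h2 : Tendsto (fun i => F i y) l (𝓝 (f y)) :=
    (hlim y hyU).comp (tendsto_id.prodMk
      ((tendsto_const_pure.mono_right (pure_le_nhdsWithin hyU) : Tendsto (fun _ : ι => y) l (𝓝[U] y))))
  have h3 : dist (f y) (f x) ≤ ε / 2 :=
    le_of_tendsto (h2.dist tendsto_const_nhds) (hy.mono fun i hi => le_of_lt hi)
  linarith

lemma tendstoLocallyUniformlyOn_of_joint {ι : Type*} {l : Filter ι} [l.NeBot] {F : ι → ℂ → ℂ}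
    {f : ℂ → ℂ} {U : Set ℂ}
    (hlim : ∀ x ∈ U, Tendsto (fun y : ι × ℂ => F y.1 y.2) (l ×ˢ 𝓝[U] x) (𝓝 (f x))) :
    TendstoLocallyUniformlyOn F f l U := by
  rw [tendstoLocallyUniformlyOn_iff_forall_tendsto]
  intro x hx
  have hc := limit_continuousOn_of_joint hlim x hx
  refine Tendsto.mono_right ?_ (nhds_le_uniformity (f x))
  exact (hc.tendsto.comp tendsto_snd).prodMk_nhds (hlim x hx)

/-- A Hurwitz-type theorem: an isolated zero of a limit of holomorphic functions attracts zeros. -/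
lemma exists_zero_near {ι : Type*} {l : Filter ι} [l.NeBot] {F : ι → ℂ → ℂ}
    {f : ℂ → ℂ} {U : Set ℂ} (hU : IsOpen U) (hUc : IsPreconnected U)
    (hF : ∀ᶠ i in l, DifferentiableOn ℂ (F i) U)
    (hlim : ∀ x ∈ U, Tendsto (fun y : ι × ℂ => F y.1 y.2) (l ×ˢ 𝓝[U] x) (𝓝 (f x)))
    {x₀ x₁ : ℂ} (h₀ : x₀ ∈ U) (h₁ : x₁ ∈ U) (hf₀ : f x₀ = 0) (hf₁ : f x₁ ≠ 0) :
    ∃ K ⊆ U, IsCompact K ∧ ∀ᶠ i in l, ∃ x ∈ K, F i x = 0 := by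
  have hloc := tendstoLocallyUniformlyOn_of_joint hlim
  have hfd : DifferentiableOn ℂ f U := hloc.differentiableOn hF hU
  have hfa := hfd.analyticOnNhd hU
  have hne : ∀ᶠ z in 𝓝[≠] x₀, f z ≠ 0 := by
    by_contra hcon
    exact hf₁ (hfa.eqOn_zero_of_preconnected_of_frequently_eq_zero hUc h₀
      hcon h₁)
  rw [eventually_nhdsWithin_iff] at hne
  obtain ⟨r, hr, hrU⟩ := Metric.eventually_nhds_iff_ball.1 (hne.and (hU.mem_nhds h₀))
  have hsub : Metric.closedBall x₀ (r / 2) ⊆ U := fun z hz =>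
    (hrU z (Metric.closedBall_subset_ball (by linarith) hz)).2
  have hsph : ∀ z ∈ Metric.sphere x₀ (r / 2), f z ≠ 0 := fun z hz =>
    (hrU z (Metric.sphere_subset_ball (by linarith) hz)).1
      (fun h => by rw [Set.mem_singleton_iff.1 h] at hz; simp at hz; linarith)
  have hsc : IsCompact (Metric.sphere x₀ (r / 2)) := isCompact_sphere _ _
  have hsne : (Metric.sphere x₀ (r / 2)).Nonempty := NormedSpace.sphere_nonempty.2 (by linarith)
  obtain ⟨z₁, hz₁, hmin⟩ := hsc.exists_isMinOn hsne
    ((hfd.continuousOn.mono (Metric.sphere_subset_closedBall.trans hsub)).norm)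
  set ε := ‖f z₁‖ / 4 with hε
  have hεpos : 0 < ε := by have := norm_pos_iff.2 (hsph z₁ hz₁); positivity
  have hmin' : ∀ z ∈ Metric.sphere x₀ (r / 2), 4 * ε ≤ ‖f z‖ := fun z hz => by
    have := isMinOn_iff.1 hmin z hz
    rw [hε]; linarith
  refine ⟨_, hsub, isCompact_closedBall _ _, ?_⟩
  have hunif := (tendstoLocallyUniformlyOn_iff_forall_isCompact hU).1 hloc _ hsub
    (isCompact_closedBall _ _)
  filter_upwards [Metric.tendstoUniformlyOn_iff.1 hunif ε hεpos, hF] with i hi hFi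
  have hx₀ := hi x₀ (Metric.mem_closedBall_self (by linarith))
  rw [hf₀, dist_zero_left] at hx₀
  have hdiff : ∀ z ∈ Metric.sphere x₀ (r / 2), 2 * ε ≤ ‖F i z - F i x₀‖ := fun z hz => by
    have h1 := hi z (Metric.sphere_subset_closedBall hz)
    have h2 := hmin' z hz
    rw [dist_eq_norm] at h1
    have h3 : f z = (f z - F i z) + (F i z - F i x₀) + F i x₀ := by ring
    have h4 := norm_add₃_le (a := f z - F i z) (b := F i z - F i x₀) (c := F i x₀)
    rw [← h3] at h4
    linarith
  have hD : DiffContOnCl ℂ (F i) (Metric.ball x₀ (r / 2)) := by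
    refine (hFi.mono ?_).diffContOnCl
    rw [closure_ball _ (by linarith)]
    exact hsub
  have hfreq : ∃ᶠ z in 𝓝 x₀, F i z ≠ F i x₀ := by
    intro hcon
    have hcon' : ∀ᶠ z in 𝓝 x₀, F i z = F i x₀ := by simpa using hcon
    have := (hFi.analyticOnNhd hU).eqOn_of_preconnected_of_eventuallyEq
      (g := fun _ => F i x₀) analyticOnNhd_const hUc h₀ hcon'
    obtain ⟨z, hz⟩ := hsne
    have h1 := hdiff z hz
    rw [this (hsub (Metric.sphere_subset_closedBall hz)), sub_self, norm_zero] at h1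
    linarith
  have himg := hD.ball_subset_image_closedBall (by linarith) hdiff hfreq
  obtain ⟨x, hx, hx0⟩ := himg (show (0 : ℂ) ∈ Metric.ball (F i x₀) (2 * ε / 2) by
    rw [Metric.mem_ball, dist_zero_left]; linarith)
  exact ⟨x, hx, hx0⟩

end Hurwitz

section Existence
open Filter Topology

lemma isOpen_oscDom : IsOpen oscDom := by
  refine (isOpen_lt continuous_const Complex.continuous_re).inter
    ((isOpen_lt Complex.continuous_im.abs (Complex.continuous_re.div_const _)).inter
      (isOpen_lt continuous_norm continuous_const))

lemma convex_oscDom : Convex ℝ oscDom := by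
  rintro x ⟨hx1, hx2, hx3⟩ y ⟨hy1, hy2, hy3⟩ p q hp hq hpq
  have hre : (p • x + q • y).re = p * x.re + q * y.re := by simp
  have him : (p • x + q • y).im = p * x.im + q * y.im := by simp
  refine ⟨?_, ?_, ?_⟩
  · rw [hre]
    rcases hp.eq_or_lt with rfl | hp
    · rw [zero_add] at hpq; subst hpq; linarith
    · nlinarith
  · rw [hre, him]
    refine (abs_add_le _ _).trans_lt ?_
    rw [abs_mul, abs_mul, abs_of_nonneg hp, abs_of_nonneg hq]
    rcases hp.eq_or_lt with rfl | hp
    · rw [zero_add] at hpq; subst hpq; linarith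
    · nlinarith
  · have := (convex_ball (0 : ℂ) 2) (x := x) (by simpa using hx3) (y := y) (by simpa using hy3)
      hp hq hpq
    simpa using this

lemma oscDir_ne : -oscDir ≠ 0 := by
  rw [oscDir, neg_ne_zero]
  intro h
  have := congrArg Complex.re h
  simp at this

lemma BddNorm.left_bounded {lam a₁ e₁ a₂ e₂ : ℂ} {b : ℝ}
    (h₂ : BddNorm (-oscDir) 3 lam b a₂ e₂)
    (h : a₁ * e₂ - e₁ * a₂ = 0) :
    ∃ B, ∀ r : ℝ, 3 ≤ r → ‖oscComb a₁ e₁ lam b (-oscDir * r)‖ ≤ B := by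
  set k := oscComb a₁ e₁ lam b (-oscDir * (3 : ℝ)) with hk
  have h3 : a₂ * oscSol 1 0 lam b (-oscDir * (3 : ℝ)) +
      e₂ * oscSol 0 1 lam b (-oscDir * (3 : ℝ)) = 1 := h₂.1
  have hk' : a₁ * oscSol 1 0 lam b (-oscDir * (3 : ℝ)) +
      e₁ * oscSol 0 1 lam b (-oscDir * (3 : ℝ)) = k := rfl
  have ha : a₁ = k * a₂ := by
    linear_combination (-a₁) * h3 + oscSol 0 1 lam b (-oscDir * (3 : ℝ)) * h + a₂ * hk'
  have he : e₁ = k * e₂ := by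
    linear_combination (-e₁) * h3 - oscSol 1 0 lam b (-oscDir * (3 : ℝ)) * h + e₂ * hk'
  refine ⟨‖k‖, fun r hr => ?_⟩
  have : oscComb a₁ e₁ lam b (-oscDir * r) = k * oscComb a₂ e₂ lam b (-oscDir * r) := by
    rw [oscComb, oscComb, ha, he]; ring
  rw [this, norm_mul]
  exact mul_le_of_le_one_right (norm_nonneg _) (h₂.2 r hr)

/-- The mismatch between the truncated Dirichlet solutions on the two rays. -/
noncomputable def dirMismatch (p : ℝ × ℝ) (lam : ℂ) : ℂ :=
  dirA 1 3 p.2 lam p.1 * dirE (-oscDir) 3 p.2 lam p.1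
    - dirE 1 3 p.2 lam p.1 * dirA (-oscDir) 3 p.2 lam p.1

lemma exists_small_mismatch_zero : ∃ K ⊆ oscDom, IsCompact K ∧
    ∀ᶠ p in 𝓝[>] (0 : ℝ) ×ˢ (atTop : Filter ℝ), ∃ lam ∈ K, dirMismatch p lam = 0 := by
  have h0 : (0 : ℝ) ∈ Set.Icc (0 : ℝ) 1 := by simp
  have hr : ∀ lam : ℂ, ∃ c : ℂ × ℂ, lam ∈ oscDom → BddNorm 1 3 lam 0 c.1 c.2 := fun lam => by
    by_cases hl : lam ∈ oscDom
    · obtain ⟨a, e, h⟩ := exists_bddNorm one_ne_zero goodDir_right hl h0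
      exact ⟨(a, e), fun _ => h⟩
    · exact ⟨0, fun h => absurd h hl⟩
  have hl : ∀ lam : ℂ, ∃ c : ℂ × ℂ, lam ∈ oscDom → BddNorm (-oscDir) 3 lam 0 c.1 c.2 :=
    fun lam => by
    by_cases hl : lam ∈ oscDom
    · obtain ⟨a, e, h⟩ := exists_bddNorm oscDir_ne goodDir_left hl h0
      exact ⟨(a, e), fun _ => h⟩
    · exact ⟨0, fun h => absurd h hl⟩
  choose cr hcr using hr
  choose cl hcl using hl
  have hb01 : ∀ᶠ b in 𝓝[>] (0 : ℝ), b ∈ Set.Icc (0 : ℝ) 1 := by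
    filter_upwards [Ioo_mem_nhdsGT (zero_lt_one : (0 : ℝ) < 1)] with b hb
    exact ⟨hb.1.le, hb.2.le⟩
  refine exists_zero_near (f := fun lam => (cr lam).1 * (cl lam).2 - (cr lam).2 * (cl lam).1)
    isOpen_oscDom convex_oscDom.isPreconnected ?_ ?_ one_mem_oscDom quarter_mem_oscDom ?_ ?_
  · filter_upwards [hb01.prod_mk (eventually_gt_atTop (3 : ℝ))] with p hp
    obtain ⟨h1, h2⟩ := dir_differentiableOn one_ne_zero goodDir_right hp.2 hp.1
    obtain ⟨h3, h4⟩ := dir_differentiableOn oscDir_ne goodDir_left hp.2 hp.1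
    exact (h1.mul h4).sub (h2.mul h3)
  · intro lam hlam
    have hR : Tendsto (fun y : (ℝ × ℝ) × ℂ => y.1.2)
        ((𝓝[>] (0 : ℝ) ×ˢ atTop) ×ˢ 𝓝[oscDom] lam) atTop := tendsto_snd.comp tendsto_fst
    have hb : Tendsto (fun y : (ℝ × ℝ) × ℂ => y.1.1)
        ((𝓝[>] (0 : ℝ) ×ˢ atTop) ×ˢ 𝓝[oscDom] lam) (𝓝[>] (0 : ℝ)) := tendsto_fst.comp tendsto_fst
    have hl : Tendsto (fun y : (ℝ × ℝ) × ℂ => y.2)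
        ((𝓝[>] (0 : ℝ) ×ˢ atTop) ×ˢ 𝓝[oscDom] lam) (𝓝[oscDom] lam) := tendsto_snd
    obtain ⟨h1, h2⟩ := dir_tendsto one_ne_zero goodDir_right hR (hb.mono_right nhdsWithin_le_nhds)
      (hl.mono_right nhdsWithin_le_nhds) (hb.eventually hb01) (hl.eventually self_mem_nhdsWithin)
      hlam h0 (hcr lam hlam)
    obtain ⟨h3, h4⟩ := dir_tendsto oscDir_ne goodDir_left hR (hb.mono_right nhdsWithin_le_nhds)
      (hl.mono_right nhdsWithin_le_nhds) (hb.eventually hb01) (hl.eventually self_mem_nhdsWithin)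
      hlam h0 (hcl lam hlam)
    exact (h1.mul h4).sub (h2.mul h3)
  · have h1 := (BddNorm.unique one_ne_zero goodDir_right one_mem_oscDom h0 (hcr 1 one_mem_oscDom)
      (bddNorm_gaussian (by norm_num) (by norm_num))).2
    have h2 := (BddNorm.unique oscDir_ne goodDir_left one_mem_oscDom h0 (hcl 1 one_mem_oscDom)
      (bddNorm_gaussian (by simp [oscDir, sq]; norm_num) (by norm_num))).2
    simp only [h1, h2]
    ring
  · intro hz
    have h1 := hcr _ quarter_mem_oscDom
    obtain ⟨B, hB⟩ := (hcl _ quarter_mem_oscDom).left_bounded hz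
    have := quarter_not_bounded h1.2 hB (1 * (3 : ℝ))
    exact one_ne_zero (h1.1.symm.trans this)

theorem exists_bounded_solution : ∃ b : ℝ, 0 < b ∧ b < 3 / 8 ∧ ∃ lam ∈ oscDom, ∃ a e : ℂ,
    BddNorm 1 3 lam b a e ∧
      ∃ B, ∀ r : ℝ, 3 ≤ r → ‖oscComb a e lam b (-oscDir * r)‖ ≤ B := by
  obtain ⟨K, hK, hKc, hev⟩ := exists_small_mismatch_zero
  obtain ⟨b, hb, hb0, hb1⟩ := (hev.curry.and
    (Ioo_mem_nhdsGT (by norm_num : (0 : ℝ) < 3 / 8))).exists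
  have hbI : b ∈ Set.Icc (0 : ℝ) 1 := ⟨hb0.le, by linarith⟩
  choose! x hx using fun (R : ℝ) (h : ∃ lam ∈ K, dirMismatch (b, R) lam = 0) => h
  have hg := Ultrafilter.of_le (atTop : Filter ℝ)
  set g := Ultrafilter.of (atTop : Filter ℝ) with hgdef
  have hxK : ∀ᶠ R in (g : Filter ℝ), x R ∈ K := hg (hb.mono fun R h => (hx R h).1)
  obtain ⟨lam, hlam, hlim⟩ := hKc.ultrafilter_le_nhds (g.map x)
    (Filter.le_principal_iff.2 hxK)
  have hlim' : Tendsto x g (𝓝 lam) := hlim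
  obtain ⟨a₁, e₁, ha₁, he₁, h₁⟩ := dir_ultrafilter_limit one_ne_zero goodDir_right g
    (R := id) (b := fun _ => b) hg tendsto_const_nhds hlim' (Eventually.of_forall fun _ => hbI)
    (hxK.mono fun R h => hK h) (hK hlam) hbI
  obtain ⟨a₂, e₂, ha₂, he₂, h₂⟩ := dir_ultrafilter_limit oscDir_ne goodDir_left g
    (R := id) (b := fun _ => b) hg tendsto_const_nhds hlim' (Eventually.of_forall fun _ => hbI)
    (hxK.mono fun R h => hK h) (hK hlam) hbI
  have h0 : a₁ * e₂ - e₁ * a₂ = 0 := by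
    refine tendsto_nhds_unique ((ha₁.mul he₂).sub (he₁.mul ha₂)) ?_
    refine tendsto_const_nhds.congr' ?_
    filter_upwards [hg hb] with R hR
    exact (hx R hR).2.symm
  exact ⟨b, hb0, hb1, lam, hK hlam, a₁, e₁, h₁, h₂.left_bounded h0⟩

end Existence

section Decay

/-- Growth of solutions along a segment. -/
lemma SolPair.gronwall {Q w w' : ℂ → ℂ} (h : SolPair Q w w') {z k : ℂ} {m δ : ℝ} (hm : 0 < m)
    (hQ : ∀ t ∈ Set.Icc (0 : ℝ) 1, ‖Q (z + k * t)‖ ≤ m ^ 2) (h0 : m * ‖w z‖ ≤ δ)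
    (h1 : ‖w' z‖ ≤ δ) :
    m * ‖w (z + k)‖ ≤ δ * Real.exp (m * ‖k‖) ∧ ‖w' (z + k)‖ ≤ δ * Real.exp (m * ‖k‖) := by
  have hg : ∀ r : ℝ, HasDerivAt (fun r : ℝ => z + k * (r : ℂ)) k r := fun r => by
    simpa using (((hasDerivAt_id r).ofReal_comp).const_mul k).const_add z
  have hd1 : ∀ t : ℝ, HasDerivAt (fun t : ℝ => (m : ℂ) * w (z + k * t))
      (m * (w' (z + k * t) * k)) t := fun t =>
    ((h.deriv_fst (z + k * t)).comp_of_eq t (hg t) rfl).const_mul (m : ℂ)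
  have hd2 : ∀ t : ℝ, HasDerivAt (fun t : ℝ => w' (z + k * t))
      (Q (z + k * t) * w (z + k * t) * k) t := fun t =>
    (h.deriv_snd (z + k * t)).comp_of_eq t (hg t) rfl
  have hd := fun t : ℝ => (hd1 t).prodMk (hd2 t)
  have hmn : ‖(m : ℂ)‖ = m := by rw [Complex.norm_real, Real.norm_of_nonneg hm.le]
  have key := norm_le_gronwallBound_of_norm_deriv_right_le (δ := δ) (K := m * ‖k‖) (ε := 0)
    (a := 0) (b := 1) (fun t _ => (hd t).continuousAt.continuousWithinAt)
    (fun t _ => (hd t).hasDerivWithinAt) (by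
      rw [Prod.norm_def]
      refine max_le ?_ ?_
      · simpa [abs_of_pos hm] using h0
      · simpa using h1) (fun t ht => by
      rw [add_zero, Prod.norm_def]
      refine max_le ?_ ?_
      · have : ‖w' (z + k * t)‖ ≤ ‖((m : ℂ) * w (z + k * t), w' (z + k * t))‖ :=
          norm_snd_le (_, _)
        simp only [norm_mul, hmn]
        nlinarith [norm_nonneg k, mul_le_mul_of_nonneg_left this
          (mul_nonneg hm.le (norm_nonneg k))]
      · have h2 : ‖(m : ℂ) * w (z + k * t)‖ ≤ ‖((m : ℂ) * w (z + k * t), w' (z + k * t))‖ :=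
          norm_fst_le (_, _)
        have h3 := hQ t ⟨ht.1, ht.2.le⟩
        simp only [norm_mul, hmn] at h2 ⊢
        calc ‖Q (z + k * t)‖ * ‖w (z + k * t)‖ * ‖k‖
            ≤ m ^ 2 * ‖w (z + k * t)‖ * ‖k‖ := by gcongr
          _ = m * ‖k‖ * (m * ‖w (z + k * t)‖) := by ring
          _ ≤ _ := by gcongr) 1 (by simp)
  rw [gronwallBound_ε0, Prod.norm_def] at key
  simp only [sub_zero, mul_one, ofReal_one] at key
  have h4 := le_trans (le_max_left _ _) key
  rw [norm_mul, hmn] at h4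
  exact ⟨h4, le_trans (le_max_right _ _) key⟩

/-- The function `r ^ (5/2)`. -/
noncomputable def rad (r : ℝ) : ℝ := r ^ 2 * √r

lemma rad_nonneg (r : ℝ) : 0 ≤ rad r := mul_nonneg (sq_nonneg r) (Real.sqrt_nonneg r)

lemma continuous_rad : Continuous rad := by unfold rad; fun_prop

lemma hasDerivAt_rad {r : ℝ} (hr : 0 < r) : HasDerivAt rad (5 / 2 * (r * √r)) r := by
  refine ((hasDerivAt_pow 2 r).mul (Real.hasDerivAt_sqrt hr.ne')).congr_deriv ?_
  have h := Real.sq_sqrt hr.le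
  have h0 : √r ≠ 0 := (Real.sqrt_pos.2 hr).ne'
  field_simp
  simp
  rw [h]; ring

lemma rad_eq (r : ℝ) : rad r = r * (r * √r) := by rw [rad]; ring

lemma rad_sub_one {r : ℝ} (hr : 1 ≤ r) : rad r - 3 * (r * √r) ≤ rad (r - 1) := by
  have h0 : 0 < √r := Real.sqrt_pos.2 (by linarith)
  have h1 := Real.sq_sqrt (by linarith : 0 ≤ r)
  have h2 := Real.sq_sqrt (by linarith : 0 ≤ r - 1)
  have h3 : √(r - 1) ≤ √r := Real.sqrt_le_sqrt (by linarith)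
  have h4 := Real.sqrt_nonneg (r - 1)
  have h5 : r - 1 ≤ √(r - 1) * √r := by nlinarith
  have h6 : (r - 1) * √r ≤ r * √(r - 1) := by nlinarith
  have h7 : r * (rad r - 3 * (r * √r)) ≤ r * rad (r - 1) := by
    have : r * rad (r - 1) = (r - 1) ^ 2 * (r * √(r - 1)) := by rw [rad]; ring
    rw [this]
    refine le_trans ?_ (mul_le_mul_of_nonneg_left h6 (sq_nonneg (r - 1)))
    have : r * (rad r - 3 * (r * √r)) = (r ^ 3 - 3 * r ^ 2) * √r := by rw [rad]; ring
    rw [this, ← mul_assoc]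
    refine mul_le_mul_of_nonneg_right ?_ h0.le
    nlinarith
  exact le_of_mul_le_mul_left h7 (by linarith)

lemma exists_lower_order (A : ℝ) {ε : ℝ} (hε : 0 < ε) :
    ∃ K, ∀ r : ℝ, 0 ≤ r → A * (r * √r) ≤ ε * rad r + K := by
  refine ⟨|A| * ((|A| / ε) * √(|A| / ε)), fun r hr => ?_⟩
  have h0 : 0 ≤ r * √r := by positivity
  have h1 : A * (r * √r) ≤ |A| * (r * √r) := mul_le_mul_of_nonneg_right (le_abs_self A) h0
  rcases le_total r (|A| / ε) with h | h
  · have h2 : r * √r ≤ (|A| / ε) * √(|A| / ε) := by gcongr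
    have h3 := mul_le_mul_of_nonneg_left h2 (abs_nonneg A)
    have := mul_nonneg hε.le (rad_nonneg r)
    linarith
  · rw [div_le_iff₀ hε] at h
    have h2 := mul_le_mul_of_nonneg_right h h0
    rw [rad_eq]
    have : 0 ≤ |A| * ((|A| / ε) * √(|A| / ε)) := by positivity
    linarith

lemma exists_bound_extend {f g : ℝ → ℝ} (hf : Continuous f) (hg : Continuous g)
    (hg0 : ∀ r, 0 < g r) {C R : ℝ} (h : ∀ r, R ≤ r → f r ≤ C * g r) :
    ∃ C', 0 ≤ C' ∧ ∀ r, 0 ≤ r → f r ≤ C' * g r := by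
  obtain ⟨D, hD⟩ := (isCompact_Icc (a := (0 : ℝ)) (b := R)).bddAbove_image
    (hf.div₀ hg fun r => (hg0 r).ne').continuousOn
  refine ⟨max (max C D) 0, le_max_right _ _, fun r hr => ?_⟩
  rcases le_total R r with h1 | h1
  · exact (h r h1).trans (mul_le_mul_of_nonneg_right
      ((le_max_left _ _).trans (le_max_left _ _)) (hg0 r).le)
  · have := hD (Set.mem_image_of_mem _ (⟨hr, h1⟩ : r ∈ Set.Icc 0 R))
    rw [div_le_iff₀ (hg0 r)] at this
    exact this.trans (mul_le_mul_of_nonneg_right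
      ((le_max_right _ _).trans (le_max_left _ _)) (hg0 r).le)

/-- Exponential decay with rate `γ` on the ray in direction `ω`. -/
def RayDecay (w w' : ℂ → ℂ) (ω : ℂ) (γ : ℝ) : Prop :=
  ∃ C, 0 ≤ C ∧ ∀ r : ℝ, 0 ≤ r → ‖w (ω * r)‖ + ‖w' (ω * r)‖ ≤ C * Real.exp (-γ * rad r)

/-- Cubic growth of the potential. -/
def CubicPot (Q : ℂ → ℂ) : Prop := ∀ r : ℝ, 1 ≤ r → ∀ z, ‖z‖ ≤ 2 * r → ‖Q z‖ ≤ 36 * r ^ 3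

lemma cubicPot_oscPot {lam : ℂ} {b : ℝ} (hl : ‖lam‖ ≤ 2) (hb : |b| ≤ 1) :
    CubicPot (oscPot lam b) := by
  intro r hr z hz
  rw [oscPot, norm_mul]
  have h1 : ‖z ^ 2 + b * z ^ 3 - 1‖ ≤ ‖z‖ ^ 2 + ‖z‖ ^ 3 + 1 := by
    refine (norm_sub_le _ _).trans ?_
    refine add_le_add ((norm_add_le _ _).trans ?_) (by simp)
    rw [norm_mul, norm_pow, norm_pow, Complex.norm_real, Real.norm_eq_abs]
    have : |b| * ‖z‖ ^ 3 ≤ 1 * ‖z‖ ^ 3 := by gcongr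
    linarith
  have h2 : ‖z‖ ^ 2 ≤ (2 * r) ^ 2 := by gcongr
  have h3 : ‖z‖ ^ 3 ≤ (2 * r) ^ 3 := by gcongr
  calc ‖lam‖ * ‖z ^ 2 + b * z ^ 3 - 1‖ ≤ 2 * ((2 * r) ^ 2 + (2 * r) ^ 3 + 1) := by
        gcongr; linarith
    _ ≤ 36 * r ^ 3 := by
      nlinarith [mul_nonneg (by linarith : 0 ≤ r - 1) (sq_nonneg r), sq_nonneg (r-1)]

section
variable {Q w w' : ℂ → ℂ} (h : SolPair Q w w')
include h

lemma SolPair.continuous_fst : Continuous w :=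
  continuous_iff_continuousAt.2 fun z => (h.deriv_fst z).continuousAt

lemma SolPair.continuous_snd : Continuous w' :=
  continuous_iff_continuousAt.2 fun z => (h.deriv_snd z).continuousAt

lemma SolPair.rayDecay_of_energy_bound (hQ : CubicPot Q) {ω β : ℂ} (hω : ‖ω‖ = 1) (hβ : ‖β‖ = 1)
    {c L B : ℝ} (hc : 0 < c) (hcβ : c ≤ β.re) (hL : 1 ≤ L)
    (hV : ∀ r : ℝ, L ≤ r → c * r ^ 3 ≤ (β * (ω ^ 2 * Q (ω * r))).re)
    (hB : ∀ r : ℝ, L ≤ r → (β * (starRingEnd ℂ (w (ω * r)) * (ω * w' (ω * r)))).re ≤ B) :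
    RayDecay w w' ω (c / 5) := by
  have hray := h.ray_zero ω
  have hN := fun r => hray.hasDerivAt_energy β r
  set N := fun r : ℝ => (β * (starRingEnd ℂ (w (ω * r)) * (ω * w' (ω * r)))).re with hNdef
  have hNabs : ∀ r, |N r| ≤ ‖w (ω * r)‖ * ‖w' (ω * r)‖ := fun r => by
    refine (Complex.abs_re_le_norm _).trans ?_
    simp [hβ, hω]
  have hN' : ∀ r : ℝ, L ≤ r → c * (‖w' (ω * r)‖ ^ 2 + r ^ 3 * ‖w (ω * r)‖ ^ 2) ≤
      β.re * ‖ω * w' (ω * r)‖ ^ 2 + (β * (ω ^ 2 * Q (ω * r))).re * ‖w (ω * r)‖ ^ 2 := by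
    intro r hr
    rw [norm_mul, hω, one_mul]
    have h1 := mul_le_mul_of_nonneg_right (hV r hr) (sq_nonneg ‖w (ω * r)‖)
    have h2 := mul_le_mul_of_nonneg_right hcβ (sq_nonneg ‖w' (ω * r)‖)
    linarith
  have hamgm : ∀ r : ℝ, L ≤ r → 2 * c * (r * √r) * |N r| ≤
      β.re * ‖ω * w' (ω * r)‖ ^ 2 + (β * (ω ^ 2 * Q (ω * r))).re * ‖w (ω * r)‖ ^ 2 := by
    intro r hr
    refine le_trans ?_ (hN' r hr)
    have hr0 : 0 ≤ r := by linarith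
    have h1 : (r * √r) ^ 2 = r ^ 3 := by rw [mul_pow, Real.sq_sqrt hr0]; ring
    have h2 : 0 ≤ 2 * c * (r * √r) := by positivity
    refine (mul_le_mul_of_nonneg_left (hNabs r) h2).trans ?_
    rw [← h1]
    nlinarith [mul_nonneg hc.le (sq_nonneg (‖w' (ω * r)‖ - (r * √r) * ‖w (ω * r)‖))]
  have hmono : MonotoneOn N (Set.Ici L) := hray.energy_monotoneOn (hc.le.trans hcβ)
    fun r hr => by
      have h1 := hV r hr
      have : 0 ≤ c * r ^ 3 := by have : 0 ≤ r := by linarith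
                                 positivity
      linarith
  have hNle : ∀ r, L ≤ r → N r ≤ 0 := by
    intro r hr
    by_contra! hcon
    have key : ∀ x, r ≤ x → 2 * c * N r * (x - r) ≤ N x - N r := by
      intro x hx
      refine (convex_Ici r).mul_sub_le_image_sub_of_le_deriv
        (fun y _ => (hN y).continuousAt.continuousWithinAt)
        (fun y _ => (hN y).differentiableAt.differentiableWithinAt)
        (fun y hy => ?_) r Set.self_mem_Ici x hx hx
      rw [interior_Ici] at hy
      have hy' : r ≤ y := le_of_lt hy
      rw [(hN y).deriv]
      refine le_trans ?_ (hamgm y (hr.trans hy'))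
      have h1 : N r ≤ |N y| := (hmono (Set.mem_Ici.2 hr) (Set.mem_Ici.2 (hr.trans hy')) hy').trans
        (le_abs_self _)
      have hy1 : 1 ≤ y := by linarith
      have h2 : 1 ≤ y * √y := by nlinarith [Real.one_le_sqrt.2 hy1]
      have h3 : c * N r ≤ c * |N y| := by gcongr
      have h4 : 1 * (c * |N y|) ≤ (y * √y) * (c * |N y|) := by gcongr
      linarith
    have hx : r ≤ r + (1 + |B|) / (2 * c * N r) := by
      have : 0 ≤ (1 + |B|) / (2 * c * N r) := by positivity
      linarith
    have h1 := key _ hx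
    have h2 : 2 * c * N r * (r + (1 + |B|) / (2 * c * N r) - r) = 1 + |B| := by
      field_simp; ring
    have h3 := hB _ (hr.trans hx)
    have h4 := le_abs_self B
    have h5 : N (r + (1 + |B|) / (2 * c * N r)) ≤ B := h3
    linarith
  have hG : MonotoneOn (fun r => N r * Real.exp (4 * c / 5 * rad r)) (Set.Ici L) := by
    have hd : ∀ r : ℝ, L ≤ r → HasDerivAt (fun r => N r * Real.exp (4 * c / 5 * rad r))
        ((β.re * ‖ω * w' (ω * r)‖ ^ 2 + (β * (ω ^ 2 * Q (ω * r))).re * ‖w (ω * r)‖ ^ 2) *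
          Real.exp (4 * c / 5 * rad r) + N r * (Real.exp (4 * c / 5 * rad r) *
            (4 * c / 5 * (5 / 2 * (r * √r))))) r := fun r hr =>
      (hN r).mul (((hasDerivAt_rad (by linarith)).const_mul (4 * c / 5)).exp)
    refine monotoneOn_of_hasDerivWithinAt_nonneg (convex_Ici L)
      (fun r hr => (hd r hr).continuousAt.continuousWithinAt)
      (fun r hr => (hd r (interior_subset hr)).hasDerivWithinAt) fun r hr => ?_
    have h1 := hamgm r (interior_subset hr)
    have h2 := neg_abs_le (N r)
    have hr0 : (0 : ℝ) ≤ r := by have : L ≤ r := interior_subset hr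
                                 linarith
    have h3 : 0 ≤ 2 * c * (r * √r) := by positivity
    have h4 := mul_le_mul_of_nonneg_left h2 h3
    have : 0 ≤ Real.exp (4 * c / 5 * rad r) * ((β.re * ‖ω * w' (ω * r)‖ ^ 2 +
        (β * (ω ^ 2 * Q (ω * r))).re * ‖w (ω * r)‖ ^ 2) + 2 * c * (r * √r) * N r) :=
      mul_nonneg (Real.exp_nonneg _) (by linarith)
    linarith
  set C₀ := -(N L * Real.exp (4 * c / 5 * rad L)) with hC₀
  have hC₀0 : 0 ≤ C₀ := by
    rw [hC₀, ← neg_mul]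
    exact mul_nonneg (by linarith [hNle L le_rfl]) (Real.exp_nonneg _)
  have hNexp : ∀ r, L ≤ r → -N r ≤ C₀ * Real.exp (-(4 * c / 5 * rad r)) := by
    intro r hr
    have := hG Set.self_mem_Ici (Set.mem_Ici.2 hr) hr
    rw [Real.exp_neg, ← div_eq_mul_inv, le_div_iff₀ (Real.exp_pos _)]
    simp only at this
    linarith
  obtain ⟨K, hK⟩ := exists_lower_order (6 * c / 5 + 7) (by positivity : 0 < c / 5)
  refine exists_bound_extend (R := L + 1) (C := 12 * √(C₀ / c) * Real.exp K) ?_ ?_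
    (fun r => Real.exp_pos _) ?_
  · have := h.continuous_fst
    have := h.continuous_snd
    fun_prop
  · have := continuous_rad
    fun_prop
  intro r hr
  have hr1 : 1 ≤ r := by linarith
  obtain ⟨σ, ⟨hσ1, hσ2⟩, hσ⟩ := exists_hasDerivAt_eq_slope N _ (sub_one_lt r)
    (fun y _ => (hN y).continuousAt.continuousWithinAt) (fun y _ => hN y)
  have hLr : L ≤ r - 1 := by linarith
  have hσL : L ≤ σ := by linarith
  have hE : c * (‖w' (ω * σ)‖ ^ 2 + ‖w (ω * σ)‖ ^ 2) ≤
      C₀ * Real.exp (-(4 * c / 5 * rad (r - 1))) := by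
    have h1 := hN' σ hσL
    rw [hσ] at h1
    have h2 := hNexp (r - 1) hLr
    have h3 := hNle r (by linarith)
    have h4 : ‖w (ω * σ)‖ ^ 2 ≤ σ ^ 3 * ‖w (ω * σ)‖ ^ 2 :=
      le_mul_of_one_le_left (sq_nonneg _) (one_le_pow₀ (by linarith))
    have h5 := mul_le_mul_of_nonneg_left h4 hc.le
    have h6 : (N r - N (r - 1)) / (r - (r - 1)) = N r - N (r - 1) := by
      rw [sub_sub_cancel, div_one]
    rw [h6] at h1
    linarith
  set S := √(C₀ / c) * Real.exp (-(2 * c / 5 * rad (r - 1))) with hS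
  have hS0 : 0 ≤ S := by positivity
  have hS2 : S ^ 2 = C₀ * Real.exp (-(4 * c / 5 * rad (r - 1))) / c := by
    rw [hS, mul_pow, Real.sq_sqrt (by positivity), ← Real.exp_nat_mul]
    rw [div_mul_eq_mul_div]
    congr 3
    push_cast; ring
  rw [← le_div_iff₀' hc, ← hS2] at hE
  have hw : ‖w (ω * σ)‖ ≤ S := abs_le_of_sq_le_sq' (by nlinarith [sq_nonneg ‖w' (ω * σ)‖]) hS0 |>.2
  have hw' : ‖w' (ω * σ)‖ ≤ S := abs_le_of_sq_le_sq' (by nlinarith [sq_nonneg ‖w (ω * σ)‖]) hS0 |>.2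
  set m := 6 * (r * √r) with hm
  have hm6 : 6 ≤ m := by nlinarith [Real.one_le_sqrt.2 hr1]
  have hm2 : m ^ 2 = 36 * r ^ 3 := by
    rw [hm, mul_pow, mul_pow, Real.sq_sqrt (by linarith)]; ring
  have hgr := h.gronwall (z := ω * σ) (k := ω * ((r - σ : ℝ) : ℂ)) (m := m) (δ := m * S)
    (by linarith) (fun t ht => by
      rw [hm2]
      refine hQ r hr1 _ ?_
      have : ω * (σ : ℂ) + ω * ((r - σ : ℝ) : ℂ) * t = ω * ((σ + (r - σ) * t : ℝ) : ℂ) := by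
        push_cast; ring
      rw [this, norm_mul, hω, one_mul, Complex.norm_real, Real.norm_eq_abs, abs_of_nonneg]
      · nlinarith [ht.1, ht.2]
      · nlinarith [ht.1, ht.2])
    (by gcongr) (hw'.trans (le_mul_of_one_le_left hS0 (by linarith)))
  have hend : ω * (σ : ℂ) + ω * ((r - σ : ℝ) : ℂ) = ω * r := by push_cast; ring
  have hk : ‖ω * ((r - σ : ℝ) : ℂ)‖ ≤ 1 := by
    rw [norm_mul, hω, one_mul, Complex.norm_real, Real.norm_eq_abs, abs_of_nonneg] <;> linarith
  rw [hend] at hgr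
  have hexp : Real.exp (m * ‖ω * ((r - σ : ℝ) : ℂ)‖) ≤ Real.exp m :=
    Real.exp_le_exp.2 (mul_le_of_le_one_right (by linarith) hk)
  have hbig : m * S * Real.exp m ≤ 6 * √(C₀ / c) * Real.exp K * Real.exp (-(c / 5) * rad r) := by
    have h1 : m ≤ 6 * Real.exp (r * √r) := by
      have := Real.add_one_le_exp (r * √r)
      linarith
    calc m * S * Real.exp m ≤ 6 * Real.exp (r * √r) * S * Real.exp m := by gcongr
      _ = 6 * √(C₀ / c) * Real.exp (r * √r + -(2 * c / 5 * rad (r - 1)) + m) := by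
          rw [hS, Real.exp_add, Real.exp_add]; ring
      _ ≤ 6 * √(C₀ / c) * Real.exp (K + -(c / 5) * rad r) := by
          refine mul_le_mul_of_nonneg_left (Real.exp_le_exp.2 ?_) (by positivity)
          have h2 := hK r (by linarith)
          have h3 := mul_le_mul_of_nonneg_left (rad_sub_one hr1) (by positivity : 0 ≤ 2 * c / 5)
          rw [hm]
          linarith
      _ = _ := by rw [Real.exp_add]; ring
  have hmS : 0 ≤ m * S := mul_nonneg (by linarith) hS0
  have h1 : ‖w (ω * r)‖ ≤ m * S * Real.exp m := by
    have h2 : ‖w (ω * r)‖ ≤ m * ‖w (ω * r)‖ := le_mul_of_one_le_left (norm_nonneg _) (by linarith)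
    exact h2.trans (hgr.1.trans (mul_le_mul_of_nonneg_left hexp hmS))
  have h2 : ‖w' (ω * r)‖ ≤ m * S * Real.exp m :=
    hgr.2.trans (mul_le_mul_of_nonneg_left hexp hmS)
  linarith

lemma SolPair.rayDecay_nhd (hQ : CubicPot Q) {ω : ℂ} (hω : ‖ω‖ = 1) {γ η : ℝ} (hγ : 0 < γ)
    (hη1 : η ≤ 1) (hηγ : 24 * η ≤ γ) (hd : RayDecay w w' ω γ) :
    ∃ C, 0 ≤ C ∧ ∀ r : ℝ, 1 ≤ r → ∀ z, ‖z - ω * r‖ ≤ η * r →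
      ‖w z‖ + ‖w' z‖ ≤ C * Real.exp (-(γ / 2) * rad r) := by
  obtain ⟨C, hC0, hC⟩ := hd
  refine ⟨2 * (6 * (4 / γ) * C), by positivity, fun r hr z hz => ?_⟩
  have hr0 : 0 ≤ r := by linarith
  set m := 6 * (r * √r) with hm
  have hs1 := Real.one_le_sqrt.2 hr
  have hm6 : 6 ≤ m := by nlinarith
  have hm2 : m ^ 2 = 36 * r ^ 3 := by
    rw [hm, mul_pow, mul_pow, Real.sq_sqrt (by linarith)]; ring
  have hCr := hC r hr0
  set E := C * Real.exp (-γ * rad r) with hE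
  have hE0 : 0 ≤ E := by positivity
  have hw : ‖w (ω * r)‖ ≤ E := by linarith [norm_nonneg (w' (ω * r))]
  have hw' : ‖w' (ω * r)‖ ≤ E := by linarith [norm_nonneg (w (ω * r))]
  have hgr := h.gronwall (z := ω * r) (k := z - ω * r) (m := m) (δ := m * E)
    (by linarith) (fun t ht => by
      rw [hm2]
      refine hQ r hr _ ?_
      refine (norm_add_le _ _).trans ?_
      rw [norm_mul, norm_mul, hω, one_mul, Complex.norm_real, Complex.norm_real,
        Real.norm_of_nonneg hr0, Real.norm_of_nonneg ht.1]
      have h1 : ‖z - ω * r‖ * t ≤ ‖z - ω * r‖ := mul_le_of_le_one_right (norm_nonneg _) ht.2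
      nlinarith)
    (by gcongr) (hw'.trans (le_mul_of_one_le_left hE0 (by linarith)))
  rw [add_sub_cancel] at hgr
  have hmk : m * ‖z - ω * r‖ ≤ γ / 4 * rad r := by
    calc m * ‖z - ω * r‖ ≤ m * (η * r) := by gcongr
      _ = 6 * η * rad r := by rw [rad_eq, hm]; ring
      _ ≤ γ / 4 * rad r := mul_le_mul_of_nonneg_right (by linarith) (rad_nonneg r)
  have hm4 : m ≤ 6 * (4 / γ) * Real.exp (γ / 4 * rad r) := by
    have h1 := Real.add_one_le_exp (γ / 4 * rad r)
    have h2 : r * √r ≤ rad r := by rw [rad_eq]; exact le_mul_of_one_le_left (by positivity) hr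
    have h3 : rad r ≤ 4 / γ * Real.exp (γ / 4 * rad r) := by
      rw [div_mul_eq_mul_div, le_div_iff₀ hγ]
      linarith
    linarith
  have hbig : m * E * Real.exp (m * ‖z - ω * r‖) ≤
      6 * (4 / γ) * C * Real.exp (-(γ / 2) * rad r) := by
    calc m * E * Real.exp (m * ‖z - ω * r‖)
        ≤ 6 * (4 / γ) * Real.exp (γ / 4 * rad r) * E * Real.exp (γ / 4 * rad r) := by gcongr
      _ = 6 * (4 / γ) * C *
          Real.exp (γ / 4 * rad r + -γ * rad r + γ / 4 * rad r) := by
          rw [hE, Real.exp_add, Real.exp_add]; ring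
      _ = _ := by congr 2; ring
  have h1 : ‖w z‖ ≤ m * ‖w z‖ := le_mul_of_one_le_left (norm_nonneg _) (by linarith)
  linarith [hgr.1, hgr.2]

end

section Rotation
variable {lam : ℂ} {b : ℝ} {w w' : ℂ → ℂ} (h : SolPair (oscPot lam b) w w') (hl : ‖lam‖ ≤ 2)
  (hb : |b| ≤ 1)
include h hl hb

lemma SolPair.rayDecay_of_lead {ω β : ℂ} (hω : ‖ω‖ = 1) (hβ : ‖β‖ = 1)
    {c L B : ℝ} (hc : 0 < c) (hcβ : c ≤ β.re) (hV : c ≤ (β * (ω ^ 5 * (lam * b))).re)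
    (hB : ∀ r : ℝ, L ≤ r → (β * (starRingEnd ℂ (w (ω * r)) * (ω * w' (ω * r)))).re ≤ B) :
    RayDecay w w' ω (c / 10) := by
  have := h.rayDecay_of_energy_bound (cubicPot_oscPot hl hb) hω hβ (c := c / 2)
    (L := max L (max 1 (8 / c))) (B := B) (by positivity) (by linarith)
    ((le_max_left _ _).trans (le_max_right _ _)) (fun r hr => ?_)
    (fun r hr => hB r ((le_max_left _ _).trans hr))
  · convert this using 1; ring
  have hr1 : 1 ≤ r := (le_max_left _ _).trans ((le_max_right _ _).trans hr)
  have hr8 : 8 / c ≤ r := (le_max_right _ _).trans ((le_max_right _ _).trans hr)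
  rw [div_le_iff₀ hc] at hr8
  have h1 : β * (ω ^ 2 * oscPot lam b (ω * r)) =
      ((r ^ 3 : ℝ) : ℂ) * (β * (ω ^ 5 * (lam * b))) +
        β * (ω ^ 2 * (lam * (ω ^ 2 * (r : ℂ) ^ 2 - 1))) := by
    rw [oscPot]; push_cast; ring
  have h2 : ‖β * (ω ^ 2 * (lam * (ω ^ 2 * (r : ℂ) ^ 2 - 1)))‖ ≤ 2 * (r ^ 2 + 1) := by
    rw [norm_mul, norm_mul, norm_mul, norm_pow, hω, hβ, one_pow, one_mul, one_mul]
    have h3 : ‖ω ^ 2 * (r : ℂ) ^ 2 - 1‖ ≤ r ^ 2 + 1 := by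
      refine (norm_sub_le _ _).trans ?_
      rw [norm_mul, norm_pow, norm_pow, hω, Complex.norm_real, Real.norm_eq_abs, sq_abs]
      simp
    exact mul_le_mul hl h3 (norm_nonneg _) (by norm_num)
  rw [h1, Complex.add_re, Complex.re_ofReal_mul]
  have h3 := (abs_le.1 ((Complex.abs_re_le_norm _).trans h2)).1
  have h4 : r ^ 3 * c ≤ r ^ 3 * (β * (ω ^ 5 * (lam * b))).re := by gcongr
  nlinarith [mul_le_mul_of_nonneg_right hr8 (sq_nonneg r)]

lemma SolPair.rayDecay_rotate {ω β : ℂ} (hω : ‖ω‖ = 1) (hβ : ‖β‖ = 1) {c γ φ : ℝ}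
    (hc : 0 < c) (hγ : 0 < γ) (hcβ : c ≤ β.re)
    (hV : ∀ t ∈ Set.Icc (0 : ℝ) 1,
      c ≤ (β * ((ω * Complex.exp ((t * φ : ℝ) * I)) ^ 5 * (lam * b))).re)
    (hd : RayDecay w w' ω γ) : RayDecay w w' (ω * Complex.exp (φ * I)) (c / 10) := by
  have hunit : ∀ t : ℝ, ‖ω * Complex.exp ((t * φ : ℝ) * I)‖ = 1 := fun t => by
    rw [norm_mul, hω, Complex.norm_exp_ofReal_mul_I, one_mul]
  have hen : ∀ ω' : ℂ, ‖ω'‖ = 1 → ∀ C x y, ‖x‖ + ‖y‖ ≤ C →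
      (β * (starRingEnd ℂ x * (ω' * y))).re ≤ C * C := by
    intro ω' hω' C x y hC
    refine (Complex.re_le_norm _).trans ?_
    simp only [norm_mul, hβ, hω', one_mul, RCLike.norm_conj]
    exact mul_le_mul (by linarith [norm_nonneg y]) (by linarith [norm_nonneg x]) (norm_nonneg _)
      (by linarith [norm_nonneg y, norm_nonneg x])
  set η := min 1 (c / 240)
  have hη0 : 0 < η := lt_min one_pos (by positivity)
  have hη24 : 24 * η ≤ c / 10 := by
    have : η ≤ c / 240 := min_le_right _ _
    linarith
  have hstep : ∀ t ∈ Set.Icc (0 : ℝ) 1, ∀ t' ∈ Set.Icc (0 : ℝ) 1, |t' - t| * |φ| ≤ η →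
      RayDecay w w' (ω * Complex.exp ((t * φ : ℝ) * I)) (c / 10) →
      RayDecay w w' (ω * Complex.exp ((t' * φ : ℝ) * I)) (c / 10) := by
    intro t ht t' ht' htt hdt
    obtain ⟨C, hC0, hC⟩ := h.rayDecay_nhd (cubicPot_oscPot hl hb) (hunit t) (by positivity)
      (min_le_left _ _) hη24 hdt
    refine h.rayDecay_of_lead hl hb (hunit t') hβ hc hcβ (hV t' ht') (L := 1) (B := C * C)
      fun r hr => hen _ (hunit t') _ _ _ ?_
    refine (hC r hr _ ?_).trans ?_
    · rw [← sub_mul, ← mul_sub, norm_mul, norm_mul, hω, one_mul, Complex.norm_real,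
        Real.norm_of_nonneg (by linarith)]
      refine mul_le_mul_of_nonneg_right ?_ (by linarith)
      have h1 : Complex.exp ((t' * φ : ℝ) * I) = Complex.exp ((t * φ : ℝ) * I) *
          Complex.exp (I * ((t' - t) * φ : ℝ)) := by
        rw [← Complex.exp_add]; congr 1; push_cast; ring
      rw [h1, ← mul_sub_one, norm_mul, Complex.norm_exp_ofReal_mul_I, one_mul]
      refine (Real.norm_exp_I_mul_ofReal_sub_one_le).trans ?_
      rw [Real.norm_eq_abs, abs_mul]
      exact htt
    · refine mul_le_of_le_one_right hC0 (Real.exp_le_one_iff.2 ?_)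
      have := rad_nonneg r
      nlinarith
  obtain ⟨n, hn⟩ := exists_nat_gt (|φ| / η)
  have hn0 : (0 : ℝ) < n := lt_of_le_of_lt (by positivity) hn
  have hind : ∀ k : ℕ, k ≤ n →
      RayDecay w w' (ω * Complex.exp (((k / n : ℝ) * φ : ℝ) * I)) (c / 10) := by
    intro k
    induction k with
    | zero =>
      intro _
      have h0 : ω * Complex.exp ((((0 : ℕ) / n : ℝ) * φ : ℝ) * I) = ω := by simp
      obtain ⟨C, hC0, hC⟩ := hd
      have hV0 := hV 0 (by simp)
      rw [h0]
      refine h.rayDecay_of_lead hl hb hω hβ hc hcβ (by simpa using hV0) (L := 0) (B := C * C)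
        fun r hr => hen _ hω _ _ _ ((hC r hr).trans ?_)
      refine mul_le_of_le_one_right hC0 (Real.exp_le_one_iff.2 ?_)
      have := rad_nonneg r
      nlinarith
    | succ k ih =>
      intro hk
      have hk' : ((k + 1 : ℕ) : ℝ) ≤ n := by exact_mod_cast hk
      push_cast at hk'
      refine hstep (k / n) ⟨by positivity, ?_⟩ _ ⟨by positivity, ?_⟩ ?_ (ih (by omega))
      · rw [div_le_one hn0]; linarith
      · rw [div_le_one hn0]; push_cast; linarith
      · have : ((k + 1 : ℕ) : ℝ) / n - k / n = 1 / n := by push_cast; ring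
        rw [this, abs_of_nonneg (by positivity), one_div, inv_mul_le_iff₀ hn0]
        rw [div_lt_iff₀ hη0] at hn
        exact hn.le
  have := hind n le_rfl
  rwa [div_self hn0.ne', one_mul] at this

end Rotation

end Decay

section Eigenpair

/-- The unit vector along the left ray. -/
noncomputable def leftDir : ℂ := -oscDir / (‖oscDir‖ : ℝ)

lemma norm_oscDir_pos : 0 < ‖oscDir‖ := norm_pos_iff.2 (neg_ne_zero.1 oscDir_ne)

lemma norm_leftDir : ‖leftDir‖ = 1 := by
  rw [leftDir, norm_div, norm_neg, Complex.norm_real, norm_norm, div_self norm_oscDir_pos.ne']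

lemma neg_oscDir_pow_five : (-oscDir) ^ 5 = 10072 - 44403 * I := by
  have hI := Complex.I_sq
  have h2 : (8 + 3 * I) ^ 2 = 55 + 48 * I := by linear_combination 9 * hI
  have h4 : (8 + 3 * I) ^ 4 = 721 + 5280 * I := by
    rw [show (4 : ℕ) = 2 * 2 by norm_num, pow_mul, h2]; linear_combination 2304 * hI
  have : (-oscDir) ^ 5 = -((8 + 3 * I) ^ 4 * (8 + 3 * I)) := by rw [oscDir]; ring
  rw [this, h4]
  linear_combination (-15840) * hI

/-- There is a nontrivial solution of the complex oscillator equation decaying on both rays. -/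
theorem exists_decaying_solution : ∃ b : ℝ, 0 < b ∧ b < 3 / 8 ∧ ∃ lam ∈ oscDom, ∃ w w' : ℂ → ℂ,
    SolPair (oscPot lam b) w w' ∧ (∃ z, w z ≠ 0) ∧
      (∃ γ, 0 < γ ∧ RayDecay w w' 1 γ) ∧ ∃ γ, 0 < γ ∧ RayDecay w w' leftDir γ := by
  obtain ⟨b, hb0, hb1, lam, hlam, a, e, hbdd, B, hB⟩ := exists_bounded_solution
  have hl := oscDom_norm hlam
  have hb : |b| ≤ 1 := by rw [abs_of_pos hb0]; linarith
  have hbI : b ∈ Set.Icc (0 : ℝ) 1 := ⟨hb0.le, by linarith⟩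
  have hp := solPair_oscComb hl (abs_le_two_of_mem hbI) a e
  obtain ⟨hre, him, -⟩ := id hlam
  refine ⟨b, hb0, hb1, lam, hlam, _, _, hp, ⟨1 * (3 : ℝ), by rw [hbdd.1]; exact one_ne_zero⟩,
    ⟨min 1 (lam.re * b) / 10, ?_, ?_⟩, ?_⟩
  · have : 0 < lam.re * b := mul_pos (by linarith) hb0
    have := lt_min one_pos this
    positivity
  · have : 0 < lam.re * b := mul_pos (by linarith) hb0
    refine hp.rayDecay_of_lead hl hb (β := 1) (L := 3) (B := 0) (by simp) (by simp)
      (lt_min one_pos this) (by simp) (by simp) fun r hr => ?_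
    rw [one_mul]
    exact (hp.ray_zero 1).energy_nonpos (goodDir_right lam hlam b hbI) hbdd.2 hr
  · have hN := norm_oscDir_pos
    set c := (10072 * lam.re + 44403 * lam.im) * b / ‖oscDir‖ ^ 5 with hc
    have hc0 : 0 < c := by
      have := (abs_lt.1 him).1
      have : 0 < 10072 * lam.re + 44403 * lam.im := by linarith
      positivity
    have hlead : (1 * (leftDir ^ 5 * (lam * b))).re = c := by
      have : 1 * (leftDir ^ 5 * (lam * b)) = ((b / ‖oscDir‖ ^ 5 : ℝ) : ℂ) *
          ((10072 - 44403 * I) * lam) := by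
        rw [leftDir, div_pow, neg_oscDir_pow_five]; push_cast; ring
      rw [this, Complex.re_ofReal_mul, hc]
      simp
      ring
    refine ⟨min 1 c / 10, by have := lt_min one_pos hc0; positivity, ?_⟩
    refine hp.rayDecay_of_lead hl hb (β := 1) (L := 3 * ‖oscDir‖) (B := 0) norm_leftDir (by simp)
      (lt_min one_pos hc0) (by simp) (by rw [hlead]; exact min_le_right _ _) fun r hr => ?_
    have h3 : 3 ≤ r / ‖oscDir‖ := by rwa [le_div_iff₀ hN]
    have := (hp.ray_zero (-oscDir)).energy_nonpos (goodDir_left lam hlam b hbI) hB h3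
    have hz : -oscDir * ((r / ‖oscDir‖ : ℝ) : ℂ) = leftDir * r := by
      rw [leftDir]; push_cast; ring
    rw [hz] at this
    have h4 : 1 * (starRingEnd ℂ (oscComb a e lam b (leftDir * r)) *
        (leftDir * oscComb' a e lam b (leftDir * r))) = ((1 / ‖oscDir‖ : ℝ) : ℂ) *
        (starRingEnd ℂ (oscComb a e lam b (leftDir * r)) *
          (-oscDir * oscComb' a e lam b (leftDir * r))) := by
      have : leftDir = ((1 / ‖oscDir‖ : ℝ) : ℂ) * -oscDir := by rw [leftDir]; push_cast; ring
      rw [show (leftDir * oscComb' a e lam b (leftDir * r)) = ((1 / ‖oscDir‖ : ℝ) : ℂ) * -oscDir *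
        oscComb' a e lam b (leftDir * r) by rw [← this]]
      ring
    rw [h4, Complex.re_ofReal_mul]
    exact mul_nonpos_of_nonneg_of_nonpos (by positivity) this

end Eigenpair

section Sign

lemma self_le_rad {r : ℝ} (hr : 1 ≤ r) : r ≤ rad r := by
  have h1 := Real.one_le_sqrt.2 hr
  have h2 : r ≤ r ^ 2 := by nlinarith
  calc r ≤ r ^ 2 := h2
    _ ≤ r ^ 2 * √r := le_mul_of_one_le_right (by positivity) h1

lemma SolPair.tendsto_shift {Q w w' : ℂ → ℂ} (h : SolPair Q w w') (hQ : CubicPot Q) {ω : ℂ}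
    (hω : ‖ω‖ = 1) {γ : ℝ} (hγ : 0 < γ) (hd : RayDecay w w' ω γ) (z₀ : ℂ) :
    Filter.Tendsto (fun r : ℝ => ‖w (z₀ + ω * r)‖ + ‖w' (z₀ + ω * r)‖) Filter.atTop (nhds 0) := by
  set η := min 1 (γ / 24)
  have hη0 : 0 < η := lt_min one_pos (by positivity)
  obtain ⟨C, hC0, hC⟩ := h.rayDecay_nhd hQ hω hγ (min_le_left _ _)
    (by have : η ≤ γ / 24 := min_le_right _ _
        linarith) hd
  have hlim : Filter.Tendsto (fun r : ℝ => C * Real.exp (-(γ / 2) * r)) Filter.atTop (nhds 0) := by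
    rw [← mul_zero C]
    refine Filter.Tendsto.const_mul C (Real.tendsto_exp_atBot.comp ?_)
    exact Filter.tendsto_id.const_mul_atTop_of_neg (by linarith)
  refine squeeze_zero' (Filter.Eventually.of_forall fun r => by positivity) ?_ hlim
  filter_upwards [Filter.eventually_ge_atTop (max 1 (‖z₀‖ / η))] with r hr
  have hr1 : 1 ≤ r := (le_max_left _ _).trans hr
  have hr2 : ‖z₀‖ ≤ η * r := by
    have := (le_max_right _ _).trans hr
    rw [div_le_iff₀ hη0] at this
    linarith
  refine (hC r hr1 _ (by simpa using hr2)).trans ?_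
  refine mul_le_mul_of_nonneg_left (Real.exp_le_exp.2 ?_) hC0
  have := self_le_rad hr1
  nlinarith

lemma tendsto_energy_zero {u v : ℝ → ℂ} (β : ℂ)
    (h : Filter.Tendsto (fun r => ‖u r‖ + ‖v r‖) Filter.atTop (nhds 0)) :
    Filter.Tendsto (fun r => (β * (starRingEnd ℂ (u r) * v r)).re) Filter.atTop (nhds 0) := by
  have h2 : Filter.Tendsto (fun r => ‖β‖ * ((‖u r‖ + ‖v r‖) * (‖u r‖ + ‖v r‖)))
      Filter.atTop (nhds 0) := by
    simpa using (h.mul h).const_mul ‖β‖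
  refine squeeze_zero_norm (fun r => ?_) h2
  rw [Real.norm_eq_abs]
  refine (Complex.abs_re_le_norm _).trans ?_
  rw [norm_mul, norm_mul, RCLike.norm_conj]
  have := norm_nonneg (u r)
  have := norm_nonneg (v r)
  gcongr <;> linarith

/-- The eigenvalue of a solution decaying on both rays lies in the lower half plane. -/
theorem SolPair.im_neg_of_decay {lam : ℂ} {b : ℝ} {w w' : ℂ → ℂ} (hl : lam ∈ oscDom) (hb0 : 0 < b)
    (hb1 : b ≤ 1) (h : SolPair (oscPot lam b) w w') (hw : ∃ z, w z ≠ 0) {γ₁ γ₂ : ℝ} (hγ₁ : 0 < γ₁)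
    (hd₁ : RayDecay w w' 1 γ₁) (hγ₂ : 0 < γ₂) (hd₂ : RayDecay w w' leftDir γ₂) : lam.im < 0 := by
  by_contra! him
  have hre : 0 < lam.re := by linarith [hl.1]
  have hl0 : lam ≠ 0 := by rintro rfl; simp at hre
  have hn := Complex.normSq_pos.2 hl0
  have hln := oscDom_norm hl
  have hQ := cubicPot_oscPot hln (b := b) (by rwa [abs_of_pos hb0])
  set s₁ : ℂ := ((-2 / b : ℝ) : ℂ) with hs₁
  have hbne : (b : ℂ) ≠ 0 := by exact_mod_cast hb0.ne'
  have hR := h.ray s₁ 1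
  have hRt := tendsto_energy_zero (-I / lam) (u := fun r : ℝ => w (s₁ + 1 * r))
    (v := fun r : ℝ => 1 * w' (s₁ + 1 * r)) (by
      simpa using h.tendsto_shift hQ (by simp) hγ₁ hd₁ s₁)
  have hRd := fun r => hR.hasDerivAt_energy (-I / lam) r
  have hRanti : Antitone fun r : ℝ =>
      (-I / lam * (starRingEnd ℂ (w (s₁ + 1 * r)) * (1 * w' (s₁ + 1 * r)))).re := by
    refine antitone_of_hasDerivAt_nonpos hRd fun r => ?_
    have h1 : (-I / lam).re ≤ 0 := by
      have : -I / lam = -I * lam⁻¹ := div_eq_mul_inv _ _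
      rw [this]
      simp only [Complex.mul_re, Complex.neg_re, Complex.I_re, Complex.neg_im, Complex.I_im,
        Complex.inv_im]
      have := div_nonneg him hn.le
      rw [neg_div]
      linarith
    have h2 : (-I / lam * (1 ^ 2 * oscPot lam b (s₁ + 1 * r))).re = 0 := by
      have : -I / lam * (1 ^ 2 * oscPot lam b (s₁ + 1 * r)) =
          ((-((-2 / b + r) ^ 2 + b * (-2 / b + r) ^ 3 - 1) : ℝ) : ℂ) * I := by
        rw [oscPot, hs₁]; push_cast; field_simp
        try ring
      rw [this, Complex.re_ofReal_mul]; simp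
    rw [h2, zero_mul, add_zero]
    exact mul_nonpos_of_nonpos_of_nonneg h1 (by positivity)
  have hR0 := hRanti.le_of_tendsto hRt 0
  have hL := h.ray s₁ (-oscDir)
  have hleft : ∀ r : ℝ, s₁ + -oscDir * r = s₁ + leftDir * ((‖oscDir‖ * r : ℝ) : ℂ) := fun r => by
    have : (‖oscDir‖ : ℂ) ≠ 0 := by exact_mod_cast norm_oscDir_pos.ne'
    rw [leftDir]; push_cast; field_simp
  have hLt : Filter.Tendsto (fun r : ℝ => ‖w (s₁ + -oscDir * r)‖ +
      ‖-oscDir * w' (s₁ + -oscDir * r)‖) Filter.atTop (nhds 0) := by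
    have h1 := (h.tendsto_shift hQ norm_leftDir hγ₂ hd₂ s₁).comp
      (Filter.tendsto_id.const_mul_atTop norm_oscDir_pos)
    have h2 := h1.const_mul (1 + ‖oscDir‖)
    rw [mul_zero] at h2
    refine squeeze_zero (fun r => by positivity) (fun r => ?_) h2
    simp only [Function.comp, id]
    rw [hleft, norm_mul, norm_neg]
    have := norm_nonneg (w (s₁ + leftDir * ((‖oscDir‖ * r : ℝ) : ℂ)))
    have := norm_nonneg (w' (s₁ + leftDir * ((‖oscDir‖ * r : ℝ) : ℂ)))
    have := norm_oscDir_pos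
    nlinarith
  set β : ℂ := -I / (oscDir * lam) with hβ
  have hd0 : oscDir ≠ 0 := neg_ne_zero.1 oscDir_ne
  have hLt' := tendsto_energy_zero β hLt
  have hLd := fun r => hL.hasDerivAt_energy β r
  have hβre : β.re < 0 := by
    have h1 : β = -I * (oscDir * lam)⁻¹ := div_eq_mul_inv _ _
    rw [h1]
    have h2 : 0 < normSq (oscDir * lam) := Complex.normSq_pos.2 (mul_ne_zero hd0 hl0)
    have h3 : 0 < (oscDir * lam).im := by simp [oscDir]; linarith
    simp only [Complex.mul_re, Complex.neg_re, Complex.I_re, Complex.neg_im, Complex.I_im,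
      Complex.inv_im]
    have := div_pos h3 h2
    rw [neg_div]
    linarith
  have hVre : ∀ r : ℝ, 0 ≤ r → (β * ((-oscDir) ^ 2 * oscPot lam b (s₁ + -oscDir * r))).re < 0 := by
    intro r hr
    have hI := Complex.I_sq
    have h2 : (8 + 3 * I) ^ 2 = 55 + 48 * I := by linear_combination 9 * hI
    have h3 : (8 + 3 * I) ^ 3 = 296 + 549 * I := by
      rw [pow_succ, h2]; linear_combination 144 * hI
    have h4 : (8 + 3 * I) ^ 4 = 721 + 5280 * I := by
      rw [show (4 : ℕ) = 2 * 2 by norm_num, pow_mul, h2]; linear_combination 2304 * hI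
    have h1 : β * ((-oscDir) ^ 2 * oscPot lam b (s₁ + -oscDir * r)) =
        -I * (((-4 / b ^ 2 - 1 : ℝ) : ℂ) * oscDir - ((8 / b * r : ℝ) : ℂ) * oscDir ^ 2 -
          ((5 * r ^ 2 : ℝ) : ℂ) * oscDir ^ 3 - ((b * r ^ 3 : ℝ) : ℂ) * oscDir ^ 4) := by
      rw [hβ, oscPot, hs₁]; push_cast; field_simp; ring
    rw [h1, oscDir, h2, h3, h4]
    have h5 : 0 < 4 / b ^ 2 := by positivity
    have h6 : 0 ≤ 8 / b * r := by positivity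
    have h7 : 0 ≤ b * r ^ 3 := by positivity
    have h8 : -4 / b ^ 2 = -(4 / b ^ 2) := neg_div _ _
    simp [-Complex.ofReal_mul, -Complex.ofReal_sub, -Complex.ofReal_div, -Complex.ofReal_pow,
      -Complex.ofReal_neg]
    nlinarith [sq_nonneg r]
  have hLanti : StrictAntiOn (fun r : ℝ =>
      (β * (starRingEnd ℂ (w (s₁ + -oscDir * r)) * (-oscDir * w' (s₁ + -oscDir * r)))).re)
      (Set.Ici 0) := by
    refine strictAntiOn_of_deriv_neg (convex_Ici _)
      (fun r _ => (hLd r).continuousAt.continuousWithinAt) fun r hr => ?_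
    rw [interior_Ici] at hr
    rw [(hLd r).deriv]
    have h1 := hVre r (le_of_lt hr)
    by_cases hu : w (s₁ + -oscDir * r) = 0
    · have hv : w' (s₁ + -oscDir * r) ≠ 0 := fun hv => by
        obtain ⟨z, hz⟩ := hw
        exact hz (h.eq_zero_of_point hln (by rw [abs_of_pos hb0]; linarith) hu hv z)
      have : 0 < ‖-oscDir * w' (s₁ + -oscDir * r)‖ :=
        norm_pos_iff.2 (mul_ne_zero (neg_ne_zero.2 hd0) hv)
      rw [hu]
      simp only [norm_zero]
      have := mul_neg_of_neg_of_pos hβre (pow_pos this 2)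
      linarith
    · have : 0 < ‖w (s₁ + -oscDir * r)‖ := norm_pos_iff.2 hu
      have := mul_neg_of_neg_of_pos h1 (pow_pos this 2)
      have : β.re * ‖-oscDir * w' (s₁ + -oscDir * r)‖ ^ 2 ≤ 0 :=
        mul_nonpos_of_nonpos_of_nonneg hβre.le (by positivity)
      linarith
  have h1pos : 0 ≤ (β * (starRingEnd ℂ (w (s₁ + -oscDir * (1 : ℝ))) *
      (-oscDir * w' (s₁ + -oscDir * (1 : ℝ))))).re := by
    refine le_of_tendsto hLt' ?_
    filter_upwards [Filter.eventually_ge_atTop 1] with r hr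
    exact hLanti.antitoneOn (by simp) (by simp; linarith) hr
  have h01 := hLanti (by simp) (by simp) (zero_lt_one (α := ℝ))
  have hsum : (β * (starRingEnd ℂ (w (s₁ + -oscDir * (0 : ℝ))) *
      (-oscDir * w' (s₁ + -oscDir * (0 : ℝ))))).re =
      -(-I / lam * (starRingEnd ℂ (w (s₁ + 1 * (0 : ℝ))) * (1 * w' (s₁ + 1 * (0 : ℝ))))).re := by
    rw [← Complex.neg_re]
    congr 1
    rw [hβ]
    simp only [Complex.ofReal_zero, mul_zero, add_zero]
    field_simp
  simp only at h01
  linarith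

end Sign

section Sector

lemma abs_arg_le_of_re_nonneg {z : ℂ} (hz : 0 ≤ z.re) :
    |z.arg| ≤ Real.pi / 2 * (|z.im| / ‖z‖) := by
  have h1 := Real.mul_abs_le_abs_sin (Complex.abs_arg_le_pi_div_two_iff.2 hz)
  rw [Complex.sin_arg, abs_div, abs_norm] at h1
  have hpi := Real.pi_pos
  calc |z.arg| = Real.pi / 2 * (2 / Real.pi * |z.arg|) := by field_simp
    _ ≤ _ := by gcongr

lemma sin_ge_of_mem {δ x : ℝ} (h0 : 0 ≤ δ) (h1 : δ ≤ x) (h2 : x ≤ Real.pi - δ) :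
    Real.sin δ ≤ Real.sin x := by
  rcases le_total x (Real.pi / 2) with h | h
  · exact Real.sin_le_sin_of_le_of_le_pi_div_two (by linarith) h h1
  · rw [← Real.sin_pi_sub x]
    exact Real.sin_le_sin_of_le_of_le_pi_div_two (by linarith) (by linarith) (by linarith)

lemma SolPair.sector_of_rayDecay {Q w w' : ℂ → ℂ} (h : SolPair Q w w') (hQ : CubicPot Q) {ω : ℂ}
    (hω : ‖ω‖ = 1) {γ : ℝ} (hγ : 0 < γ) (hd : RayDecay w w' ω γ) :
    ∃ κ > 0, ∃ c > 0, ∃ C > 0, ∀ z : ℂ, |z.im| ≤ κ * z.re →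
      ‖w (ω * z)‖ + ‖w' (ω * z)‖ ≤ C * Real.exp (-c * ‖z‖ ^ 2) := by
  set η := min 1 (γ / 24)
  have hη0 : 0 < η := lt_min one_pos (by positivity)
  have hη1 : η ≤ 1 := min_le_left _ _
  obtain ⟨C, hC0, hC⟩ := h.rayDecay_nhd hQ hω hγ (min_le_left _ _)
    (by have : η ≤ γ / 24 := min_le_right _ _
        linarith) hd
  obtain ⟨B, hB⟩ := ((isCompact_closedBall (0 : ℂ) 2).image_of_continuousOn
    (f := fun z => ‖w z‖ + ‖w' z‖)
    (h.continuous_fst.norm.add h.continuous_snd.norm).continuousOn).bddAbove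
  have hB' : ∀ z : ℂ, ‖z‖ ≤ 2 → ‖w z‖ + ‖w' z‖ ≤ B := fun z hz =>
    hB ⟨z, by simpa using hz, rfl⟩
  have hB0 : 0 ≤ B := le_trans (by positivity) (hB' 0 (by simp))
  refine ⟨η, hη0, γ / 8, by positivity, C + B * Real.exp (γ / 2) + 1, by positivity,
    fun z hz => ?_⟩
  have hre : 0 ≤ z.re := by
    by_contra! hneg
    have := mul_neg_of_pos_of_neg hη0 hneg
    linarith [abs_nonneg z.im]
  have hz2 : ‖z‖ ≤ 2 * z.re := by
    have h1 := Complex.norm_le_abs_re_add_abs_im z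
    rw [abs_of_nonneg hre] at h1
    have : η * z.re ≤ 1 * z.re := by gcongr
    linarith
  rcases le_total 1 z.re with h1 | h1
  · have hh : ‖ω * z - ω * (z.re : ℂ)‖ ≤ η * z.re := by
      rw [← mul_sub, norm_mul, hω, one_mul]
      have : z - z.re = z.im * I := by
        nth_rewrite 1 [← Complex.re_add_im z]; ring
      rw [this, norm_mul, Complex.norm_I, mul_one, Complex.norm_real]
      exact hz
    refine (hC z.re h1 _ hh).trans ?_
    have he : Real.exp (-(γ / 2) * rad z.re) ≤ Real.exp (-(γ / 8) * ‖z‖ ^ 2) := by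
      refine Real.exp_le_exp.2 ?_
      have h3 : z.re ^ 2 ≤ rad z.re :=
        le_mul_of_one_le_right (by positivity) (Real.one_le_sqrt.2 h1)
      have h4 : ‖z‖ ^ 2 ≤ (2 * z.re) ^ 2 := by gcongr
      nlinarith
    have : 0 ≤ B * Real.exp (γ / 2) := by positivity
    refine mul_le_mul (by linarith) he (Real.exp_pos _).le (by linarith)
  · have hn : ‖z‖ ≤ 2 := by linarith
    refine (hB' (ω * z) (by rwa [norm_mul, hω, one_mul])).trans ?_
    have h5 : B = B * Real.exp (γ / 2) * Real.exp (-(γ / 2)) := by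
      rw [mul_assoc, ← Real.exp_add]; simp
    rw [h5]
    refine mul_le_mul ?_ (Real.exp_le_exp.2 ?_) (Real.exp_pos _).le (by positivity)
    · rw [← h5]
      linarith
    · have h4 : ‖z‖ ^ 2 ≤ 2 ^ 2 := by gcongr
      nlinarith

/-- A nontrivial solution of the oscillator `W'' = (y² + b y³ / ζ - ζ²) W` with `Im ζ < 0` which
decays in a double sector around the real axis. -/
theorem exists_sector_solution : ∃ b : ℝ, 0 < b ∧ b < 3 / 8 ∧ ∃ ζ : ℂ, ζ.im < 0 ∧
    ∃ W W' : ℂ → ℂ, SolPair (fun y => y ^ 2 + b * y ^ 3 / ζ - ζ ^ 2) W W' ∧ (∃ z, W z ≠ 0) ∧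
      ∃ κ > 0, ∃ c > 0, ∃ C > 0, ∀ z : ℂ, |z.im| ≤ κ * |z.re| →
        ‖W z‖ ≤ C * Real.exp (-c * ‖z‖ ^ 2) := by
  obtain ⟨b, hb0, hb1, lam, hlam, w, w', hp, ⟨z₀, hz₀⟩, ⟨γ₁, hγ₁, hd₁⟩, γ₂, hγ₂, hd₂⟩ :=
    exists_decaying_solution
  have hl := oscDom_norm hlam
  have hb : |b| ≤ 1 := by rw [abs_of_pos hb0]; linarith
  have him := hp.im_neg_of_decay hlam hb0 (by linarith) ⟨z₀, hz₀⟩ hγ₁ hd₁ hγ₂ hd₂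
  obtain ⟨hre, him', -⟩ := id hlam
  have hre0 : 0 < lam.re := by linarith
  have hl0 : lam ≠ 0 := by rintro rfl; simp at hre0
  have hln : 0 < ‖lam‖ := norm_pos_iff.2 hl0
  have hpi := Real.pi_gt_three
  have hpi4 := Real.pi_lt_four
  have hQ := cubicPot_oscPot hl hb
  have harg := abs_arg_le_of_re_nonneg hre0.le
  have hargneg := Complex.arg_neg_iff.2 him
  set δ := -lam.arg / 4 with hδ
  have hδ0 : 0 < δ := by rw [hδ]; linarith
  have hδ1 : δ ≤ 1 / 100 := by
    rw [abs_of_neg hargneg] at harg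
    have h1 : |lam.im| / ‖lam‖ ≤ 1 / 100 := by
      rw [div_le_iff₀ hln]
      have := Complex.re_le_norm lam
      linarith
    have : Real.pi / 2 * (|lam.im| / ‖lam‖) ≤ 4 / 2 * (1 / 100) := by gcongr
    rw [hδ]; linarith
  have hlexp : lam = ‖lam‖ * Complex.exp ((-4 * δ : ℝ) * I) := by
    have : -4 * δ = lam.arg := by rw [hδ]; ring
    rw [this, Complex.norm_mul_exp_arg_mul_I]
  have hlb : 0 < ‖lam‖ * b := by positivity
  have hright : RayDecay w w' (1 * Complex.exp (δ * I)) (min 1 (‖lam‖ * b / 2) / 10) := by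
    refine hp.rayDecay_rotate hl hb (ω := 1) (β := 1) (by simp) (by simp)
      (lt_min one_pos (by positivity)) hγ₁ (by simp) (fun t ht => ?_) hd₁
    have : 1 * ((1 * Complex.exp ((t * δ : ℝ) * I)) ^ 5 * (lam * b)) =
        ((‖lam‖ * b : ℝ) : ℂ) * Complex.exp ((5 * (t * δ) - 4 * δ : ℝ) * I) := by
      nth_rewrite 1 [hlexp]
      rw [one_mul, one_mul, ← Complex.exp_nat_mul]
      have : ((5 * (t * δ) - 4 * δ : ℝ) : ℂ) * I =
        (5 : ℕ) * ((t * δ : ℝ) * I) + (-4 * δ : ℝ) * I := by push_cast; ring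
      rw [this, Complex.exp_add]
      push_cast; ring
    rw [this, Complex.re_ofReal_mul, Complex.exp_ofReal_mul_I_re]
    have hcos : 1 / 2 ≤ Real.cos (5 * (t * δ) - 4 * δ) := by
      have h1 := Real.one_sub_sq_div_two_le_cos (x := 5 * (t * δ) - 4 * δ)
      have h2 : 0 ≤ t * δ := mul_nonneg ht.1 hδ0.le
      have h3 : t * δ ≤ 1 * δ := mul_le_mul_of_nonneg_right ht.2 hδ0.le
      have h4 : (5 * (t * δ) - 4 * δ) ^ 2 ≤ 1 := by nlinarith
      linarith
    refine (min_le_right _ _).trans ?_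
    have := mul_le_mul_of_nonneg_left hcos hlb.le
    linarith
  set θ := oscDir.arg with hθ
  have hdexp : oscDir = ‖oscDir‖ * Complex.exp (θ * I) := (Complex.norm_mul_exp_arg_mul_I _).symm
  have hdim : oscDir.im = 3 := by simp [oscDir]
  have hdre : oscDir.re = 8 := by simp [oscDir]
  have hdn : ‖oscDir‖ ^ 2 = 73 := by
    rw [← Complex.normSq_eq_norm_sq, Complex.normSq_apply, hdim, hdre]; norm_num
  have hdpos := norm_oscDir_pos
  have hdn1 : 8.5 ≤ ‖oscDir‖ := by nlinarith
  have hdn2 : ‖oscDir‖ ≤ 9 := by nlinarith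
  have hθ0 : 0 ≤ θ := Complex.arg_nonneg_iff.2 (by rw [hdim]; norm_num)
  have hθ1 : θ ≤ Real.pi * (3 / 17) := by
    have h1 := abs_arg_le_of_re_nonneg (z := oscDir) (by rw [hdre]; norm_num)
    rw [← hθ, abs_of_nonneg hθ0, hdim, abs_of_pos (by norm_num : (0 : ℝ) < 3)] at h1
    have : Real.pi / 2 * (3 / ‖oscDir‖) ≤ Real.pi / 2 * (3 / 8.5) := by gcongr
    refine (h1.trans this).trans (le_of_eq ?_)
    ring
  have hθ2 : 1 / 3 ≤ θ := by
    have h1 := Real.sin_le hθ0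
    rw [hθ, Complex.sin_arg, hdim, ← hθ] at h1
    have : (3 : ℝ) / 9 ≤ 3 / ‖oscDir‖ := by gcongr
    linarith
  have hleftexp : leftDir = -Complex.exp (θ * I) := by
    rw [leftDir]
    have : (‖oscDir‖ : ℂ) ≠ 0 := by exact_mod_cast hdpos.ne'
    nth_rewrite 1 [hdexp]
    field_simp
  have hsin : 0 < Real.sin (δ / 2) := Real.sin_pos_of_pos_of_lt_pi (by linarith) (by linarith)
  have hcpos : 0 < min (Real.sin (δ / 2)) (‖lam‖ * b * Real.sin (δ / 2)) :=
    lt_min hsin (by positivity)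
  have hleft : RayDecay w w' (leftDir * Complex.exp ((δ - θ : ℝ) * I))
      (min (Real.sin (δ / 2)) (‖lam‖ * b * Real.sin (δ / 2)) / 10) := by
    refine hp.rayDecay_rotate hl hb (β := Complex.exp ((Real.pi / 2 - δ / 2 : ℝ) * I)) norm_leftDir
      (Complex.norm_exp_ofReal_mul_I _) hcpos hγ₂ ?_ (fun t ht => ?_) hd₂
    · rw [Complex.exp_ofReal_mul_I_re, Real.cos_pi_div_two_sub]
      exact min_le_left _ _
    · have : Complex.exp ((Real.pi / 2 - δ / 2 : ℝ) * I) *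
          ((leftDir * Complex.exp ((t * (δ - θ) : ℝ) * I)) ^ 5 * (lam * b)) =
          ((‖lam‖ * b : ℝ) : ℂ) * -Complex.exp
            ((5 * (θ + t * (δ - θ)) - 9 / 2 * δ + Real.pi / 2 : ℝ) * I) := by
        nth_rewrite 1 [hlexp]
        rw [hleftexp]
        have h1 : (-Complex.exp (θ * I) * Complex.exp ((t * (δ - θ) : ℝ) * I)) ^ 5 =
            -Complex.exp ((5 : ℕ) * (θ * I + (t * (δ - θ) : ℝ) * I)) := by
          rw [Complex.exp_nat_mul, Complex.exp_add]; ring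
        have h2 : ((5 * (θ + t * (δ - θ)) - 9 / 2 * δ + Real.pi / 2 : ℝ) : ℂ) * I =
          (Real.pi / 2 - δ / 2 : ℝ) * I + ((5 : ℕ) * (θ * I + (t * (δ - θ) : ℝ) * I) +
            (-4 * δ : ℝ) * I) := by push_cast; ring
        rw [h1, h2, Complex.exp_add, Complex.exp_add]
        push_cast; ring
      rw [this, Complex.re_ofReal_mul, Complex.neg_re, Complex.exp_ofReal_mul_I_re,
        Real.cos_add_pi_div_two, neg_neg]
      refine (min_le_right _ _).trans (mul_le_mul_of_nonneg_left ?_ hlb.le)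
      have h5 : 0 ≤ t * (θ - δ) := mul_nonneg ht.1 (by linarith)
      have h6 : t * (θ - δ) ≤ 1 * (θ - δ) := mul_le_mul_of_nonneg_right ht.2 (by linarith)
      refine sin_ge_of_mem (by linarith) ?_ ?_
      · nlinarith
      · nlinarith
  have hleft' : leftDir * Complex.exp ((δ - θ : ℝ) * I) = -Complex.exp (δ * I) := by
    rw [hleftexp, neg_mul, ← Complex.exp_add]
    congr 2; push_cast; ring
  rw [hleft'] at hleft
  rw [one_mul] at hright
  obtain ⟨κ₁, hκ₁, c₁, hc₁, C₁, hC₁, hs₁⟩ := hp.sector_of_rayDecay hQ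
    (Complex.norm_exp_ofReal_mul_I δ) (div_pos (lt_min one_pos (by positivity)) (by norm_num))
    hright
  obtain ⟨κ₂, hκ₂, c₂, hc₂, C₂, hC₂, hs₂⟩ := hp.sector_of_rayDecay hQ
    (by rw [norm_neg]; exact Complex.norm_exp_ofReal_mul_I δ) (div_pos hcpos (by norm_num)) hleft
  set m : ℝ := ‖lam‖ ^ (1 / 4 : ℝ) with hm
  have hm0 : 0 < m := Real.rpow_pos_of_pos hln _
  have hm4 : m ^ 4 = ‖lam‖ := by
    rw [hm, ← Real.rpow_natCast, ← Real.rpow_mul hln.le]; norm_num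
  have hmC : (m : ℂ) ≠ 0 := by exact_mod_cast hm0.ne'
  set ζ : ℂ := m * Complex.exp ((-δ : ℝ) * I) with hζ
  have hζ0 : ζ ≠ 0 := mul_ne_zero hmC (Complex.exp_ne_zero _)
  have hζ4 : ζ ^ 4 = lam := by
    rw [hζ, mul_pow, ← Complex.exp_nat_mul, hlexp]
    congr 1
    · rw [← Complex.ofReal_pow, hm4]
    · congr 1; push_cast; ring
  have hinv : ∀ z, z / ζ = Complex.exp (δ * I) * (z / m) := fun z => by
    have : Complex.exp (δ * I) * Complex.exp ((-δ : ℝ) * I) = 1 := by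
      rw [← Complex.exp_add, ← Complex.exp_zero]; congr 1; push_cast; ring
    rw [hζ, div_eq_iff (mul_ne_zero hmC (Complex.exp_ne_zero _))]
    calc z = z * (m / m) * (Complex.exp (δ * I) * Complex.exp ((-δ : ℝ) * I)) := by
          rw [this, div_self hmC]; ring
      _ = _ := by ring
  refine ⟨b, hb0, hb1, ζ, ?_, fun y => w (y / ζ), fun y => w' (y / ζ) / ζ,
    ⟨fun z => ?_, fun z => ?_⟩,
    ⟨ζ * z₀, by simpa [mul_div_cancel_left₀ _ hζ0] using hz₀⟩, min κ₁ κ₂, lt_min hκ₁ hκ₂,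
    min c₁ c₂ / m ^ 2, div_pos (lt_min hc₁ hc₂) (by positivity), C₁ + C₂, by positivity,
    fun z hz => ?_⟩
  · rw [hζ, Complex.im_ofReal_mul, Complex.exp_ofReal_mul_I_im, Real.sin_neg]
    have := Real.sin_pos_of_pos_of_lt_pi hδ0 (by linarith)
    nlinarith
  · refine ((hp.deriv_fst (z / ζ)).comp z ((hasDerivAt_id z).div_const ζ)).congr_deriv ?_
    ring
  · refine (((hp.deriv_snd (z / ζ)).comp z ((hasDerivAt_id z).div_const ζ)).div_const
      ζ).congr_deriv ?_
    rw [oscPot, ← hζ4]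
    field_simp
  · have hzm : ‖z / m‖ ^ 2 = ‖z‖ ^ 2 / m ^ 2 := by
      rw [norm_div, Complex.norm_real, Real.norm_of_nonneg hm0.le, div_pow]
    have hre' : (z / m).re = z.re / m := by simp
    have him'' : (z / m).im = z.im / m := by simp
    have hexp : ∀ c', min c₁ c₂ ≤ c' → Real.exp (-c' * ‖z / m‖ ^ 2) ≤
        Real.exp (-(min c₁ c₂ / m ^ 2) * ‖z‖ ^ 2) := fun c' hc' => by
      refine Real.exp_le_exp.2 ?_
      rw [hzm]
      have : min c₁ c₂ * (‖z‖ ^ 2 / m ^ 2) ≤ c' * (‖z‖ ^ 2 / m ^ 2) := by gcongr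
      have h7 : -(min c₁ c₂ / m ^ 2) * ‖z‖ ^ 2 = -(min c₁ c₂ * (‖z‖ ^ 2 / m ^ 2)) := by ring
      rw [h7]; linarith
    rcases le_total 0 z.re with h0 | h0
    · have := hs₁ (z / m) (by
        rw [hre', him'', abs_div, abs_of_pos hm0, ← mul_div_assoc]
        gcongr
        refine hz.trans ?_
        rw [abs_of_nonneg h0]
        gcongr
        exact min_le_left _ _)
      beta_reduce
      rw [hinv]
      have hn := norm_nonneg (w' (Complex.exp (δ * I) * (z / m)))
      refine (by linarith : ‖w (Complex.exp (δ * I) * (z / m))‖ ≤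
        C₁ * Real.exp (-c₁ * ‖z / m‖ ^ 2)).trans ?_
      exact mul_le_mul (by linarith) (hexp _ (min_le_left _ _)) (Real.exp_pos _).le (by linarith)
    · have := hs₂ (-(z / m)) (by
        rw [Complex.neg_re, Complex.neg_im, hre', him'', abs_neg, abs_div, abs_of_pos hm0,
          ← neg_div, ← mul_div_assoc]
        gcongr
        refine hz.trans ?_
        rw [abs_of_nonpos h0]
        gcongr
        · linarith
        · exact min_le_right _ _)
      rw [neg_mul_neg, norm_neg] at this
      beta_reduce
      rw [hinv]
      have hn := norm_nonneg (w' (Complex.exp (δ * I) * (z / m)))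
      refine (by linarith : ‖w (Complex.exp (δ * I) * (z / m))‖ ≤
        C₂ * Real.exp (-c₂ * ‖z / m‖ ^ 2)).trans ?_
      exact mul_le_mul (by linarith) (hexp _ (min_le_right _ _)) (Real.exp_pos _).le (by linarith)

end Sector

section Moment

lemma integrable_exp_linear_gauss (A : ℝ) {c : ℝ} (hc : 0 < c) :
    MeasureTheory.Integrable fun x : ℝ => Real.exp (A * |x|) * Real.exp (-c * x ^ 2) := by
  have h := (integrable_exp_neg_mul_sq (b := c / 2) (by positivity)).const_mul
    (Real.exp (A ^ 2 / (2 * c)))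
  refine h.mono' (by fun_prop) (Filter.Eventually.of_forall fun x => ?_)
  rw [← Real.exp_add, ← Real.exp_add, Real.norm_of_nonneg (Real.exp_pos _).le]
  refine Real.exp_le_exp.2 ?_
  have h1 : A ^ 2 / (2 * c) + -(c / 2) * x ^ 2 - (A * |x| + -c * x ^ 2) =
      (A - c * |x|) ^ 2 / (2 * c) := by
    rw [← sq_abs x]; field_simp; ring
  have : 0 ≤ (A - c * |x|) ^ 2 / (2 * c) := by positivity
  linarith

/-- A continuous Gaussian decaying function with vanishing moments is zero. -/
theorem eq_zero_of_moments {f : ℝ → ℂ} (hf : Continuous f) {c C : ℝ} (hc : 0 < c)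
    (hb : ∀ x, ‖f x‖ ≤ C * Real.exp (-c * x ^ 2))
    (hm : ∀ k : ℕ, ∫ x : ℝ, (x : ℂ) ^ k * f x = 0) : ∀ x, f x = 0 := by
  have hfi : MeasureTheory.Integrable f :=
    ((integrable_exp_neg_mul_sq hc).const_mul C).mono' hf.aestronglyMeasurable
      (Filter.Eventually.of_forall hb)
  have hF : FourierTransform.fourier f = 0 := by
    funext w
    rw [Real.fourier_real_eq_integral_exp_smul]
    set a : ℂ := ((-2 * Real.pi * w : ℝ) : ℂ) * I with ha
    have hsum : HasSum (fun n : ℕ => ∫ v : ℝ, (a * v) ^ n / (n.factorial : ℂ) * f v)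
        (∫ v : ℝ, Complex.exp (a * v) * f v) := by
      refine MeasureTheory.hasSum_integral_of_dominated_convergence
        (fun n v => (‖a‖ * |v|) ^ n / n.factorial * (C * Real.exp (-c * v ^ 2))) (fun n => ?_)
        (fun n => Filter.Eventually.of_forall fun v => ?_) (Filter.Eventually.of_forall fun v => ?_)
        ?_ (Filter.Eventually.of_forall fun v => ?_)
      · exact Continuous.aestronglyMeasurable (by fun_prop)
      · rw [norm_mul, norm_div, norm_pow, norm_mul, Complex.norm_real, Complex.norm_natCast,
          Real.norm_eq_abs]
        exact mul_le_mul_of_nonneg_left (hb v) (by positivity)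
      · exact (Real.summable_pow_div_factorial _).mul_right _
      · have : (fun v : ℝ => ∑' n : ℕ, (‖a‖ * |v|) ^ n / n.factorial *
            (C * Real.exp (-c * v ^ 2))) =
            fun v : ℝ => C * (Real.exp (‖a‖ * |v|) * Real.exp (-c * v ^ 2)) := by
          funext v
          rw [tsum_mul_right, Real.exp_eq_exp_ℝ, NormedSpace.exp_eq_tsum_div]
          ring
        rw [this]
        exact (integrable_exp_linear_gauss _ hc).const_mul C
      · refine HasSum.mul_right _ ?_
        rw [Complex.exp_eq_exp_ℂ]
        exact NormedSpace.expSeries_div_hasSum_exp (a * v)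
    have h0 : ∀ n : ℕ, ∫ v : ℝ, (a * v) ^ n / (n.factorial : ℂ) * f v = 0 := fun n => by
      have : (fun v : ℝ => (a * v) ^ n / (n.factorial : ℂ) * f v) =
          fun v : ℝ => a ^ n / (n.factorial : ℂ) * ((v : ℂ) ^ n * f v) := by
        funext v; rw [mul_pow]; ring
      rw [this, MeasureTheory.integral_const_mul, hm, mul_zero]
    simp only [h0] at hsum
    have h1 := hsum.unique hasSum_zero
    rw [Pi.zero_apply, ← h1]
    refine MeasureTheory.integral_congr_ae (Filter.Eventually.of_forall fun v => ?_)
    simp only [smul_eq_mul]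
    congr 2
    rw [ha]; push_cast; ring
  intro x
  have h2 := hf.fourierInv_fourier_eq hfi (by rw [hF]; exact MeasureTheory.integrable_zero _ _ _)
  rw [← h2, hF]
  rw [Real.fourierInv_eq']
  simp

/-- A nontrivial solution with Gaussian decay on the real line has a nonzero moment. -/
theorem SolPair.exists_moment_ne_zero {Q W W' : ℂ → ℂ} (h : SolPair Q W W') (hW : ∃ z, W z ≠ 0)
    {c C : ℝ} (hc : 0 < c) (hb : ∀ x : ℝ, ‖W x‖ ≤ C * Real.exp (-c * x ^ 2)) :
    ∃ k : ℕ, ∫ x : ℝ, (x : ℂ) ^ k * W x ≠ 0 := by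
  by_contra! hm
  have h0 := eq_zero_of_moments (h.continuous_fst.comp Complex.continuous_ofReal) hc hb hm
  obtain ⟨z, hz⟩ := hW
  refine hz ?_
  have han : AnalyticOnNhd ℂ W Set.univ :=
    (Complex.analyticOnNhd_univ_iff_differentiable).2 fun z => (h.deriv_fst z).differentiableAt
  refine han.eqOn_of_preconnected_of_frequently_eq (g := fun _ => 0) analyticOnNhd_const
    isPreconnected_univ (z₀ := ((0 : ℝ) : ℂ)) trivial ?_ (Set.mem_univ z)
  have hfr : ∃ᶠ x : ℝ in nhdsWithin 0 {0}ᶜ, W x = 0 :=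
    (Filter.Eventually.of_forall h0).frequently
  refine Filter.Tendsto.frequently (f := fun x : ℝ => (x : ℂ)) ?_ hfr
  refine tendsto_nhdsWithin_iff.2 ⟨?_, ?_⟩
  · exact (Complex.continuous_ofReal.tendsto 0).mono_left nhdsWithin_le_nhds
  · filter_upwards [self_mem_nhdsWithin] with x hx
    simpa using hx

end Moment

section GevreyData

lemma summable_exp_neg_half_rpow {s : ℝ} (hs : 0 < s) :
    Summable fun j : ℕ => Real.exp (-((j : ℝ) ^ (1 / s)) / 2) := by
  obtain ⟨N, hN⟩ := exists_nat_ge (2 * s)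
  refine Summable.of_norm_bounded_eventually_nat (g := fun j : ℕ => (N.factorial * 2 ^ N : ℝ) *
    (1 / (j : ℝ) ^ 2)) ((Real.summable_one_div_nat_pow.2 one_lt_two).mul_left _) ?_
  filter_upwards [Filter.eventually_ge_atTop 1] with j hj
  have hj1 : (1 : ℝ) ≤ j := by exact_mod_cast hj
  have hj0 : (0 : ℝ) < j := by linarith
  set x : ℝ := (j : ℝ) ^ (1 / s) with hx
  have hx0 : 0 < x := Real.rpow_pos_of_pos hj0 _
  have h1 := Real.pow_div_factorial_le_exp (x / 2) (by positivity) N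
  have h2 : (j : ℝ) ^ 2 ≤ x ^ N := by
    rw [hx, ← Real.rpow_natCast (_ ^ _), ← Real.rpow_mul hj0.le, ← Real.rpow_natCast]
    refine Real.rpow_le_rpow_of_exponent_le hj1 ?_
    rw [one_div, inv_mul_eq_div, le_div_iff₀ hs]
    exact_mod_cast hN
  rw [Real.norm_of_nonneg (Real.exp_pos _).le, neg_div, Real.exp_neg, mul_one_div,
    inv_le_comm₀ (Real.exp_pos _) (by positivity), inv_div]
  refine le_trans ?_ h1
  rw [div_pow, div_div, mul_comm (2 ^ N : ℝ)]
  gcongr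

lemma pow_mul_exp_neg_rpow_le {s : ℝ} (hs : 0 < s) (m j : ℕ) :
    (j : ℝ) ^ m * Real.exp (-((j : ℝ) ^ (1 / s))) ≤
      ((2 * s) ^ s) ^ m * (m.factorial : ℝ) ^ s * Real.exp (-((j : ℝ) ^ (1 / s)) / 2) := by
  set x : ℝ := (j : ℝ) ^ (1 / s) with hx
  have hx0 : 0 ≤ x := Real.rpow_nonneg (by positivity) _
  have hjx : (j : ℝ) = x ^ s := by
    rw [hx, ← Real.rpow_mul (by positivity), one_div_mul_cancel hs.ne', Real.rpow_one]
  have h1 := Real.pow_div_factorial_le_exp (x / (2 * s)) (by positivity) m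
  have h2 : x ^ m ≤ (2 * s) ^ m * m.factorial * Real.exp (x / (2 * s)) := by
    rw [div_pow, div_div, div_le_iff₀ (by positivity)] at h1
    linarith
  have h3 : (x ^ m) ^ s ≤ ((2 * s) ^ m * m.factorial * Real.exp (x / (2 * s))) ^ s := by gcongr
  rw [Real.mul_rpow (by positivity) (by positivity), Real.mul_rpow (by positivity) (by positivity),
    ← Real.exp_mul] at h3
  have h4 : x / (2 * s) * s = x / 2 := by field_simp
  have h5 : ∀ y : ℝ, 0 ≤ y → (y ^ m) ^ s = (y ^ s) ^ m := fun y hy => by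
    rw [← Real.rpow_natCast, ← Real.rpow_natCast, ← Real.rpow_mul hy, ← Real.rpow_mul hy, mul_comm]
  rw [h4, h5 _ hx0, h5 _ (by positivity), ← hjx] at h3
  have h6 : Real.exp (-x / 2) = Real.exp (x / 2) * Real.exp (-x) := by
    rw [← Real.exp_add]; congr 1; ring
  rw [h6, ← mul_assoc]
  exact mul_le_mul_of_nonneg_right h3 (Real.exp_pos _).le

/-- The `m`-th derivative of the Gevrey series `∑ exp (-j ^ (1 / s)) * exp (i j y)`. -/
noncomputable def gevSeries (s : ℝ) (m : ℕ) (y : ℝ) : ℂ :=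
  ∑' j : ℕ, (I * j) ^ m * (Real.exp (-((j : ℝ) ^ (1 / s))) : ℂ) * Complex.exp (I * j * y)

lemma norm_gevSeries_term (s : ℝ) (m j : ℕ) (y : ℝ) :
    ‖(I * j) ^ m * (Real.exp (-((j : ℝ) ^ (1 / s))) : ℂ) * Complex.exp (I * j * y)‖ =
      (j : ℝ) ^ m * Real.exp (-((j : ℝ) ^ (1 / s))) := by
  have : Complex.exp (I * j * y) = Complex.exp ((j * y : ℝ) * I) := by congr 1; push_cast; ring
  rw [this, norm_mul, Complex.norm_exp_ofReal_mul_I, mul_one, norm_mul, norm_pow, norm_mul,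
    Complex.norm_I, one_mul, Complex.norm_natCast, Complex.norm_real,
    Real.norm_of_nonneg (Real.exp_pos _).le]

lemma summable_gevBound {s : ℝ} (hs : 0 < s) (m : ℕ) :
    Summable fun j : ℕ => (j : ℝ) ^ m * Real.exp (-((j : ℝ) ^ (1 / s))) :=
  Summable.of_nonneg_of_le (fun j => by positivity) (fun j => pow_mul_exp_neg_rpow_le hs m j)
    ((summable_exp_neg_half_rpow hs).mul_left _)

lemma hasSum_gevSeries {s : ℝ} (hs : 0 < s) (m : ℕ) (y : ℝ) :
    HasSum (fun j : ℕ => (I * j) ^ m * (Real.exp (-((j : ℝ) ^ (1 / s))) : ℂ) *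
      Complex.exp (I * j * y)) (gevSeries s m y) :=
  (Summable.of_norm_bounded (summable_gevBound hs m)
    fun j => (norm_gevSeries_term s m j y).le).hasSum

lemma norm_gevSeries_le {s : ℝ} (hs : 0 < s) (m : ℕ) (y : ℝ) :
    ‖gevSeries s m y‖ ≤ (∑' j : ℕ, Real.exp (-((j : ℝ) ^ (1 / s)) / 2)) *
      (((2 * s) ^ s) ^ m * (m.factorial : ℝ) ^ s) := by
  refine tsum_of_norm_bounded (((summable_exp_neg_half_rpow hs).hasSum).mul_right _) fun j => ?_
  rw [norm_gevSeries_term, mul_comm (Real.exp _)]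
  exact pow_mul_exp_neg_rpow_le hs m j

lemma hasDerivAt_gevSeries {s : ℝ} (hs : 0 < s) (m : ℕ) (y : ℝ) :
    HasDerivAt (gevSeries s m) (gevSeries s (m + 1) y) y := by
  refine hasDerivAt_tsum (g := fun (j : ℕ) (z : ℝ) => (I * j) ^ m *
      (Real.exp (-((j : ℝ) ^ (1 / s))) : ℂ) * Complex.exp (I * j * z))
    (g' := fun (j : ℕ) (z : ℝ) => (I * j) ^ (m + 1) *
      (Real.exp (-((j : ℝ) ^ (1 / s))) : ℂ) * Complex.exp (I * j * z))
    (summable_gevBound hs (m + 1)) (fun j z => ?_)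
    (fun j z => (norm_gevSeries_term s (m + 1) j z).le) (y₀ := y)
    (hasSum_gevSeries hs m y).summable y
  have h1 : HasDerivAt (fun z : ℝ => I * (j : ℂ) * (z : ℂ)) (I * j) z := by
    simpa using ((hasDerivAt_id z).ofReal_comp).const_mul (I * (j : ℂ))
  refine (h1.cexp.const_mul _).congr_deriv ?_
  ring

lemma contDiff_gevSeries {s : ℝ} (hs : 0 < s) (m : ℕ) : ContDiff ℝ (⊤ : ℕ∞) (gevSeries s m) := by
  have hit : ∀ k, iteratedDeriv k (gevSeries s m) = gevSeries s (m + k) := fun k => by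
    induction k with
    | zero => simp
    | succ k ih =>
      rw [iteratedDeriv_succ, ih]
      funext y
      exact (hasDerivAt_gevSeries hs (m + k) y).deriv
  refine contDiff_of_differentiable_iteratedDeriv fun k _ => ?_
  rw [hit]
  exact fun y => (hasDerivAt_gevSeries hs _ y).differentiableAt

variable {N : ℕ}

/-- The product of a monomial in one coordinate and a Gevrey series in another one. -/
noncomputable def gevProd (s : ℝ) (i l : Fin N) (c : ℂ) (r m : ℕ) (x : Fin N → ℝ) : ℂ :=
  c * ((x i : ℂ) ^ r * gevSeries s m (x l))

lemma contDiff_gevProd {s : ℝ} (hs : 0 < s) (i l : Fin N) (c : ℂ) (r m : ℕ) :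
    ContDiff ℝ (⊤ : ℕ∞) (gevProd s i l c r m) := by
  have h1 : ContDiff ℝ (⊤ : ℕ∞) fun x : Fin N → ℝ => (x i : ℂ) :=
    Complex.ofRealCLM.contDiff.comp (contDiff_apply ℝ ℝ i)
  exact contDiff_const.mul ((h1.pow r).mul ((contDiff_gevSeries hs m).comp (contDiff_apply ℝ ℝ l)))

lemma pd_eq_of_hasDerivAt {f : (Fin N → ℝ) → ℂ} {x : Fin N → ℝ} (hf : DifferentiableAt ℝ f x)
    {j : Fin N} {d : ℂ} (hd : HasDerivAt (fun t : ℝ => f (x + t • Pi.single j 1)) d 0) :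
    pd j f x = d := by
  rw [pd, ← hf.lineDeriv_eq_fderiv]
  exact hd.deriv

lemma pd_gevProd {s : ℝ} (hs : 0 < s) (i l j : Fin N) (hil : i ≠ l) (c : ℂ) (r m : ℕ) :
    pd j (gevProd s i l c r m) = if j = i then gevProd s i l (c * r) (r - 1) m
      else if j = l then gevProd s i l c r (m + 1) else gevProd s i l 0 r m := by
  funext x
  refine pd_eq_of_hasDerivAt
    (((contDiff_gevProd hs i l c r m).differentiable (by simp)).differentiableAt) ?_
  have hline : ∀ k : Fin N, HasDerivAt (fun t : ℝ => (x + t • (Pi.single j 1 : Fin N → ℝ)) k)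
      (if j = k then 1 else 0) 0 := fun k => by
    have : (Pi.single j 1 : Fin N → ℝ) k = if j = k then 1 else 0 := by
      rw [Pi.single_apply]; simp [eq_comm]
    simp only [Pi.add_apply, Pi.smul_apply, this, smul_eq_mul]
    simpa using ((hasDerivAt_id (0 : ℝ)).mul_const (if j = k then (1 : ℝ) else 0)).const_add (x k)
  have h1 := (hline i).ofReal_comp.pow r
  have h2 := (hasDerivAt_gevSeries hs m ((x + (0 : ℝ) • (Pi.single j 1 : Fin N → ℝ)) l)).scomp
    (0 : ℝ) (hline l)
  refine ((h1.mul h2).const_mul c).congr_deriv ?_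
  simp only [zero_smul, add_zero, Function.comp_apply]
  rcases eq_or_ne j i with rfl | hji
  · simp [hil, gevProd]; ring
  · rcases eq_or_ne j l with rfl | hjl
    · simp [hji, gevProd]
    · simp [hji, hjl, gevProd]

lemma pd_gevProd_form {s : ℝ} (hs : 0 < s) {i l : Fin N} (j : Fin N) (hil : i ≠ l) {k : ℕ}
    {c : ℂ} {r m a : ℕ} (hr : r ≤ k) (hc : ‖c‖ ≤ (k + 1) ^ a) (hm : m ≤ a) :
    ∃ c' : ℂ, ∃ r' m' : ℕ, pd j (gevProd s i l c r m) = gevProd s i l c' r' m' ∧ r' ≤ k ∧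
      ‖c'‖ ≤ (k + 1) ^ (a + 1) ∧ m' ≤ a + 1 := by
  have hk : (1 : ℝ) ≤ (k : ℝ) + 1 := by linarith [(Nat.cast_nonneg k : (0 : ℝ) ≤ k)]
  have hc1 : ‖c‖ ≤ (k + 1) ^ (a + 1) := hc.trans (pow_le_pow_right₀ hk (by omega))
  rw [pd_gevProd hs i l j hil]
  split_ifs
  · refine ⟨_, _, _, rfl, by omega, ?_, by omega⟩
    rw [norm_mul, Complex.norm_natCast, pow_succ]
    have : (r : ℝ) ≤ k + 1 := by exact_mod_cast hr.trans (Nat.le_succ k)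
    gcongr
  · exact ⟨_, _, _, rfl, hr, hc1, by omega⟩
  · exact ⟨_, _, _, rfl, hr, by rw [norm_zero]; positivity, by omega⟩

lemma pd_iterate_gevProd_form {s : ℝ} (hs : 0 < s) {i l : Fin N} (j : Fin N) (hil : i ≠ l) {k : ℕ}
    {c : ℂ} {r m a : ℕ} (hr : r ≤ k) (hc : ‖c‖ ≤ (k + 1) ^ a) (hm : m ≤ a) (q : ℕ) :
    ∃ c' : ℂ, ∃ r' m' : ℕ, (pd j)^[q] (gevProd s i l c r m) = gevProd s i l c' r' m' ∧ r' ≤ k ∧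
      ‖c'‖ ≤ (k + 1) ^ (q + a) ∧ m' ≤ q + a := by
  induction q with
  | zero => exact ⟨c, r, m, rfl, hr, by simpa using hc, by simpa using hm⟩
  | succ q ih =>
    obtain ⟨c', r', m', he, hr', hc', hm'⟩ := ih
    obtain ⟨c₂, r₂, m₂, he₂, h₂⟩ := pd_gevProd_form hs j hil hr' hc' hm'
    refine ⟨c₂, r₂, m₂, ?_, ?_⟩
    · rw [Function.iterate_succ_apply', he, he₂]
    · rwa [Nat.succ_add]

lemma pdMulti_gevProd_form {s : ℝ} (hs : 0 < s) {i l : Fin N} (hil : i ≠ l) {k : ℕ} {c : ℂ}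
    (hc : ‖c‖ ≤ 1) (α : Fin N → ℕ) :
    ∃ c' : ℂ, ∃ r' m' : ℕ, pdMulti α (gevProd s i l c k 0) = gevProd s i l c' r' m' ∧ r' ≤ k ∧
      ‖c'‖ ≤ (k + 1) ^ (∑ j, α j) ∧ m' ≤ ∑ j, α j := by
  have key : ∀ L : List (Fin N), ∃ c' : ℂ, ∃ r' m' : ℕ,
      L.foldr (fun j g => (pd j)^[α j] g) (gevProd s i l c k 0) = gevProd s i l c' r' m' ∧ r' ≤ k ∧
      ‖c'‖ ≤ (k + 1) ^ ((L.map α).sum) ∧ m' ≤ (L.map α).sum := fun L => by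
    induction L with
    | nil => exact ⟨c, k, 0, rfl, le_rfl, by simpa using hc, by simp⟩
    | cons j L ih =>
      obtain ⟨c', r', m', he, hr', hc', hm'⟩ := ih
      obtain ⟨c₂, r₂, m₂, he₂, h₂⟩ := pd_iterate_gevProd_form hs j hil hr' hc' hm' (α j)
      exact ⟨c₂, r₂, m₂, by rw [List.foldr_cons, he, he₂], by simpa using h₂⟩
  have := key (List.finRange N)
  rwa [← List.sum_ofFn, List.ofFn_eq_map]

/-- Products of monomials and the Gevrey series are of Gevrey class `s`. -/
theorem gevreyOn_gevProd {s : ℝ} (hs : 1 ≤ s) {i l : Fin N} (hil : i ≠ l) (k : ℕ) {c : ℂ}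
    (hc : ‖c‖ ≤ 1) : GevreyOn s (gevProd s i l c k 0) := by
  have hs0 : 0 < s := by linarith
  refine ⟨contDiff_gevProd hs0 i l c k 0, fun K hK => ?_⟩
  obtain ⟨R, hR⟩ := hK.isBounded.exists_norm_le
  set S := ∑' j : ℕ, Real.exp (-((j : ℝ) ^ (1 / s)) / 2)
  have hS : 0 ≤ S := tsum_nonneg fun j => (Real.exp_pos _).le
  set R' := max 1 R
  have hR1 : 1 ≤ R' := le_max_left _ _
  set h₀ : ℝ := (2 * s) ^ s
  have hh₀ : 1 ≤ h₀ := Real.one_le_rpow (by linarith) hs0.le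
  refine ⟨R' ^ k * S + 1, by positivity, (k + 1) * h₀, by positivity, fun x hx α => ?_⟩
  obtain ⟨c', r', m', he, hr', hc', hm'⟩ := pdMulti_gevProd_form hs0 hil (k := k) hc α
  rw [he, gevProd, norm_mul, norm_mul, norm_pow, Complex.norm_real]
  set a := ∑ j, α j
  have h1 : ‖x i‖ ^ r' ≤ R' ^ k :=
    (pow_le_pow_left₀ (norm_nonneg _) (((norm_le_pi_norm x i).trans (hR x hx)).trans
      (le_max_right _ _)) r').trans (pow_le_pow_right₀ hR1 hr')
  have h2 : ‖gevSeries s m' (x l)‖ ≤ S * (h₀ ^ a * (a.factorial : ℝ) ^ s) := by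
    refine (norm_gevSeries_le hs0 m' (x l)).trans (mul_le_mul_of_nonneg_left ?_ hS)
    refine mul_le_mul (pow_le_pow_right₀ hh₀ hm') ?_ (by positivity) (by positivity)
    exact Real.rpow_le_rpow (by positivity) (by exact_mod_cast Nat.factorial_le hm') hs0.le
  calc ‖c'‖ * (‖x i‖ ^ r' * ‖gevSeries s m' (x l)‖)
      ≤ (k + 1) ^ a * (R' ^ k * (S * (h₀ ^ a * (a.factorial : ℝ) ^ s))) := by gcongr
    _ = R' ^ k * S * ((k + 1) * h₀) ^ a * (a.factorial : ℝ) ^ s := by rw [mul_pow]; ring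
    _ ≤ _ := by gcongr; linarith

end GevreyData

open MeasureTheory

section Slice

variable {N : ℕ}

/-- Smooth functions with compact support. -/
structure TestFn (q : (Fin N → ℝ) → ℂ) : Prop where
  smooth : ContDiff ℝ (⊤ : ℕ∞) q
  compactSupport : HasCompactSupport q

lemma contDiff_pd {q : (Fin N → ℝ) → ℂ} (hq : ContDiff ℝ (⊤ : ℕ∞) q) (j : Fin N) :
    ContDiff ℝ (⊤ : ℕ∞) (pd j q) :=
  (hq.fderiv_right (m := (⊤ : ℕ∞)) (by simp)).clm_apply contDiff_const

lemma TestFn.dop {q : (Fin N → ℝ) → ℂ} (hq : TestFn q) (j : Fin N) : TestFn (Dop j q) where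
  smooth := contDiff_const.mul (contDiff_pd hq.smooth j)
  compactSupport := by
    have h : HasCompactSupport (pd j q) := hq.compactSupport.fderiv_apply ℝ _
    exact h.mul_left

lemma TestFn.mul {q p : (Fin N → ℝ) → ℂ} (hq : TestFn q) (hp : ContDiff ℝ (⊤ : ℕ∞) p) :
    TestFn fun x => p x * q x :=
  ⟨hp.mul hq.smooth, hq.compactSupport.mul_left⟩

lemma TestFn.continuous {q : (Fin N → ℝ) → ℂ} (hq : TestFn q) : Continuous q := hq.smooth.continuous

lemma TestFn.exists_bound {q : (Fin N → ℝ) → ℂ} (hq : TestFn q) :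
    ∃ R : ℝ, 0 < R ∧ (∀ x, ‖q x‖ ≤ R) ∧ ∀ x, R < ‖x‖ → q x = 0 := by
  obtain ⟨B, hB⟩ := hq.compactSupport.exists_bound_of_continuous hq.continuous
  obtain ⟨R, hR⟩ := hq.compactSupport.isCompact.isBounded.exists_norm_le
  refine ⟨max 1 (max B R), by positivity, fun x => (hB x).trans (by simp), fun x hx => ?_⟩
  by_contra h
  have := hR x (subset_tsupport _ h)
  have h2 : R ≤ max 1 (max B R) := by simp
  linarith

/-- The point with prescribed coordinates `t`, `z.1`, `z.2` in three coordinate directions. -/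
noncomputable def slicePt (i₀ i₁ i₂ : Fin N) (t : ℝ) (z : ℝ × ℝ) : Fin N → ℝ :=
  t • Pi.single i₀ 1 + z.1 • Pi.single i₁ 1 + z.2 • Pi.single i₂ 1

/-- The integral of a slice of `q` against the plane wave `Φ (ρ x) exp (-i ρ² y)`. -/
noncomputable def sliceInt (i₀ i₁ i₂ : Fin N) (Φ : ℂ → ℂ) (q : (Fin N → ℝ) → ℂ) (ρ t : ℝ) : ℂ :=
  ∫ z : ℝ × ℝ, q (slicePt i₀ i₁ i₂ t z) * (Φ (ρ * z.1 : ℝ) * cexp (-I * (ρ ^ 2 : ℝ) * z.2))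

variable {i₀ i₁ i₂ : Fin N}

lemma continuous_slicePt : Continuous fun p : ℝ × (ℝ × ℝ) => slicePt i₀ i₁ i₂ p.1 p.2 := by
  unfold slicePt; fun_prop

lemma norm_le_norm_slicePt (h₀₁ : i₀ ≠ i₁) (h₀₂ : i₀ ≠ i₂) (h₁₂ : i₁ ≠ i₂) (t : ℝ) (z : ℝ × ℝ) :
    ‖z‖ ≤ ‖slicePt i₀ i₁ i₂ t z‖ := by
  rw [Prod.norm_def]
  refine max_le ?_ ?_
  · refine le_trans (le_of_eq ?_) (norm_le_pi_norm _ i₁)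
    simp [slicePt, h₀₁.symm, h₁₂]
  · refine le_trans (le_of_eq ?_) (norm_le_pi_norm _ i₂)
    simp [slicePt, h₀₂.symm, h₁₂.symm]

lemma hasCompactSupport_slice (h₀₁ : i₀ ≠ i₁) (h₀₂ : i₀ ≠ i₂) (h₁₂ : i₁ ≠ i₂)
    {q : (Fin N → ℝ) → ℂ} (hq : TestFn q) (t : ℝ) :
    HasCompactSupport fun z => q (slicePt i₀ i₁ i₂ t z) := by
  obtain ⟨R, -, -, hR⟩ := hq.exists_bound
  refine HasCompactSupport.intro (isCompact_closedBall (0 : ℝ × ℝ) R) fun z hz => hR _ ?_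
  rw [mem_closedBall_zero_iff, not_le] at hz
  exact hz.trans_le (norm_le_norm_slicePt h₀₁ h₀₂ h₁₂ t z)

lemma continuous_slice {q : (Fin N → ℝ) → ℂ} (hq : Continuous q) (t : ℝ) :
    Continuous fun z => q (slicePt i₀ i₁ i₂ t z) :=
  hq.comp (continuous_slicePt.comp (continuous_const.prodMk continuous_id))

lemma integrable_slice_mul (h₀₁ : i₀ ≠ i₁) (h₀₂ : i₀ ≠ i₂) (h₁₂ : i₁ ≠ i₂)
    {q : (Fin N → ℝ) → ℂ} (hq : TestFn q) (t : ℝ) {ψ : ℝ × ℝ → ℂ} (hψ : Continuous ψ) :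
    Integrable fun z => q (slicePt i₀ i₁ i₂ t z) * ψ z :=
  ((continuous_slice hq.continuous t).mul hψ).integrable_of_hasCompactSupport
    (hasCompactSupport_slice h₀₁ h₀₂ h₁₂ hq t).mul_right

lemma hasDerivAt_line {q : (Fin N → ℝ) → ℂ} (hq : ContDiff ℝ (⊤ : ℕ∞) q) (j : Fin N)
    (a : Fin N → ℝ) (t : ℝ) :
    HasDerivAt (fun t : ℝ => q (a + t • Pi.single j 1)) (pd j q (a + t • Pi.single j 1)) t := by
  have h1 : HasDerivAt (fun t : ℝ => a + t • (Pi.single j 1 : Fin N → ℝ)) (Pi.single j 1) t := by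
    simpa using ((hasDerivAt_id t).smul_const (Pi.single j 1 : Fin N → ℝ)).const_add a
  exact ((hq.differentiable (by simp)) _).hasFDerivAt.comp_hasDerivAt t h1

lemma hasDerivAt_slice {q : (Fin N → ℝ) → ℂ} (hq : ContDiff ℝ (⊤ : ℕ∞) q) (t : ℝ) (z : ℝ × ℝ) :
    HasDerivAt (fun t => q (slicePt i₀ i₁ i₂ t z)) (pd i₀ q (slicePt i₀ i₁ i₂ t z)) t := by
  have := hasDerivAt_line hq i₀ (z.1 • Pi.single i₁ 1 + z.2 • Pi.single i₂ 1) t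
  have he : ∀ t, z.1 • Pi.single i₁ 1 + z.2 • Pi.single i₂ 1 + t • Pi.single i₀ 1 =
    slicePt i₀ i₁ i₂ t z := fun t => by rw [slicePt]; abel
  simpa only [he] using this

lemma hasLineDerivAt_slice_fst {q : (Fin N → ℝ) → ℂ} (hq : ContDiff ℝ (⊤ : ℕ∞) q) (t : ℝ)
    (z : ℝ × ℝ) : HasLineDerivAt ℝ (fun z => q (slicePt i₀ i₁ i₂ t z))
      (pd i₁ q (slicePt i₀ i₁ i₂ t z)) z (1, 0) := by
  have := hasDerivAt_line hq i₁ (slicePt i₀ i₁ i₂ t z) 0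
  have he : ∀ r : ℝ, slicePt i₀ i₁ i₂ t z + r • Pi.single i₁ 1 =
    slicePt i₀ i₁ i₂ t (z + r • (1, 0)) := fun r => by
      simp only [slicePt, Prod.fst_add, Prod.snd_add, Prod.smul_fst, Prod.smul_snd, smul_eq_mul,
        mul_one, mul_zero, add_zero, add_smul]
      abel
  simp only [he, zero_smul, add_zero] at this
  exact this

lemma hasLineDerivAt_slice_snd {q : (Fin N → ℝ) → ℂ} (hq : ContDiff ℝ (⊤ : ℕ∞) q) (t : ℝ)
    (z : ℝ × ℝ) : HasLineDerivAt ℝ (fun z => q (slicePt i₀ i₁ i₂ t z))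
      (pd i₂ q (slicePt i₀ i₁ i₂ t z)) z (0, 1) := by
  have := hasDerivAt_line hq i₂ (slicePt i₀ i₁ i₂ t z) 0
  have he : ∀ r : ℝ, slicePt i₀ i₁ i₂ t z + r • Pi.single i₂ 1 =
    slicePt i₀ i₁ i₂ t (z + r • (0, 1)) := fun r => by
      simp only [slicePt, Prod.fst_add, Prod.snd_add, Prod.smul_fst, Prod.smul_snd, smul_eq_mul,
        mul_one, mul_zero, add_zero, add_smul]
      abel
  simp only [he, zero_smul, add_zero] at this
  exact this

lemma continuous_planeWave {Φ : ℂ → ℂ} (hΦ : Continuous Φ) (ρ : ℝ) :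
    Continuous fun z : ℝ × ℝ => Φ (ρ * z.1 : ℝ) * cexp (-I * (ρ ^ 2 : ℝ) * z.2) := by fun_prop

lemma integral_slice_parts (h₀₁ : i₀ ≠ i₁) (h₀₂ : i₀ ≠ i₂) (h₁₂ : i₁ ≠ i₂)
    {q : (Fin N → ℝ) → ℂ} (hq : TestFn q) (t : ℝ) {j : Fin N} {v : ℝ × ℝ}
    (hv : ∀ z, HasLineDerivAt ℝ (fun z => q (slicePt i₀ i₁ i₂ t z))
      (pd j q (slicePt i₀ i₁ i₂ t z)) z v) {ψ ψ' : ℝ × ℝ → ℂ} (hψ : Continuous ψ)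
    (hψ' : Continuous ψ') (hd : ∀ z, HasLineDerivAt ℝ ψ (ψ' z) z v) :
    ∫ z, Dop j q (slicePt i₀ i₁ i₂ t z) * ψ z =
      I * ∫ z, q (slicePt i₀ i₁ i₂ t z) * ψ' z := by
  have hp : TestFn (pd j q) := ⟨contDiff_pd hq.smooth j, hq.compactSupport.fderiv_apply ℝ _⟩
  have h := integral_bilinear_hasLineDerivAt_right_eq_neg_left_of_integrable
    (μ := (volume : Measure (ℝ × ℝ))) (B := ContinuousLinearMap.mul ℝ ℂ) (f := ψ) (f' := ψ')
    (g := fun z => q (slicePt i₀ i₁ i₂ t z)) (g' := fun z => pd j q (slicePt i₀ i₁ i₂ t z)) (v := v)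
    (by simpa [mul_comm] using integrable_slice_mul h₀₁ h₀₂ h₁₂ hq t hψ')
    (by simpa [mul_comm] using integrable_slice_mul h₀₁ h₀₂ h₁₂ hp t hψ)
    (by simpa [mul_comm] using integrable_slice_mul h₀₁ h₀₂ h₁₂ hq t hψ) (fun z _ => hd z)
    fun z _ => hv z
  simp only [ContinuousLinearMap.mul_apply'] at h
  simp only [Dop, mul_assoc, integral_const_mul]
  simp only [mul_comm (pd j q _), mul_comm (q _), h]
  ring

lemma sliceInt_dop_fst (h₀₁ : i₀ ≠ i₁) (h₀₂ : i₀ ≠ i₂) (h₁₂ : i₁ ≠ i₂)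
    {q : (Fin N → ℝ) → ℂ} (hq : TestFn q) {Φ Φ' : ℂ → ℂ} (hΦ : ∀ z, HasDerivAt Φ (Φ' z) z)
    (hΦ' : Continuous Φ') (ρ t : ℝ) :
    sliceInt i₀ i₁ i₂ Φ (Dop i₁ q) ρ t = I * ρ * sliceInt i₀ i₁ i₂ Φ' q ρ t := by
  have hc : Continuous Φ := continuous_iff_continuousAt.2 fun z => (hΦ z).continuousAt
  rw [sliceInt, integral_slice_parts h₀₁ h₀₂ h₁₂ hq t (hasLineDerivAt_slice_fst hq.smooth t)
    (continuous_planeWave hc ρ)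
    (ψ' := fun z => ρ * (Φ' (ρ * z.1 : ℝ) * cexp (-I * (ρ ^ 2 : ℝ) * z.2)))
    (continuous_const.mul (continuous_planeWave hΦ' ρ)), sliceInt]
  · simp only [mul_left_comm (q _), integral_const_mul, mul_assoc]
  · intro z
    have h1 : HasDerivAt (fun r : ℝ => ((ρ * (z.1 + r) : ℝ) : ℂ)) ρ 0 := by
      simpa using (((hasDerivAt_id (0 : ℝ)).const_add z.1).const_mul ρ).ofReal_comp
    have h2 := HasDerivAt.comp (h := fun r : ℝ => ((ρ * (z.1 + r) : ℝ) : ℂ)) (0 : ℝ)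
      (hΦ ((ρ * (z.1 + 0) : ℝ) : ℂ)) h1
    rw [HasLineDerivAt]
    simp only [Prod.fst_add, Prod.snd_add, Prod.smul_fst, Prod.smul_snd, smul_eq_mul, mul_one,
      mul_zero, add_zero] at h2 ⊢
    refine (h2.mul_const _).congr_deriv ?_
    ring

lemma sliceInt_dop_snd (h₀₁ : i₀ ≠ i₁) (h₀₂ : i₀ ≠ i₂) (h₁₂ : i₁ ≠ i₂)
    {q : (Fin N → ℝ) → ℂ} (hq : TestFn q) {Φ : ℂ → ℂ} (hΦ : Continuous Φ) (ρ t : ℝ) :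
    sliceInt i₀ i₁ i₂ Φ (Dop i₂ q) ρ t = ρ ^ 2 * sliceInt i₀ i₁ i₂ Φ q ρ t := by
  rw [sliceInt, integral_slice_parts h₀₁ h₀₂ h₁₂ hq t (hasLineDerivAt_slice_snd hq.smooth t)
    (continuous_planeWave hΦ ρ)
    (ψ' := fun z => (-I * (ρ ^ 2 : ℝ)) * (Φ (ρ * z.1 : ℝ) * cexp (-I * (ρ ^ 2 : ℝ) * z.2)))
    (continuous_const.mul (continuous_planeWave hΦ ρ)), sliceInt]
  · simp only [mul_left_comm (q _), integral_const_mul]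
    rw [← mul_assoc]
    congr 1
    push_cast
    linear_combination (-(ρ : ℂ) ^ 2) * I_mul_I
  · intro z
    have h1 : HasDerivAt (fun r : ℝ => -I * ((ρ ^ 2 : ℝ) : ℂ) * ((z.2 + r : ℝ) : ℂ))
        (-I * (ρ ^ 2 : ℝ)) 0 := by
      refine ((((hasDerivAt_id (0 : ℝ)).const_add z.2).ofReal_comp).const_mul
        (-I * ((ρ ^ 2 : ℝ) : ℂ))).congr_deriv ?_
      simp
    have h2 := h1.cexp
    rw [HasLineDerivAt]
    simp only [Prod.fst_add, Prod.snd_add, Prod.smul_fst, Prod.smul_snd, smul_eq_mul, mul_one,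
      mul_zero, add_zero] at h2 ⊢
    refine (h2.const_mul _).congr_deriv ?_
    ring

lemma hasDerivAt_sliceInt (h₀₁ : i₀ ≠ i₁) (h₀₂ : i₀ ≠ i₂) (h₁₂ : i₁ ≠ i₂)
    {q : (Fin N → ℝ) → ℂ} (hq : TestFn q) {Φ : ℂ → ℂ} (hΦ : Continuous Φ) (ρ t : ℝ) :
    HasDerivAt (sliceInt i₀ i₁ i₂ Φ q ρ) (I * sliceInt i₀ i₁ i₂ Φ (Dop i₀ q) ρ t) t := by
  have hp : TestFn (pd i₀ q) := ⟨contDiff_pd hq.smooth i₀, hq.compactSupport.fderiv_apply ℝ _⟩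
  obtain ⟨R, hR, hB, h0⟩ := hp.exists_bound
  set ψ : ℝ × ℝ → ℂ := fun z => Φ (ρ * z.1 : ℝ) * cexp (-I * (ρ ^ 2 : ℝ) * z.2) with hψdef
  have hψ : Continuous ψ := continuous_planeWave hΦ ρ
  have key := hasDerivAt_integral_of_dominated_loc_of_deriv_le (μ := (volume : Measure (ℝ × ℝ)))
    (F := fun t z => q (slicePt i₀ i₁ i₂ t z) * ψ z)
    (F' := fun t z => pd i₀ q (slicePt i₀ i₁ i₂ t z) * ψ z) (x₀ := t)
    (bound := (Metric.closedBall (0 : ℝ × ℝ) R).indicator fun z => R * ‖ψ z‖)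
    (Metric.ball_mem_nhds t one_pos)
    (Filter.Eventually.of_forall fun τ =>
      (integrable_slice_mul h₀₁ h₀₂ h₁₂ hq τ hψ).aestronglyMeasurable)
    (integrable_slice_mul h₀₁ h₀₂ h₁₂ hq t hψ)
    (integrable_slice_mul h₀₁ h₀₂ h₁₂ hp t hψ).aestronglyMeasurable
    (Filter.Eventually.of_forall fun z τ _ => ?_) ?_
    (Filter.Eventually.of_forall fun z τ _ => (hasDerivAt_slice hq.smooth τ z).mul_const _)
  · refine key.2.congr_deriv ?_
    rw [sliceInt, ← integral_const_mul]
    congr 1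
    funext z
    rw [Dop]
    linear_combination ((pd i₀ q (slicePt i₀ i₁ i₂ t z) * ψ z)) * I_mul_I
  · by_cases hz : z ∈ Metric.closedBall (0 : ℝ × ℝ) R
    · rw [Set.indicator_of_mem hz, norm_mul]
      exact mul_le_mul_of_nonneg_right (hB _) (norm_nonneg _)
    · rw [Set.indicator_of_notMem hz, h0, zero_mul, norm_zero]
      rw [mem_closedBall_zero_iff, not_le] at hz
      exact hz.trans_le (norm_le_norm_slicePt h₀₁ h₀₂ h₁₂ τ z)
  · rw [integrable_indicator_iff measurableSet_closedBall]
    exact (continuous_const.mul hψ.norm).continuousOn.integrableOn_compact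
      (isCompact_closedBall _ _)

end Slice

section Green

/-- The reduced operator applied to a slice integral against a plane wave. -/
lemma sliceInt_pop {n : ℕ} (hn : 2 ≤ n) {b : ℝ} {ζ : ℂ} {W W' : ℂ → ℂ}
    (h : SolPair (fun y => y ^ 2 + b * y ^ 3 / ζ - ζ ^ 2) W W') {g : (Fin (n + 1) → ℝ) → ℂ}
    (hg : TestFn g) {ρ : ℝ} (hρ : 0 < ρ) (t : ℝ) :
    sliceInt 0 1 (Fin.last n) W (Pop n b g) ρ t =
      sliceInt 0 1 (Fin.last n) W (Dop 0 (Dop 0 (Dop 0 g))) ρ t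
      + ρ ^ 2 * (b / ζ * sliceInt 0 1 (Fin.last n) (fun y => y ^ 3 * W y) (Dop 0 g) ρ t
        - ζ ^ 2 * sliceInt 0 1 (Fin.last n) W (Dop 0 g) ρ t)
      - b * ρ ^ 3 * sliceInt 0 1 (Fin.last n) (fun y => y ^ 3 * W y) g ρ t := by
  have h1 : (1 : Fin (n + 1)).val = 1 := by rw [Fin.val_one']; exact Nat.mod_eq_of_lt (by omega)
  have h₀₁ : (0 : Fin (n + 1)) ≠ 1 := fun hh => by
    have := congrArg Fin.val hh; rw [h1] at this; simp at this
  have h₀₂ : (0 : Fin (n + 1)) ≠ Fin.last n := fun hh => by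
    have := congrArg Fin.val hh; simp at this; omega
  have h₁₂ : (1 : Fin (n + 1)) ≠ Fin.last n := fun hh => by
    have := congrArg Fin.val hh; rw [h1] at this; simp at this; omega
  have hW := h.continuous_fst
  have hW' := h.continuous_snd
  have hW2 : Continuous fun y => y ^ 2 * W y := by fun_prop
  have hW3 : Continuous fun y => y ^ 3 * W y := by fun_prop
  have hQW : Continuous fun y => (y ^ 2 + b * y ^ 3 / ζ - ζ ^ 2) * W y := by fun_prop
  have hx : ∀ z : ℝ × ℝ, slicePt (0 : Fin (n + 1)) 1 (Fin.last n) t z 1 = z.1 := fun z => by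
    simp [slicePt, h₀₁.symm, h₁₂]
  have hρ' : (ρ : ℂ) ≠ 0 := by exact_mod_cast hρ.ne'
  have iA := integrable_slice_mul h₀₁ h₀₂ h₁₂ ((hg.dop 0).dop 0 |>.dop 0) t
    (continuous_planeWave hW ρ)
  have iB := integrable_slice_mul h₀₁ h₀₂ h₁₂ (((hg.dop 0).dop 1).dop 1) t
    (continuous_planeWave hW ρ)
  have iC := integrable_slice_mul h₀₁ h₀₂ h₁₂ (((hg.dop 0).dop (Fin.last n)).dop (Fin.last n)) t
    (continuous_planeWave hW2 ρ)
  have iD := integrable_slice_mul h₀₁ h₀₂ h₁₂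
    (((hg.dop (Fin.last n)).dop (Fin.last n)).dop (Fin.last n)) t (continuous_planeWave hW3 ρ)
  have hsub : ∀ {u v : ℝ × ℝ → ℂ}, Integrable u → Integrable v → Integrable fun z => u z - v z :=
    fun hu hv => hu.sub hv
  have e1 : sliceInt 0 1 (Fin.last n) W (Pop n b g) ρ t =
      sliceInt 0 1 (Fin.last n) W (Dop 0 (Dop 0 (Dop 0 g))) ρ t
      - sliceInt 0 1 (Fin.last n) W (Dop 1 (Dop 1 (Dop 0 g))) ρ t
      - ((ρ : ℂ) ^ 2)⁻¹ * sliceInt 0 1 (Fin.last n) (fun y => y ^ 2 * W y)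
          (Dop (Fin.last n) (Dop (Fin.last n) (Dop 0 g))) ρ t
      - b * ((ρ : ℂ) ^ 3)⁻¹ * sliceInt 0 1 (Fin.last n) (fun y => y ^ 3 * W y)
          (Dop (Fin.last n) (Dop (Fin.last n) (Dop (Fin.last n) g))) ρ t := by
    simp only [sliceInt]
    rw [← integral_const_mul, ← integral_const_mul, ← integral_sub iA iB,
      ← integral_sub (hsub iA iB) (iC.const_mul _),
      ← integral_sub (hsub (hsub iA iB) (iC.const_mul _)) (iD.const_mul _)]
    congr 1
    funext z
    simp only [Pop, hx]
    push_cast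
    field_simp
    ring
  have e2 : sliceInt 0 1 (Fin.last n) W (Dop 1 (Dop 1 (Dop 0 g))) ρ t =
      -ρ ^ 2 * sliceInt 0 1 (Fin.last n) (fun y => (y ^ 2 + b * y ^ 3 / ζ - ζ ^ 2) * W y)
        (Dop 0 g) ρ t := by
    rw [sliceInt_dop_fst h₀₁ h₀₂ h₁₂ ((hg.dop 0).dop 1) h.deriv_fst hW',
      sliceInt_dop_fst h₀₁ h₀₂ h₁₂ (hg.dop 0) h.deriv_snd hQW]
    linear_combination (ρ ^ 2 * sliceInt 0 1 (Fin.last n)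
      (fun y => (y ^ 2 + b * y ^ 3 / ζ - ζ ^ 2) * W y) (Dop 0 g) ρ t) * I_mul_I
  have iE := integrable_slice_mul h₀₁ h₀₂ h₁₂ (hg.dop 0) t (continuous_planeWave hW ρ)
  have iF := integrable_slice_mul h₀₁ h₀₂ h₁₂ (hg.dop 0) t (continuous_planeWave hW2 ρ)
  have iG := integrable_slice_mul h₀₁ h₀₂ h₁₂ (hg.dop 0) t (continuous_planeWave hW3 ρ)
  have e3 : sliceInt 0 1 (Fin.last n) (fun y => (y ^ 2 + b * y ^ 3 / ζ - ζ ^ 2) * W y)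
        (Dop 0 g) ρ t = sliceInt 0 1 (Fin.last n) (fun y => y ^ 2 * W y) (Dop 0 g) ρ t
      + b / ζ * sliceInt 0 1 (Fin.last n) (fun y => y ^ 3 * W y) (Dop 0 g) ρ t
      - ζ ^ 2 * sliceInt 0 1 (Fin.last n) W (Dop 0 g) ρ t := by
    simp only [sliceInt]
    rw [← integral_const_mul, ← integral_const_mul, ← integral_add iF (iG.const_mul _),
      ← integral_sub (iF.fun_add (iG.const_mul _)) (iE.const_mul _)]
    congr 1
    funext z
    ring
  rw [e1, e2, e3, sliceInt_dop_snd h₀₁ h₀₂ h₁₂ ((hg.dop 0).dop _) hW2,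
    sliceInt_dop_snd h₀₁ h₀₂ h₁₂ (hg.dop 0) hW2,
    sliceInt_dop_snd h₀₁ h₀₂ h₁₂ ((hg.dop _).dop _) hW3,
    sliceInt_dop_snd h₀₁ h₀₂ h₁₂ (hg.dop _) hW3, sliceInt_dop_snd h₀₁ h₀₂ h₁₂ hg hW3]
  generalize sliceInt 0 1 (Fin.last n) (fun y => y ^ 3 * W y) g ρ t = X
  generalize sliceInt 0 1 (Fin.last n) (fun y => y ^ 3 * W y) (Dop 0 g) ρ t = X'
  generalize sliceInt 0 1 (Fin.last n) (fun y => y ^ 2 * W y) (Dop 0 g) ρ t = X''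
  have f1 : ((ρ : ℂ) ^ 2)⁻¹ * (ρ ^ 2 * (ρ ^ 2 * X'')) = ρ ^ 2 * X'' := by field_simp
  have f2 : ((ρ : ℂ) ^ 3)⁻¹ * (ρ ^ 2 * (ρ ^ 2 * (ρ ^ 2 * X))) = ρ ^ 3 * X := by field_simp
  rw [f1, mul_assoc, f2]
  ring

/-- The boundary term in the Green identity. -/
noncomputable def greenTerm (n : ℕ) (b : ℝ) (ζ : ℂ) (W : ℂ → ℂ) (g : (Fin (n + 1) → ℝ) → ℂ)
    (ρ t : ℝ) : ℂ :=
  sliceInt 0 1 (Fin.last n) W (Dop 0 (Dop 0 g)) ρ t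
    + ζ * ρ * sliceInt 0 1 (Fin.last n) W (Dop 0 g) ρ t
    + b / ζ * ρ ^ 2 * sliceInt 0 1 (Fin.last n) (fun y => y ^ 3 * W y) g ρ t

lemma green_identity {n : ℕ} (hn : 2 ≤ n) {b : ℝ} {ζ : ℂ} (hζ : ζ ≠ 0) {W W' : ℂ → ℂ}
    (h : SolPair (fun y => y ^ 2 + b * y ^ 3 / ζ - ζ ^ 2) W W') {g : (Fin (n + 1) → ℝ) → ℂ}
    (hg : TestFn g) {ρ : ℝ} (hρ : 0 < ρ) (T : ℝ) :
    I * ∫ t in (0 : ℝ)..T, cexp (-I * ζ * ρ * t) *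
        sliceInt 0 1 (Fin.last n) W (Pop n b g) ρ t =
      cexp (-I * ζ * ρ * T) * greenTerm n b ζ W g ρ T - greenTerm n b ζ W g ρ 0 := by
  have h1 : (1 : Fin (n + 1)).val = 1 := by rw [Fin.val_one']; exact Nat.mod_eq_of_lt (by omega)
  have h₀₁ : (0 : Fin (n + 1)) ≠ 1 := fun hh => by
    have := congrArg Fin.val hh; rw [h1] at this; simp at this
  have h₀₂ : (0 : Fin (n + 1)) ≠ Fin.last n := fun hh => by
    have := congrArg Fin.val hh; simp at this; omega
  have h₁₂ : (1 : Fin (n + 1)) ≠ Fin.last n := fun hh => by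
    have := congrArg Fin.val hh; rw [h1] at this; simp at this; omega
  have hW := h.continuous_fst
  have hW3 : Continuous fun y => y ^ 3 * W y := by fun_prop
  have hd : ∀ {q : (Fin (n + 1) → ℝ) → ℂ} (_ : TestFn q) {Φ : ℂ → ℂ} (_ : Continuous Φ) (t : ℝ),
      HasDerivAt (sliceInt 0 1 (Fin.last n) Φ q ρ)
        (I * sliceInt 0 1 (Fin.last n) Φ (Dop 0 q) ρ t) t :=
    fun hq _ hΦ t => hasDerivAt_sliceInt h₀₁ h₀₂ h₁₂ hq hΦ ρ t
  have hc : ∀ {q : (Fin (n + 1) → ℝ) → ℂ} (_ : TestFn q) {Φ : ℂ → ℂ} (_ : Continuous Φ),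
      Continuous fun t => sliceInt 0 1 (Fin.last n) Φ q ρ t :=
    fun hq _ hΦ => continuous_iff_continuousAt.2 fun t => (hd hq hΦ t).continuousAt
  have key : ∀ t : ℝ, HasDerivAt (fun t : ℝ => cexp (-I * ζ * ρ * t) * greenTerm n b ζ W g ρ t)
      (I * (cexp (-I * ζ * ρ * t) * sliceInt 0 1 (Fin.last n) W (Pop n b g) ρ t)) t := fun t => by
    have e1 : HasDerivAt (fun t : ℝ => cexp (-I * ζ * ρ * t))
        (cexp (-I * ζ * ρ * t) * (-I * ζ * ρ)) t := by
      have : HasDerivAt (fun t : ℝ => -I * ζ * ρ * (t : ℂ)) (-I * ζ * ρ) t := by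
        simpa using ((hasDerivAt_id t).ofReal_comp).const_mul (-I * ζ * ρ)
      exact this.cexp
    have e2 := ((hd ((hg.dop 0).dop 0) hW t).add ((hd (hg.dop 0) hW t).const_mul (ζ * ρ))).add
      ((hd hg hW3 t).const_mul (b / ζ * ρ ^ 2))
    refine (e1.mul e2).congr_deriv ?_
    rw [sliceInt_pop hn h hg hρ]
    simp only [Pi.add_apply]
    field_simp
    ring
  rw [← intervalIntegral.integral_const_mul, intervalIntegral.integral_eq_sub_of_hasDerivAt
    (fun t _ => key t)]
  · simp
  · refine Continuous.intervalIntegrable ?_ _ _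
    have : Continuous fun t => sliceInt 0 1 (Fin.last n) W (Pop n b g) ρ t := by
      simp only [sliceInt_pop hn h hg hρ]
      have c1 := hc (((hg.dop 0).dop 0).dop 0) hW
      have c2 := hc (hg.dop 0) hW3
      have c3 := hc (hg.dop 0) hW
      have c4 := hc hg hW3
      fun_prop
    fun_prop

end Green

section Saddle

lemma exists_pow_mul_exp_neg_le (k : ℕ) {c : ℝ} (hc : 0 < c) :
    ∃ A : ℝ, 0 < A ∧ ∀ M : ℝ, 0 ≤ M → M ^ k * Real.exp (-c * M) ≤ A * Real.exp (-(c / 2) * M) := by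
  refine ⟨k.factorial * (2 / c) ^ k, by positivity, fun M hM => ?_⟩
  have h := Real.pow_div_factorial_le_exp (c / 2 * M) (by positivity) k
  rw [div_le_iff₀ (by positivity), mul_pow] at h
  have h1 : M ^ k ≤ k.factorial * (2 / c) ^ k * Real.exp (c / 2 * M) := by
    have h2 : (2 / c) ^ k * (c / 2) ^ k = 1 := by
      rw [← mul_pow, div_mul_div_comm, mul_comm c 2, div_self (by positivity), one_pow]
    calc M ^ k = (2 / c) ^ k * ((c / 2) ^ k * M ^ k) := by rw [← mul_assoc, h2, one_mul]
      _ ≤ (2 / c) ^ k * (Real.exp (c / 2 * M) * k.factorial) := by gcongr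
      _ = _ := by ring
  have h3 : Real.exp (-(c / 2) * M) = Real.exp (c / 2 * M) * Real.exp (-c * M) := by
    rw [← Real.exp_add]; congr 1; ring
  rw [h3, ← mul_assoc]
  exact mul_le_mul_of_nonneg_right h1 (Real.exp_pos _).le

/-- Square roots of points close to the positive half line. -/
lemma sqrt_sector {M κ : ℝ} (hM : 0 < M) {r : ℂ} (hr : 0 < r.re) (h1 : M / 2 ≤ (r ^ 2).re)
    (h2 : |(r ^ 2).im| ≤ κ * M) : M / 2 ≤ r.re ^ 2 ∧ |r.im| ≤ κ * r.re := by
  have e1 : (r ^ 2).re = r.re ^ 2 - r.im ^ 2 := by rw [sq, mul_re]; ring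
  have e2 : (r ^ 2).im = 2 * r.re * r.im := by rw [sq, mul_im]; ring
  have h3 : M / 2 ≤ r.re ^ 2 := by nlinarith [sq_nonneg r.im]
  refine ⟨h3, ?_⟩
  rw [e2, abs_mul, abs_of_pos (by positivity)] at h2
  have hκ : 0 ≤ κ := by
    have : 0 ≤ κ * M := le_trans (by positivity) h2
    exact nonneg_of_mul_nonneg_left this hM
  have : 2 * r.re * |r.im| ≤ 2 * r.re * (κ * r.re) := by nlinarith
  exact le_of_mul_le_mul_left this (by positivity)

/-- The factor multiplying the Gaussian weight, as a function of the square root `r` of the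
frequency. -/
noncomputable def waveKer (ζ : ℂ) (Φ : ℂ → ℂ) (p : ℕ) (t x y : ℝ) (r : ℂ) : ℂ :=
  r ^ p * (cexp (-I * ζ * r * t) * (Φ (r * x) * cexp (-I * r ^ 2 * y)))

lemma norm_waveKer_le {ζ : ℂ} {Φ : ℂ → ℂ} {κ c C κ' : ℝ} (hc : 0 < c) (hC : 0 < C)
    (hb : ∀ z : ℂ, |z.im| ≤ κ * |z.re| → ‖Φ z‖ ≤ C * Real.exp (-c * ‖z‖ ^ 2)) (hκ : κ' ≤ κ)
    (hζ : ζ.im + ‖ζ‖ * κ' ≤ 0) (p : ℕ) {t : ℝ} (ht : 0 ≤ t) (x y : ℝ) {r : ℂ} (hr : 0 < r.re)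
    (hr' : |r.im| ≤ κ' * r.re) :
    ‖waveKer ζ Φ p t x y r‖ ≤
      ‖r‖ ^ p * (C * Real.exp (-c * (r.re * x) ^ 2) * Real.exp ((r ^ 2).im * y)) := by
  have e1 : ‖cexp (-I * ζ * r * t)‖ ≤ 1 := by
    rw [Complex.norm_exp, Real.exp_le_one_iff]
    have : (-I * ζ * r * t).re = (ζ.im * r.re + ζ.re * r.im) * t := by simp; ring
    rw [this]
    refine mul_nonpos_of_nonpos_of_nonneg ?_ ht
    have h1 : ζ.re * r.im ≤ ‖ζ‖ * (κ' * r.re) := (le_abs_self _).trans (by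
      rw [abs_mul]
      exact mul_le_mul (abs_re_le_norm ζ) hr' (abs_nonneg _) (norm_nonneg _))
    nlinarith
  have e2 : ‖cexp (-I * r ^ 2 * y)‖ = Real.exp ((r ^ 2).im * y) := by
    rw [Complex.norm_exp]
    congr 1
    simp
  have e3 : ‖Φ (r * x)‖ ≤ C * Real.exp (-c * (r.re * x) ^ 2) := by
    refine (hb _ ?_).trans (mul_le_mul_of_nonneg_left (Real.exp_le_exp.2 ?_) hC.le)
    · rw [im_mul_ofReal, re_mul_ofReal, abs_mul, abs_mul, abs_of_pos hr]
      have : κ' * r.re ≤ κ * r.re := by gcongr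
      nlinarith [abs_nonneg x]
    · have : (r.re * x) ^ 2 ≤ ‖r * x‖ ^ 2 := by
        rw [← re_mul_ofReal, ← sq_abs]
        exact pow_le_pow_left₀ (abs_nonneg _) (abs_re_le_norm _) 2
      nlinarith
  rw [waveKer, norm_mul, norm_pow, norm_mul, norm_mul, e2]
  refine mul_le_mul_of_nonneg_left ?_ (by positivity)
  calc _ ≤ 1 * (C * Real.exp (-c * (r.re * x) ^ 2) * Real.exp ((r ^ 2).im * y)) := by gcongr
    _ = _ := one_mul _

lemma cpow_half_re_pos {μ : ℂ} (hμ : 0 < μ.re) : 0 < (μ ^ (1 / 2 : ℂ)).re := by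
  have hμ0 : μ ≠ 0 := fun h => by simp [h] at hμ
  have hr2 : (μ ^ (1 / 2 : ℂ)) ^ 2 = μ := by rw [← cpow_nat_mul]; norm_num
  have harg : |μ.arg| < Real.pi / 2 := by
    rw [abs_arg_lt_pi_div_two_iff]; exact Or.inl hμ
  have h1 : (μ ^ (1 / 2 : ℂ)).arg = μ.arg * (1 / 2) := by
    have hl : (Complex.log μ * (1 / 2)).im = μ.arg * (1 / 2) := by
      have : (Complex.log μ * (1 / 2)) = Complex.log μ * ((1 / 2 : ℝ) : ℂ) := by push_cast; rfl
      rw [this, im_mul_ofReal, log_im]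
    rw [cpow_def_of_ne_zero hμ0, arg_exp, hl, toIocMod_eq_self]
    obtain ⟨h2, h3⟩ := abs_lt.1 harg
    constructor <;> linarith
  have h2 : |(μ ^ (1 / 2 : ℂ)).arg| < Real.pi / 2 := by
    rw [h1, abs_mul, abs_of_pos (by norm_num : (0 : ℝ) < 1 / 2)]
    linarith [abs_nonneg μ.arg, Real.pi_pos]
  rcases abs_arg_lt_pi_div_two_iff.1 h2 with h3 | h3
  · exact h3
  · rw [h3] at hr2; simp at hr2; exact absurd hr2.symm hμ0

lemma norm_gaussWt {M : ℝ} (μ : ℂ) : ‖cexp (-(μ - M) ^ 2 / (2 * M))‖ =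
    Real.exp ((μ.im ^ 2 - (μ.re - M) ^ 2) / (2 * M)) := by
  rw [Complex.norm_exp]
  congr 1
  have : -(μ - M) ^ 2 / (2 * (M : ℂ)) = (-(μ - M) ^ 2) / ((2 * M : ℝ) : ℂ) := by push_cast; rfl
  rw [this, div_ofReal_re, sq, neg_re, mul_re]
  simp
  ring

lemma norm_contour_le {ζ : ℂ} {Φ : ℂ → ℂ} {κ c C κ' : ℝ} (hc : 0 < c) (hC : 0 < C)
    (hb : ∀ z : ℂ, |z.im| ≤ κ * |z.re| → ‖Φ z‖ ≤ C * Real.exp (-c * ‖z‖ ^ 2)) (hκ : κ' ≤ κ)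
    (hκ4 : κ' ≤ 1 / 4) (hζ : ζ.im + ‖ζ‖ * κ' ≤ 0) (p : ℕ) {t : ℝ} (ht : 0 ≤ t) (x : ℝ)
    {y M ε σ c₁ a b : ℝ} (hM : 1 ≤ M) (hσ : |σ| = 1) (hσy : σ * y = -|y|) (hy : ε ≤ |y|)
    (ha1 : M / 2 ≤ a) (ha2 : a ≤ 3 * M / 2) (hb0 : 0 ≤ b) (hb1 : b ≤ κ' * M)
    (hE : b ^ 2 - (a - M) ^ 2 - 2 * M * (b * ε) ≤ -(2 * M * (c₁ * M))) {μ : ℂ}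
    (hμ : μ = a + (b * σ : ℝ) * I) :
    ‖cexp (-(μ - M) ^ 2 / (2 * M)) * waveKer ζ Φ p t x y (μ ^ (1 / 2 : ℂ))‖ ≤
      (2 * M) ^ p * (C * Real.exp (-c₁ * M)) := by
  have hM0 : 0 < M := by linarith
  have hre : μ.re = a := by simp [hμ]
  have him : μ.im = b * σ := by simp [hμ]
  set r : ℂ := μ ^ (1 / 2 : ℂ) with hr
  have hr2 : r ^ 2 = μ := by
    rw [hr, ← cpow_nat_mul]; norm_num
  have hrre : 0 < r.re := cpow_half_re_pos (by rw [hre]; linarith)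
  have him' : |(r ^ 2).im| ≤ κ' * M := by
    rw [hr2, him, abs_mul, hσ, mul_one, abs_of_nonneg hb0]; exact hb1
  obtain ⟨-, h2⟩ := sqrt_sector hM0 hrre (by rw [hr2, hre]; exact ha1) him'
  have h3 := norm_waveKer_le hc hC hb hκ hζ p ht x y hrre h2
  have hrn : ‖r‖ ≤ 2 * M := by
    have h4 : ‖r‖ ^ 2 ≤ (2 * M) ^ 2 := by
      rw [← norm_pow, hr2]
      refine (norm_le_abs_re_add_abs_im μ).trans ?_
      rw [hre, ← hr2, abs_of_nonneg (by linarith)]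
      have h5 : κ' * M ≤ 1 / 4 * M := by gcongr
      nlinarith
    exact (pow_le_pow_iff_left₀ (norm_nonneg _) (by positivity) two_ne_zero).1 h4
  have h4 : (r ^ 2).im * y ≤ -(b * ε) := by
    rw [hr2, him, mul_assoc, hσy]
    have := mul_le_mul_of_nonneg_left hy hb0
    linarith
  rw [norm_mul, norm_gaussWt, hre, him]
  have h5 : (b * σ) ^ 2 = b ^ 2 := by rw [mul_pow, ← sq_abs σ, hσ]; ring
  rw [h5]
  have h6 : Real.exp (-c * (r.re * x) ^ 2) ≤ 1 := by
    have := mul_nonneg hc.le (sq_nonneg (r.re * x))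
    rw [Real.exp_le_one_iff]; linarith
  have h7 := Real.exp_le_exp.2 h4
  calc Real.exp ((b ^ 2 - (a - M) ^ 2) / (2 * M)) * ‖waveKer ζ Φ p t x y r‖
      ≤ Real.exp ((b ^ 2 - (a - M) ^ 2) / (2 * M)) * ((2 * M) ^ p *
        (C * 1 * Real.exp (-(b * ε)))) := by
        refine mul_le_mul_of_nonneg_left (h3.trans ?_) (Real.exp_pos _).le
        gcongr
    _ = (2 * M) ^ p * (C * Real.exp ((b ^ 2 - (a - M) ^ 2) / (2 * M) + -(b * ε))) := by
        rw [Real.exp_add]; ring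
    _ ≤ _ := by
        refine mul_le_mul_of_nonneg_left (mul_le_mul_of_nonneg_left (Real.exp_le_exp.2 ?_) hC.le)
          (by positivity)
        rw [← le_sub_iff_add_le, div_le_iff₀ (by positivity)]
        linarith

lemma norm_line_le {ζ : ℂ} {Φ : ℂ → ℂ} {κ c C κ' : ℝ} (hc : 0 < c) (hC : 0 < C)
    (hb : ∀ z : ℂ, |z.im| ≤ κ * |z.re| → ‖Φ z‖ ≤ C * Real.exp (-c * ‖z‖ ^ 2)) (hκ'0 : 0 < κ')
    (hκ : κ' ≤ κ) (hζ : ζ.im + ‖ζ‖ * κ' ≤ 0) (p : ℕ) {t : ℝ} (ht : 0 ≤ t) {x y M ε c₁ μ : ℝ}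
    (hε : 0 < ε) (hM : 1 ≤ M) (hx : ε ≤ |x|) (hc₁ : c₁ ≤ c * ε ^ 2 / 2) (h1 : M / 2 < μ)
    (h2 : μ ≤ 3 * M / 2) :
    ‖cexp (-(μ - M) ^ 2 / (2 * M)) * waveKer ζ Φ p t x y (√μ : ℝ)‖ ≤
      (2 * M) ^ p * (C * Real.exp (-c₁ * M)) := by
  have hμ0 : 0 < μ := by linarith
  have hs : 0 < √μ := Real.sqrt_pos.2 hμ0
  have h5 := norm_waveKer_le hc hC hb hκ hζ p ht x y (r := (√μ : ℝ)) (by simpa using hs)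
    (by simp; positivity)
  have h6 : (((√μ : ℝ) : ℂ) ^ 2).im = 0 := by rw [← ofReal_pow, ofReal_im]
  rw [h6, zero_mul, Real.exp_zero, mul_one, ofReal_re, mul_pow, Real.sq_sqrt hμ0.le,
    norm_real, Real.norm_of_nonneg hs.le] at h5
  rw [norm_mul, norm_gaussWt, ofReal_im, ofReal_re]
  have h3 : Real.exp ((0 ^ 2 - (μ - M) ^ 2) / (2 * M)) ≤ 1 := by
    rw [Real.exp_le_one_iff]
    refine div_nonpos_of_nonpos_of_nonneg ?_ (by linarith)
    linarith [sq_nonneg (μ - M)]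
  have h4 : √μ ≤ 2 * M := by
    rw [Real.sqrt_le_left (by linarith)]; nlinarith
  have h5' : Real.exp (-c * (μ * x ^ 2)) ≤ Real.exp (-c₁ * M) := by
    refine Real.exp_le_exp.2 ?_
    have : ε ^ 2 ≤ x ^ 2 := by rw [← sq_abs x]; gcongr
    have h6 : M / 2 * ε ^ 2 ≤ μ * x ^ 2 := by
      refine mul_le_mul h1.le this (by positivity) hμ0.le
    have h7 : c * (M / 2 * ε ^ 2) ≤ c * (μ * x ^ 2) := by gcongr
    have h8 : c₁ * M ≤ c * ε ^ 2 / 2 * M := by gcongr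
    linarith
  refine (mul_le_mul h3 h5 (norm_nonneg _) zero_le_one).trans ?_
  rw [one_mul]
  gcongr

set_option maxHeartbeats 1000000 in
/-- Averages of wave packets away from the origin are exponentially small. -/
theorem exists_saddle_bound {ζ : ℂ} (hζ : ζ.im < 0) {Φ : ℂ → ℂ} (hΦ : Differentiable ℂ Φ)
    {κ c C : ℝ} (hκ : 0 < κ) (hc : 0 < c) (hC : 0 < C)
    (hb : ∀ z : ℂ, |z.im| ≤ κ * |z.re| → ‖Φ z‖ ≤ C * Real.exp (-c * ‖z‖ ^ 2)) (p : ℕ) {ε : ℝ}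
    (hε : 0 < ε) :
    ∃ A : ℝ, 0 < A ∧ ∃ c' : ℝ, 0 < c' ∧ ∀ M : ℝ, 1 ≤ M → ∀ t x y : ℝ, 0 ≤ t →
      (ε ≤ |x| ∨ ε ≤ |y|) →
      ‖∫ μ : ℝ in (M / 2)..(3 * M / 2), cexp (-(μ - M) ^ 2 / (2 * M)) *
        waveKer ζ Φ p t x y (√μ : ℝ)‖ ≤ A * Real.exp (-c' * M) := by
  have hζ0 : 0 < ‖ζ‖ := norm_pos_iff.2 fun h => by simp [h] at hζ
  obtain ⟨κ', hκ'0, hκ'κ, hκ'4, hκ'ε, hκ'ζ⟩ : ∃ κ' : ℝ, 0 < κ' ∧ κ' ≤ κ ∧ κ' ≤ 1 / 4 ∧ κ' ≤ ε ∧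
      ζ.im + ‖ζ‖ * κ' ≤ 0 := by
    refine ⟨min (min κ (1 / 4)) (min ε (-ζ.im / ‖ζ‖)), ?_, by simp, by simp, by simp, ?_⟩
    · have : 0 < -ζ.im / ‖ζ‖ := div_pos (by linarith) hζ0
      positivity
    · have : min (min κ (1 / 4)) (min ε (-ζ.im / ‖ζ‖)) ≤ -ζ.im / ‖ζ‖ := by simp
      rw [le_div_iff₀ hζ0] at this
      linarith
  set c₁ : ℝ := min (min (3 / 32) (κ' * ε / 2)) (c * ε ^ 2 / 2) with hc₁
  have hc₁0 : 0 < c₁ := by positivity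
  have hc₁a : c₁ ≤ 3 / 32 := by simp [hc₁]
  have hc₁b : c₁ ≤ κ' * ε / 2 := by simp [hc₁]
  have hc₁c : c₁ ≤ c * ε ^ 2 / 2 := by simp [hc₁]
  obtain ⟨A, hA, hAM⟩ := exists_pow_mul_exp_neg_le (p + 1) hc₁0
  refine ⟨2 * (2 ^ p * C) * A, by positivity, c₁ / 2, by positivity, fun M hM t x y ht hxy => ?_⟩
  have hM0 : 0 < M := by linarith
  suffices h : ‖∫ μ : ℝ in (M / 2)..(3 * M / 2), cexp (-(μ - M) ^ 2 / (2 * M)) *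
        waveKer ζ Φ p t x y (√μ : ℝ)‖ ≤ 2 * M * ((2 * M) ^ p * (C * Real.exp (-c₁ * M))) by
    refine h.trans ?_
    have h2 := mul_le_mul_of_nonneg_left (hAM M hM0.le) (by positivity : 0 ≤ 2 * (2 ^ p * C))
    rw [mul_pow]
    rw [pow_succ] at h2
    linarith
  have hlen : |3 * M / 2 - M / 2| = M := by rw [abs_of_pos] <;> linarith
  set E : ℝ := (2 * M) ^ p * (C * Real.exp (-c₁ * M)) with hE
  have hE0 : 0 < E := by positivity
  rcases hxy with hx | hy
  · refine (intervalIntegral.norm_integral_le_of_norm_le_const (C := E) fun μ hμ => ?_).trans ?_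
    · rw [Set.uIoc_of_le (by linarith)] at hμ
      exact norm_line_le hc hC hb hκ'0 hκ'κ hκ'ζ p ht hε hM hx hc₁c hμ.1 hμ.2
    · rw [hlen]
      have : 0 ≤ E * M := by positivity
      linarith
  · set f : ℂ → ℂ := fun μ => cexp (-(μ - M) ^ 2 / (2 * M)) *
      waveKer ζ Φ p t x y (μ ^ (1 / 2 : ℂ)) with hf
    obtain ⟨σ, hσ, hσy⟩ : ∃ σ : ℝ, |σ| = 1 ∧ σ * y = -|y| := by
      rcases le_total 0 y with h | h
      · exact ⟨-1, by simp, by rw [abs_of_nonneg h]; ring⟩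
      · exact ⟨1, by simp, by rw [abs_of_nonpos h]; ring⟩
    have hdiff : DifferentiableOn ℂ f {μ : ℂ | 0 < μ.re} := fun μ hμ => by
      have h1 : DifferentiableAt ℂ (fun μ : ℂ => μ ^ (1 / 2 : ℂ)) μ :=
        differentiableAt_id.cpow_const (Or.inl hμ)
      have h2 : Differentiable ℂ (waveKer ζ Φ p t x y) := by
        unfold waveKer; fun_prop
      refine (DifferentiableAt.mul ?_ (h2.differentiableAt.comp μ h1)).differentiableWithinAt
      fun_prop
    have hrect := integral_boundary_rect_eq_zero_of_differentiableOn f (M / 2 : ℝ)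
      ((3 * M / 2 : ℝ) + (κ' * M * σ : ℝ) * I) (hdiff.mono fun μ hμ => by
        have := hμ.1
        simp only [add_re, ofReal_re, re_ofReal_mul, I_re, mul_zero, add_zero] at this
        rw [Set.mem_preimage, Set.uIcc_of_le (by linarith)] at this
        exact lt_of_lt_of_le (by linarith) this.1)
    simp only [add_re, ofReal_re, re_ofReal_mul, I_re, mul_zero, add_zero, add_im, ofReal_im,
      im_ofReal_mul, I_im, mul_one, zero_add, ofReal_zero, zero_mul, smul_eq_mul] at hrect
    have hside : ∀ a : ℝ, (a = M / 2 ∨ a = 3 * M / 2) → ‖∫ τ : ℝ in (0 : ℝ)..(κ' * M * σ),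
        f (a + τ * I)‖ ≤ E * (κ' * M) := fun a ha => by
      refine (intervalIntegral.norm_integral_le_of_norm_le_const (C := E) fun τ hτ => ?_).trans ?_
      · obtain ⟨b, hb0, hb1, hbτ⟩ : ∃ b, 0 ≤ b ∧ b ≤ κ' * M ∧ τ = b * σ := by
          have hσ' : σ * σ = 1 := by rw [← abs_mul_abs_self, hσ, one_mul]
          refine ⟨τ * σ, ?_, ?_, by rw [mul_assoc, hσ', mul_one]⟩
          all_goals
            rcases (abs_eq one_pos.le).1 hσ with h | h <;> subst h
            · rw [Set.uIoc_of_le (by nlinarith)] at hτ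
              linarith [hτ.1, hτ.2]
            · rw [Set.uIoc_of_ge (by nlinarith)] at hτ
              linarith [hτ.1, hτ.2]
        refine norm_contour_le hc hC hb hκ'κ hκ'4 hκ'ζ p ht x hM hσ hσy hy (a := a) (b := b) ?_ ?_
          hb0 hb1 ?_ (by rw [hbτ])
        · rcases ha with rfl | rfl <;> linarith
        · rcases ha with rfl | rfl <;> linarith
        · have e1 : (a - M) ^ 2 = M ^ 2 / 4 := by rcases ha with rfl | rfl <;> ring
          have e2 : b ≤ M / 4 := hb1.trans (by
            have : κ' * M ≤ 1 / 4 * M := by gcongr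
            linarith)
          have e3 : b ^ 2 ≤ (M / 4) ^ 2 := pow_le_pow_left₀ hb0 e2 2
          have e4 : 0 ≤ 2 * M * (b * ε) := by positivity
          have e5 : c₁ * (M * M) ≤ 3 / 32 * (M * M) := by gcongr
          linarith
      · rw [sub_zero, abs_mul, hσ, mul_one, abs_of_pos (by positivity)]
    have htop : ‖∫ a : ℝ in (M / 2)..(3 * M / 2), f (a + (κ' * M * σ : ℝ) * I)‖ ≤ E * M := by
      refine (intervalIntegral.norm_integral_le_of_norm_le_const (C := E) fun a ha => ?_).trans ?_
      · rw [Set.uIoc_of_le (by linarith)] at ha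
        refine norm_contour_le hc hC hb hκ'κ hκ'4 hκ'ζ p ht x hM hσ hσy hy (a := a) (b := κ' * M)
          ha.1.le ha.2 (by positivity) le_rfl ?_ rfl
        have e1 : κ' * (κ' * M * M) ≤ ε * (κ' * M * M) := by gcongr
        have e2 : c₁ * (M * M) ≤ κ' * ε / 2 * (M * M) := by gcongr
        have e3 := sq_nonneg (a - M)
        linarith
      · rw [hlen]
    have hbot : (∫ μ : ℝ in (M / 2)..(3 * M / 2), cexp (-(μ - M) ^ 2 / (2 * M)) *
        waveKer ζ Φ p t x y (√μ : ℝ)) = ∫ a : ℝ in (M / 2)..(3 * M / 2), f a := by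
      refine intervalIntegral.integral_congr fun μ hμ => ?_
      rw [Set.uIcc_of_le (by linarith)] at hμ
      have : ((√μ : ℝ) : ℂ) = (μ : ℂ) ^ (1 / 2 : ℂ) := by
        rw [Real.sqrt_eq_rpow, ofReal_cpow (by linarith [hμ.1])]
        norm_num
      simp only [hf, this]
    have h1 := hside _ (Or.inl rfl)
    have h2 := hside _ (Or.inr rfl)
    have h3 : (∫ a : ℝ in (M / 2)..(3 * M / 2), f a) =
        (∫ a : ℝ in (M / 2)..(3 * M / 2), f (a + (κ' * M * σ : ℝ) * I))
        - I * (∫ τ : ℝ in (0 : ℝ)..(κ' * M * σ), f ((3 * M / 2 : ℝ) + τ * I))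
        + I * (∫ τ : ℝ in (0 : ℝ)..(κ' * M * σ), f ((M / 2 : ℝ) + τ * I)) := by
      linear_combination hrect
    rw [hbot, h3]
    refine (norm_add_le _ _).trans ((add_le_add_left (norm_sub_le _ _) _).trans ?_)
    rw [norm_mul, norm_mul, norm_I, one_mul, one_mul]
    have h4 : E * (κ' * M) ≤ E * (1 / 4 * M) := by gcongr
    have h5 : 0 ≤ E * M := by positivity
    linarith

end Saddle

section Far

lemma continuous_gaussWt (M : ℝ) : Continuous fun μ : ℝ => cexp (-((μ : ℂ) - M) ^ 2 / (2 * M)) := by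
  fun_prop

lemma norm_gaussWt_ofReal_le {M : ℝ} (hM : 0 ≤ M) (μ : ℝ) :
    ‖cexp (-((μ : ℂ) - M) ^ 2 / (2 * M))‖ ≤ 1 := by
  rw [norm_gaussWt, ofReal_im, ofReal_re, Real.exp_le_one_iff]
  refine div_nonpos_of_nonpos_of_nonneg ?_ (by linarith)
  linarith [sq_nonneg (μ - M)]

lemma norm_waveKer_real_le {ζ : ℂ} (hζ : ζ.im < 0) {Φ : ℂ → ℂ} {κ c C : ℝ} (hκ : 0 < κ) (hc : 0 < c)
    (hC : 0 < C) (hb : ∀ z : ℂ, |z.im| ≤ κ * |z.re| → ‖Φ z‖ ≤ C * Real.exp (-c * ‖z‖ ^ 2))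
    (p : ℕ) {t : ℝ} (ht : 0 ≤ t) (x y : ℝ) {ρ : ℝ} (hρ : 0 < ρ) :
    ‖waveKer ζ Φ p t x y ρ‖ ≤ ρ ^ p * C := by
  have h := norm_waveKer_le (κ' := 0) hc hC hb hκ.le (by simpa using hζ.le) p ht x y (r := (ρ : ℂ))
    (by simpa using hρ) (by simp)
  have h6 : ((ρ : ℂ) ^ 2).im = 0 := by rw [← ofReal_pow, ofReal_im]
  rw [h6, zero_mul, Real.exp_zero, mul_one, norm_real, Real.norm_of_nonneg hρ.le, ofReal_re] at h
  refine h.trans (mul_le_mul_of_nonneg_left ?_ (by positivity))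
  have : Real.exp (-c * (ρ * x) ^ 2) ≤ 1 := by
    rw [Real.exp_le_one_iff]; nlinarith [sq_nonneg (ρ * x)]
  nlinarith

variable {X : Type*} [MeasurableSpace X] {ν : Measure X} [IsFiniteMeasure ν]

lemma integrable_gaussWt_mul_wave {ζ : ℂ} (hζ : ζ.im < 0) {Φ : ℂ → ℂ} (hΦ : Continuous Φ)
    {κ c C : ℝ} (hκ : 0 < κ) (hc : 0 < c) (hC : 0 < C)
    (hb : ∀ z : ℂ, |z.im| ≤ κ * |z.re| → ‖Φ z‖ ≤ C * Real.exp (-c * ‖z‖ ^ 2)) (p : ℕ)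
    {t x y : X → ℝ} (ht : Measurable t) (hx : Measurable x) (hy : Measurable y)
    {F : X → ℂ} (hF : AEStronglyMeasurable F ν) {B : ℝ} (hFB : ∀ z, ‖F z‖ ≤ B)
    (ht0 : ∀ᵐ z ∂ν, 0 ≤ t z) {M : ℝ} (hM0 : 0 < M) :
    Integrable (fun q : ℝ × X => cexp (-((q.1 : ℂ) - M) ^ 2 / (2 * M)) *
      (F q.2 * waveKer ζ Φ p (t q.2) (x q.2) (y q.2) (√q.1 : ℝ)))
      ((volume.restrict (Set.Ioc (M / 2) (3 * M / 2))).prod ν) := by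
  have hker : Continuous fun q : (ℝ × ℝ) × (ℝ × ℝ) =>
      waveKer ζ Φ p q.1.1 q.1.2 q.2.1 ((√q.2.2 : ℝ) : ℂ) := by
    unfold waveKer; fun_prop
  refine Integrable.of_bound (C := 1 * (max B 0 * (√(3 * M / 2) ^ p * C))) ?_ ?_
  · refine AEStronglyMeasurable.mul
      ((continuous_gaussWt M).measurable.comp measurable_fst).aestronglyMeasurable
      (AEStronglyMeasurable.mul hF.comp_snd (Measurable.aestronglyMeasurable ?_))
    exact hker.measurable.comp (f := fun q : ℝ × X => ((t q.2, x q.2), (y q.2, q.1)))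
      (((ht.comp measurable_snd).prodMk (hx.comp measurable_snd)).prodMk
        ((hy.comp measurable_snd).prodMk measurable_fst))
  · filter_upwards [Measure.quasiMeasurePreserving_fst.ae (ae_restrict_mem measurableSet_Ioc),
      Measure.quasiMeasurePreserving_snd.ae ht0] with q hq1 hq2
    have hq0 : 0 < √q.1 := Real.sqrt_pos.2 (by linarith [hq1.1])
    rw [norm_mul, norm_mul]
    have h1 := norm_gaussWt_ofReal_le hM0.le q.1
    have h2 : ‖F q.2‖ ≤ max B 0 := (hFB _).trans (le_max_left _ _)
    have h3 := norm_waveKer_real_le hζ hκ hc hC hb p hq2 (x q.2) (y q.2) hq0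
    have h4 : √q.1 ^ p ≤ √(3 * M / 2) ^ p := by
      gcongr; exact hq1.2
    have h5 : √q.1 ^ p * C ≤ √(3 * M / 2) ^ p * C := by gcongr
    have h6 := h3.trans h5
    gcongr

lemma intervalIntegrable_gaussWt_mul_wave {ζ : ℂ} (hζ : ζ.im < 0) {Φ : ℂ → ℂ} (hΦ : Continuous Φ)
    {κ c C : ℝ} (hκ : 0 < κ) (hc : 0 < c) (hC : 0 < C)
    (hb : ∀ z : ℂ, |z.im| ≤ κ * |z.re| → ‖Φ z‖ ≤ C * Real.exp (-c * ‖z‖ ^ 2)) (p : ℕ)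
    {t x y : X → ℝ} (ht : Measurable t) (hx : Measurable x) (hy : Measurable y)
    {F : X → ℂ} (hF : AEStronglyMeasurable F ν) {B : ℝ} (hFB : ∀ z, ‖F z‖ ≤ B)
    (ht0 : ∀ᵐ z ∂ν, 0 ≤ t z) {M : ℝ} (hM0 : 0 < M) :
    IntervalIntegrable (fun μ : ℝ => cexp (-((μ : ℂ) - M) ^ 2 / (2 * M)) *
      ∫ z, F z * waveKer ζ Φ p (t z) (x z) (y z) (√μ : ℝ) ∂ν) volume (M / 2) (3 * M / 2) := by
  rw [intervalIntegrable_iff_integrableOn_Ioc_of_le (by linarith)]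
  simp only [← integral_const_mul]
  exact (integrable_gaussWt_mul_wave hζ hΦ hκ hc hC hb p ht hx hy hF hFB ht0 hM0).integral_prod_left

/-- Averaged superpositions of wave packets away from the origin are exponentially small. -/
theorem exists_far_bound {ζ : ℂ} (hζ : ζ.im < 0) {Φ : ℂ → ℂ} (hΦ : Differentiable ℂ Φ)
    {κ c C : ℝ} (hκ : 0 < κ) (hc : 0 < c) (hC : 0 < C)
    (hb : ∀ z : ℂ, |z.im| ≤ κ * |z.re| → ‖Φ z‖ ≤ C * Real.exp (-c * ‖z‖ ^ 2)) (p : ℕ) {ε : ℝ}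
    (hε : 0 < ε) {t x y : X → ℝ} (ht : Measurable t) (hx : Measurable x) (hy : Measurable y)
    {F : X → ℂ} (hF : AEStronglyMeasurable F ν) {B : ℝ} (hFB : ∀ z, ‖F z‖ ≤ B)
    (hF0 : ∀ᵐ z ∂ν, 0 ≤ t z ∧ (F z = 0 ∨ ε ≤ |x z| ∨ ε ≤ |y z|)) :
    ∃ A : ℝ, 0 ≤ A ∧ ∃ c' : ℝ, 0 < c' ∧ ∀ M : ℝ, 1 ≤ M →
      ‖∫ μ : ℝ in (M / 2)..(3 * M / 2), cexp (-(μ - M) ^ 2 / (2 * M)) *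
        ∫ z, F z * waveKer ζ Φ p (t z) (x z) (y z) (√μ : ℝ) ∂ν‖ ≤ A * Real.exp (-c' * M) := by
  obtain ⟨A, hA, c', hc', hAc⟩ := exists_saddle_bound hζ hΦ hκ hc hC hb p hε
  refine ⟨max B 0 * A * ν.real Set.univ, by positivity, c', hc', fun M hM => ?_⟩
  have hM0 : 0 < M := by linarith
  have hle : M / 2 ≤ 3 * M / 2 := by linarith
  have hfi := integrable_gaussWt_mul_wave hζ hΦ.continuous hκ hc hC hb p ht hx hy hF hFB
    (hF0.mono fun z hz => hz.1) hM0
  simp only [← integral_const_mul]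
  rw [intervalIntegral.integral_of_le hle, integral_integral_swap hfi]
  refine (norm_integral_le_of_norm_le_const (C := max B 0 * (A * Real.exp (-c' * M))) ?_).trans
    (by linarith)
  filter_upwards [hF0] with z hz
  simp only [mul_left_comm _ (F z)]
  rw [integral_const_mul, norm_mul]
  rcases hz.2 with h0 | hxy
  · rw [h0, norm_zero, zero_mul]; positivity
  · have := hAc M hM (t z) (x z) (y z) hz.1 hxy
    rw [intervalIntegral.integral_of_le hle] at this
    have h2 : ‖F z‖ ≤ max B 0 := (hFB _).trans (le_max_left _ _)
    gcongr

end Far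

section GaussianMain

lemma integrable_of_gaussian_bound {f : ℝ → ℂ} {C b a : ℝ} (hb : 0 < b)
    (hfm : AEStronglyMeasurable f volume) (hf : ∀ y, ‖f y‖ ≤ C * Real.exp (-b * (y - a) ^ 2)) :
    Integrable f :=
  (((integrable_exp_neg_mul_sq hb).comp_sub_right a).const_mul C).mono' hfm
    (Filter.Eventually.of_forall hf)

lemma norm_integral_sub_setIntegral_le {f : ℝ → ℂ} {C b a δ : ℝ} (hC : 0 ≤ C) (hb : 0 < b)
    (hδ : 0 ≤ δ) (hfm : AEStronglyMeasurable f volume)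
    (hf : ∀ y, ‖f y‖ ≤ C * Real.exp (-b * (y - a) ^ 2)) :
    ‖(∫ y, f y) - ∫ y in Set.Ioc (a - δ) (a + δ), f y‖ ≤
      C * Real.exp (-(b * δ ^ 2 / 2)) * √(Real.pi / (b / 2)) := by
  have hfi := integrable_of_gaussian_bound hb hfm hf
  rw [← integral_add_compl (measurableSet_Ioc (a := a - δ) (b := a + δ)) hfi, add_sub_cancel_left]
  have hgi : Integrable fun y : ℝ => C * Real.exp (-(b * δ ^ 2 / 2)) *
      Real.exp (-(b / 2) * (y - a) ^ 2) :=
    ((integrable_exp_neg_mul_sq (half_pos hb)).comp_sub_right a).const_mul _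
  calc _ ≤ ∫ y in (Set.Ioc (a - δ) (a + δ))ᶜ, C * Real.exp (-(b * δ ^ 2 / 2)) *
      Real.exp (-(b / 2) * (y - a) ^ 2) := by
        refine norm_integral_le_of_norm_le hgi.integrableOn ?_
        refine (ae_restrict_iff' measurableSet_Ioc.compl).2 (Filter.Eventually.of_forall ?_)
        intro y hy
        refine (hf y).trans ?_
        rw [mul_assoc, ← Real.exp_add]
        refine mul_le_mul_of_nonneg_left (Real.exp_le_exp.2 ?_) hC
        have h1 : δ ^ 2 ≤ (y - a) ^ 2 := by
          rw [← sq_abs (y - a)]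
          refine pow_le_pow_left₀ hδ ?_ 2
          by_contra h
          rw [not_le, abs_lt] at h
          exact hy ⟨by linarith [h.1], by linarith [h.2]⟩
        nlinarith
    _ ≤ ∫ y, C * Real.exp (-(b * δ ^ 2 / 2)) * Real.exp (-(b / 2) * (y - a) ^ 2) :=
        setIntegral_le_integral hgi (Filter.Eventually.of_forall fun y => by positivity)
    _ = _ := by
        rw [integral_const_mul, integral_sub_right_eq_self (fun y => Real.exp (-(b / 2) * y ^ 2)),
          integral_gaussian]

lemma ofReal_cpow_half {a : ℝ} (ha : 0 ≤ a) : (a : ℂ) ^ (1 / 2 : ℂ) = (√a : ℝ) := by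
  rw [Real.sqrt_eq_rpow, ofReal_cpow ha]; norm_num

lemma integral_gaussWt_mul_cexp {M : ℝ} (hM : 0 < M) (y : ℝ) :
    ∫ μ : ℝ, cexp (-((μ : ℂ) - M) ^ 2 / (2 * M)) * cexp (-I * μ * y) =
      (√(2 * Real.pi * M) : ℝ) * cexp (-I * M * y - M * y ^ 2 / 2) := by
  have hM' : (M : ℂ) ≠ 0 := by exact_mod_cast hM.ne'
  have h := integral_cexp_quadratic (b := ((-(1 / (2 * M)) : ℝ) : ℂ))
    (by rw [ofReal_re]; exact neg_neg_of_pos (by positivity)) (1 - I * y) (-(M / 2 : ℂ))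
  have e1 : (Real.pi : ℂ) / -((-(1 / (2 * M)) : ℝ) : ℂ) = ((2 * Real.pi * M : ℝ) : ℂ) := by
    push_cast; field_simp
  rw [e1, ofReal_cpow_half (by positivity)] at h
  have e2 : -(M / 2 : ℂ) - (1 - I * y) ^ 2 / (4 * ((-(1 / (2 * M)) : ℝ) : ℂ)) =
      -I * M * y - M * y ^ 2 / 2 := by
    push_cast
    field_simp
    linear_combination 4 * (y : ℂ) ^ 2 * I_sq
  rw [e2] at h
  rw [← h]
  congr 1
  funext μ
  rw [← Complex.exp_add]
  congr 1
  push_cast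
  field_simp
  ring

lemma integral_cexp_mul_gauss {M : ℝ} (hM : 0 < M) (j : ℕ) :
    ∫ y : ℝ, cexp (I * j * y) * cexp (-I * M * y - M * y ^ 2 / 2) =
      (√(2 * Real.pi / M) : ℝ) * (Real.exp (-((j : ℝ) - M) ^ 2 / (2 * M)) : ℂ) := by
  have hM' : (M : ℂ) ≠ 0 := by exact_mod_cast hM.ne'
  have h := integral_cexp_quadratic (b := ((-(M / 2) : ℝ) : ℂ))
    (by rw [ofReal_re]; exact neg_neg_of_pos (by positivity)) (I * (j - M)) 0
  have e1 : (Real.pi : ℂ) / -((-(M / 2) : ℝ) : ℂ) = ((2 * Real.pi / M : ℝ) : ℂ) := by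
    push_cast; field_simp
  rw [e1, ofReal_cpow_half (by positivity)] at h
  have e2 : 0 - (I * ((j : ℂ) - M)) ^ 2 / (4 * ((-(M / 2) : ℝ) : ℂ)) =
      ((-((j : ℝ) - M) ^ 2 / (2 * M) : ℝ) : ℂ) := by
    rw [mul_pow, I_sq]
    push_cast
    field_simp
    ring
  rw [e2, ← ofReal_exp] at h
  rw [← h]
  congr 1
  funext y
  rw [← Complex.exp_add]
  congr 1
  push_cast
  ring

lemma norm_gauss_phase {M : ℝ} (y : ℝ) :
    ‖cexp (-I * M * y - M * y ^ 2 / 2)‖ = Real.exp (-(M / 2) * (y - 0) ^ 2) := by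
  have : -I * M * y - M * y ^ 2 / 2 =
      ((-(M / 2) * (y - 0) ^ 2 : ℝ) : ℂ) + ((-M * y : ℝ) : ℂ) * I := by
    push_cast; ring
  rw [this, Complex.exp_add, norm_mul, norm_exp_ofReal_mul_I, mul_one, Complex.norm_exp, ofReal_re]

/-- The Gaussian average of the Fourier coefficients of the Gevrey series. -/
noncomputable def gevGaussSum (s M : ℝ) : ℝ :=
  2 * Real.pi * ∑' j : ℕ, Real.exp (-((j : ℝ) ^ (1 / s))) * Real.exp (-((j : ℝ) - M) ^ 2 / (2 * M))

lemma summable_gevGaussSum {s M : ℝ} (hs : 0 < s) (hM : 0 < M) : Summable fun j : ℕ =>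
    Real.exp (-((j : ℝ) ^ (1 / s))) * Real.exp (-((j : ℝ) - M) ^ 2 / (2 * M)) := by
  have h := summable_gevBound hs 0
  simp only [pow_zero, one_mul] at h
  refine Summable.of_nonneg_of_le (fun j => by positivity) (fun j => ?_) h
  refine mul_le_of_le_one_right (Real.exp_pos _).le ?_
  rw [Real.exp_le_one_iff]
  exact div_nonpos_of_nonpos_of_nonneg (by linarith [sq_nonneg ((j : ℝ) - M)]) (by linarith)

lemma le_gevGaussSum {s : ℝ} (hs : 0 < s) {M : ℕ} (hM : 0 < M) :
    Real.exp (-((M : ℝ) ^ (1 / s))) ≤ gevGaussSum s M := by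
  have h := (summable_gevGaussSum hs (M := M) (by exact_mod_cast hM)).le_tsum M
    (fun j _ => by positivity)
  rw [sub_self, zero_pow (two_ne_zero (α := ℕ)), neg_zero, zero_div, Real.exp_zero, mul_one] at h
  rw [gevGaussSum]
  nlinarith [Real.pi_gt_three, Real.exp_pos (-((M : ℝ) ^ (1 / s)))]

lemma integral_gevSeries_mul_gauss {s M : ℝ} (hs : 0 < s) (hM : 0 < M) :
    (√(2 * Real.pi * M) : ℝ) * ∫ y : ℝ, gevSeries s 0 y * cexp (-I * M * y - M * y ^ 2 / 2) =
      (gevGaussSum s M : ℂ) := by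
  have hgi : Integrable fun y : ℝ => cexp (-I * M * y - M * y ^ 2 / 2) :=
    integrable_of_gaussian_bound (C := 1) (b := M / 2) (a := 0) (by positivity)
      (by fun_prop : Continuous _).aestronglyMeasurable fun y => by rw [norm_gauss_phase, one_mul]
  have hnorm : ∀ (j : ℕ) (y : ℝ), ‖(Real.exp (-((j : ℝ) ^ (1 / s))) : ℂ) * (cexp (I * j * y) *
      cexp (-I * M * y - M * y ^ 2 / 2))‖ =
      Real.exp (-((j : ℝ) ^ (1 / s))) * ‖cexp (-I * M * y - M * y ^ 2 / 2)‖ := fun j y => by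
    have h := norm_gevSeries_term s 0 j y
    simp only [pow_zero, one_mul] at h
    rw [← mul_assoc, norm_mul, h]
  have hFi : ∀ j : ℕ, Integrable fun y : ℝ => (Real.exp (-((j : ℝ) ^ (1 / s))) : ℂ) *
      (cexp (I * j * y) * cexp (-I * M * y - M * y ^ 2 / 2)) := fun j => by
    refine (hgi.norm.const_mul (Real.exp (-((j : ℝ) ^ (1 / s))))).mono'
      (by fun_prop : Continuous _).aestronglyMeasurable (Filter.Eventually.of_forall fun y => ?_)
    exact (hnorm j y).le
  have h := hasSum_integral_of_summable_integral_norm hFi (by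
    simp only [hnorm, integral_const_mul]
    exact Summable.mul_right _ (by simpa using summable_gevBound hs 0))
  have e1 : ∀ y : ℝ, ∑' j : ℕ, (Real.exp (-((j : ℝ) ^ (1 / s))) : ℂ) * (cexp (I * j * y) *
      cexp (-I * M * y - M * y ^ 2 / 2)) = gevSeries s 0 y * cexp (-I * M * y - M * y ^ 2 / 2) :=
    fun y => by
      simp only [← mul_assoc, tsum_mul_right, gevSeries, pow_zero, one_mul]
  simp only [e1, integral_const_mul, integral_cexp_mul_gauss hM] at h
  rw [← h.tsum_eq, gevGaussSum, ofReal_mul, ofReal_tsum, ← tsum_mul_left, ← tsum_mul_left]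
  congr 1
  funext j
  have e2 : √(2 * Real.pi * M) * √(2 * Real.pi / M) = 2 * Real.pi := by
    rw [← Real.sqrt_mul (by positivity)]
    have : 2 * Real.pi * M * (2 * Real.pi / M) = (2 * Real.pi) ^ 2 := by field_simp
    rw [this, Real.sqrt_sq (by positivity)]
  have e3 : ((2 * Real.pi : ℝ) : ℂ) = (√(2 * Real.pi * M) : ℝ) * (√(2 * Real.pi / M) : ℝ) := by
    rw [← ofReal_mul, e2]
  rw [e3, ofReal_mul]
  ring

end GaussianMain

section ExpSmall

/-- Bounded by a decaying exponential on `[1, ∞)`. -/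
def ExpSmall (E : ℝ → ℝ) : Prop :=
  ∃ A : ℝ, 0 ≤ A ∧ ∃ c : ℝ, 0 < c ∧ ∀ M : ℝ, 1 ≤ M → E M ≤ A * Real.exp (-c * M)

lemma ExpSmall.mono {E F : ℝ → ℝ} (hF : ExpSmall F) (h : ∀ M, 1 ≤ M → E M ≤ F M) : ExpSmall E := by
  obtain ⟨A, hA, c, hc, hAc⟩ := hF
  exact ⟨A, hA, c, hc, fun M hM => (h M hM).trans (hAc M hM)⟩

lemma ExpSmall.add {E F : ℝ → ℝ} (hE : ExpSmall E) (hF : ExpSmall F) :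
    ExpSmall fun M => E M + F M := by
  obtain ⟨A, hA, c, hc, hAc⟩ := hE
  obtain ⟨B, hB, d, hd, hBd⟩ := hF
  refine ⟨A + B, by positivity, min c d, lt_min hc hd, fun M hM => ?_⟩
  have h1 : Real.exp (-c * M) ≤ Real.exp (-(min c d) * M) := Real.exp_le_exp.2 <| by
    linarith [mul_le_mul_of_nonneg_right (min_le_left c d) (by linarith : 0 ≤ M)]
  have h2 : Real.exp (-d * M) ≤ Real.exp (-(min c d) * M) := Real.exp_le_exp.2 <| by
    linarith [mul_le_mul_of_nonneg_right (min_le_right c d) (by linarith : 0 ≤ M)]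
  rw [add_mul]
  exact add_le_add ((hAc M hM).trans (mul_le_mul_of_nonneg_left h1 hA))
    ((hBd M hM).trans (mul_le_mul_of_nonneg_left h2 hB))

lemma ExpSmall.const_mul {E : ℝ → ℝ} (hE : ExpSmall E) {B : ℝ} (hB : 0 ≤ B) :
    ExpSmall fun M => B * E M := by
  obtain ⟨A, hA, c, hc, hAc⟩ := hE
  refine ⟨B * A, by positivity, c, hc, fun M hM => ?_⟩
  rw [mul_assoc]
  exact mul_le_mul_of_nonneg_left (hAc M hM) hB

lemma expSmall_mul_exp {c : ℝ} (hc : 0 < c) : ExpSmall fun M => M * Real.exp (-c * M) := by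
  obtain ⟨A, hA, h⟩ := exists_pow_mul_exp_neg_le 1 hc
  exact ⟨A, hA.le, c / 2, half_pos hc, fun M hM => by simpa using h M (by linarith)⟩

end ExpSmall

section MainTerm

variable {Φ : ℂ → ℂ} {c C : ℝ}

lemma norm_pow_mul_le (k : ℕ) (hc : 0 < c) (hC : 0 ≤ C)
    (hb : ∀ x : ℝ, ‖Φ x‖ ≤ C * Real.exp (-c * x ^ 2)) :
    ∃ A : ℝ, 0 ≤ A ∧ ∀ x : ℝ, ‖(x : ℂ) ^ k * Φ x‖ ≤ A * Real.exp (-(c / 2) * (x - 0) ^ 2) := by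
  obtain ⟨A, hA, h⟩ := exists_pow_mul_exp_neg_le k hc
  refine ⟨(1 + A) * C, by positivity, fun x => ?_⟩
  have h1 := h (x ^ 2) (sq_nonneg x)
  have h2 : |x| ^ k ≤ 1 + (x ^ 2) ^ k := by
    rcases le_total |x| 1 with hx | hx
    · have h3 := pow_le_one₀ (n := k) (abs_nonneg x) hx
      have h4 : (0 : ℝ) ≤ (x ^ 2) ^ k := by positivity
      linarith
    · have : |x| ≤ x ^ 2 := by rw [← sq_abs]; nlinarith
      linarith [pow_le_pow_left₀ (abs_nonneg x) this k]
  have h3 : Real.exp (-c * x ^ 2) ≤ Real.exp (-(c / 2) * x ^ 2) :=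
    Real.exp_le_exp.2 (by nlinarith [mul_nonneg hc.le (sq_nonneg x)])
  rw [norm_mul, norm_pow, norm_real, Real.norm_eq_abs, sub_zero]
  calc |x| ^ k * ‖Φ x‖ ≤ (1 + (x ^ 2) ^ k) * (C * Real.exp (-c * x ^ 2)) :=
        mul_le_mul h2 (hb x) (norm_nonneg _) (by positivity)
    _ = C * (Real.exp (-c * x ^ 2) + (x ^ 2) ^ k * Real.exp (-c * x ^ 2)) := by ring
    _ ≤ C * (Real.exp (-(c / 2) * x ^ 2) + A * Real.exp (-(c / 2) * x ^ 2)) :=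
        mul_le_mul_of_nonneg_left (add_le_add h3 h1) hC
    _ = _ := by ring

lemma exists_moment_bound (hΦ : Continuous Φ) (hc : 0 < c) (hC : 0 ≤ C)
    (hb : ∀ x : ℝ, ‖Φ x‖ ≤ C * Real.exp (-c * x ^ 2)) (k : ℕ) {ε : ℝ} (hε : 0 < ε) :
    ∃ A : ℝ, 0 ≤ A ∧ ∃ c' : ℝ, 0 < c' ∧ ∀ M : ℝ, ∀ μ : ℝ, 0 ≤ M → M / 2 ≤ μ →
      ‖((√μ : ℝ) : ℂ) ^ (k + 1) * (∫ x in (-ε)..ε, (x : ℂ) ^ k * Φ ((√μ : ℝ) * x)) -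
        ∫ x : ℝ, (x : ℂ) ^ k * Φ x‖ ≤ A * Real.exp (-c' * M) := by
  obtain ⟨A, hA, h⟩ := norm_pow_mul_le k hc hC hb
  refine ⟨A * √(Real.pi / (c / 2 / 2)), by positivity, c * ε ^ 2 / 8, by positivity,
    fun M μ hM hμ => ?_⟩
  have hμ0 : 0 ≤ μ := by linarith
  have hle : 0 ≤ √μ * ε := by positivity
  have h1 := norm_integral_sub_setIntegral_le hA (half_pos hc) hle
    (by fun_prop : Continuous fun x : ℝ => (x : ℂ) ^ k * Φ x).aestronglyMeasurable h
  have h2 : ((√μ : ℝ) : ℂ) ^ (k + 1) * (∫ x in (-ε)..ε, (x : ℂ) ^ k * Φ ((√μ : ℝ) * x)) =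
      ∫ x in Set.Ioc (0 - √μ * ε) (0 + √μ * ε), (x : ℂ) ^ k * Φ x := by
    rw [zero_sub, zero_add, ← intervalIntegral.integral_of_le (by linarith), ← mul_neg,
      ← intervalIntegral.smul_integral_comp_mul_left (fun x : ℝ => (x : ℂ) ^ k * Φ x), pow_succ',
      mul_assoc, ← intervalIntegral.integral_const_mul, real_smul]
    congr 1
    refine intervalIntegral.integral_congr fun x _ => ?_
    simp only [ofReal_mul, mul_pow, mul_assoc]
  rw [h2, norm_sub_rev]
  refine h1.trans ?_
  rw [mul_assoc, mul_assoc, mul_comm (Real.exp _)]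
  refine mul_le_mul_of_nonneg_left (mul_le_mul_of_nonneg_left (Real.exp_le_exp.2 ?_)
    (by positivity)) hA
  rw [mul_pow, Real.sq_sqrt hμ0]
  have : c * ε ^ 2 * (M / 2) ≤ c * ε ^ 2 * μ := mul_le_mul_of_nonneg_left hμ (by positivity)
  linarith

lemma norm_integral_gaussWt_sub_le {M : ℝ} (hM : 1 ≤ M) (y : ℝ) :
    ‖(√(2 * Real.pi * M) : ℝ) * cexp (-I * M * y - M * y ^ 2 / 2) -
      ∫ μ : ℝ in (M / 2)..(3 * M / 2), cexp (-((μ : ℂ) - M) ^ 2 / (2 * M)) * cexp (-I * μ * y)‖ ≤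
      4 * Real.pi * (M * Real.exp (-(1 / 16) * M)) := by
  have hM0 : 0 < M := by linarith
  have h := norm_integral_sub_setIntegral_le
    (f := fun μ : ℝ => cexp (-((μ : ℂ) - M) ^ 2 / (2 * M)) * cexp (-I * μ * y))
    (C := 1) (b := 1 / (2 * M)) (a := M) (δ := M / 2) zero_le_one (by positivity) (by positivity)
    (by fun_prop : Continuous _).aestronglyMeasurable (fun μ => by
      have e : -I * μ * y = ((-(μ * y) : ℝ) : ℂ) * I := by push_cast; ring
      rw [norm_mul, norm_gaussWt, e, norm_exp_ofReal_mul_I, mul_one, one_mul, ofReal_im, ofReal_re]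
      refine Real.exp_le_exp.2 (le_of_eq ?_)
      field_simp
      ring)
  rw [integral_gaussWt_mul_cexp hM0, ← intervalIntegral.integral_of_le (by linarith),
    (by ring : M - M / 2 = M / 2), (by ring : M + M / 2 = 3 * M / 2)] at h
  refine h.trans ?_
  have e1 : -(1 / (2 * M) * (M / 2) ^ 2 / 2) = -(1 / 16) * M := by field_simp; norm_num
  have e2 : √(Real.pi / (1 / (2 * M) / 2)) ≤ 4 * Real.pi * M := by
    have e3 : Real.pi / (1 / (2 * M) / 2) = 4 * Real.pi * M := by field_simp; norm_num
    rw [e3, Real.sqrt_le_left (by positivity)]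
    have h3 : 1 ≤ 4 * Real.pi * M := by nlinarith [Real.pi_gt_three]
    nlinarith
  rw [e1, one_mul, mul_comm, ← mul_assoc]
  exact mul_le_mul_of_nonneg_right e2 (Real.exp_pos _).le

lemma norm_gevGaussSum_sub_le {s M ε : ℝ} (hs : 0 < s) (hM : 1 ≤ M) (hε : 0 < ε) {S : ℝ}
    (hS : ∀ y, ‖gevSeries s 0 y‖ ≤ S) :
    ‖(gevGaussSum s M : ℂ) - ∫ y : ℝ in (-ε)..ε, gevSeries s 0 y *
      ((√(2 * Real.pi * M) : ℝ) * cexp (-I * M * y - M * y ^ 2 / 2))‖ ≤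
      S * (4 * Real.pi) * (M * Real.exp (-(ε ^ 2 / 4) * M)) := by
  have hM0 : 0 < M := by linarith
  have hS0 : 0 ≤ S := (norm_nonneg _).trans (hS 0)
  have hcont := (contDiff_gevSeries hs 0).continuous
  have h := norm_integral_sub_setIntegral_le
    (f := fun y : ℝ => gevSeries s 0 y * cexp (-I * M * y - M * y ^ 2 / 2))
    (C := S) (b := M / 2) (a := 0) (δ := ε) hS0 (by positivity) hε.le
    (by fun_prop : Continuous _).aestronglyMeasurable (fun y => by
      rw [norm_mul, norm_gauss_phase]
      exact mul_le_mul_of_nonneg_right (hS y) (Real.exp_pos _).le)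
  rw [zero_sub, zero_add, ← intervalIntegral.integral_of_le (by linarith)] at h
  have e : ∀ y : ℝ, gevSeries s 0 y *
      ((√(2 * Real.pi * M) : ℝ) * cexp (-I * M * y - M * y ^ 2 / 2)) =
      (√(2 * Real.pi * M) : ℝ) * (gevSeries s 0 y * cexp (-I * M * y - M * y ^ 2 / 2)) :=
    fun y => by ring
  simp only [e]
  rw [intervalIntegral.integral_const_mul, ← integral_gevSeries_mul_gauss hs hM0, ← mul_sub,
    norm_mul, norm_real, Real.norm_of_nonneg (Real.sqrt_nonneg _)]
  refine (mul_le_mul_of_nonneg_left h (Real.sqrt_nonneg _)).trans ?_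
  have e1 : √(2 * Real.pi * M) * √(Real.pi / (M / 2 / 2)) ≤ 4 * Real.pi := by
    rw [← Real.sqrt_mul (by positivity), Real.sqrt_le_left (by positivity)]
    have : 2 * Real.pi * M * (Real.pi / (M / 2 / 2)) = 8 * Real.pi ^ 2 := by field_simp; norm_num
    rw [this]
    nlinarith [sq_nonneg Real.pi]
  have e2 : -(M / 2 * ε ^ 2 / 2) = -(ε ^ 2 / 4) * M := by ring
  rw [e2]
  have hx := Real.exp_pos (-(ε ^ 2 / 4) * M)
  calc _ = S * (√(2 * Real.pi * M) * √(Real.pi / (M / 2 / 2))) *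
        (1 * Real.exp (-(ε ^ 2 / 4) * M)) := by ring
    _ ≤ S * (4 * Real.pi) * (M * Real.exp (-(ε ^ 2 / 4) * M)) :=
        mul_le_mul (mul_le_mul_of_nonneg_left e1 hS0) (mul_le_mul_of_nonneg_right hM hx.le)
          (by positivity) (by positivity)

lemma integral_box_eq (ζ : ℂ) (θ : ℝ → ℂ) (k : ℕ) {ε μ : ℝ} (hε : 0 < ε) (hμ : 0 ≤ μ) :
    ∫ z : ℝ × ℝ, ((z.1 : ℂ) ^ k * θ z.2) * waveKer ζ Φ (k + 1) 0 z.1 z.2 (√μ : ℝ)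
      ∂(volume.restrict (Set.Ioc (-ε) ε ×ˢ Set.Ioc (-ε) ε)) =
      (((√μ : ℝ) : ℂ) ^ (k + 1) * ∫ x in (-ε)..ε, (x : ℂ) ^ k * Φ ((√μ : ℝ) * x)) *
        ∫ y in (-ε)..ε, θ y * cexp (-I * μ * y) := by
  have hle : -ε ≤ ε := by linarith
  have e : ((√μ : ℝ) : ℂ) ^ 2 = μ := by rw [← ofReal_pow, Real.sq_sqrt hμ]
  rw [intervalIntegral.integral_of_le hle, intervalIntegral.integral_of_le hle, mul_assoc,
    ← setIntegral_prod_mul, ← Measure.volume_eq_prod, ← integral_const_mul]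
  congr 1
  funext z
  rw [waveKer, e, ofReal_zero, mul_zero, Complex.exp_zero]
  ring

/-- The Gaussian average over frequencies of the pairing of a wave packet with the Gevrey data. -/
theorem expSmall_main_term (ζ : ℂ) (hΦ : Continuous Φ) (hc : 0 < c) (hC : 0 ≤ C)
    (hb : ∀ x : ℝ, ‖Φ x‖ ≤ C * Real.exp (-c * x ^ 2)) (k : ℕ) {s ε : ℝ} (hs : 0 < s)
    (hε : 0 < ε) :
    ExpSmall fun M => ‖(∫ μ : ℝ in (M / 2)..(3 * M / 2), cexp (-(μ - M) ^ 2 / (2 * M)) *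
      ∫ z : ℝ × ℝ, ((z.1 : ℂ) ^ k * gevSeries s 0 z.2) *
        waveKer ζ Φ (k + 1) 0 z.1 z.2 (√μ : ℝ)
        ∂(volume.restrict (Set.Ioc (-ε) ε ×ˢ Set.Ioc (-ε) ε))) -
      (∫ x : ℝ, (x : ℂ) ^ k * Φ x) * gevGaussSum s M‖ := by
  obtain ⟨S, hS⟩ : ∃ S, ∀ y, ‖gevSeries s 0 y‖ ≤ S := ⟨_, norm_gevSeries_le hs 0⟩
  have hS0 : 0 ≤ S := (norm_nonneg _).trans (hS 0)
  have hθ := (contDiff_gevSeries hs 0).continuous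
  obtain ⟨A, hA, c', hc', hX⟩ := exists_moment_bound hΦ hc hC hb k hε
  set m := ∫ x : ℝ, (x : ℂ) ^ k * Φ x with hm
  set X : ℝ → ℂ := fun μ =>
    ((√μ : ℝ) : ℂ) ^ (k + 1) * ∫ x in (-ε)..ε, (x : ℂ) ^ k * Φ ((√μ : ℝ) * x) with hXdef
  set Y : ℝ → ℂ := fun μ => ∫ y in (-ε)..ε, gevSeries s 0 y * cexp (-I * μ * y) with hYdef
  have hXc : Continuous X := by
    have h1 := intervalIntegral.continuous_parametric_intervalIntegral_of_continuous'
      (μ := volume) (f := fun (μ : ℝ) (x : ℝ) => (x : ℂ) ^ k * Φ ((√μ : ℝ) * x))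
      (by unfold Function.uncurry; fun_prop) (-ε) ε
    rw [hXdef]
    fun_prop
  have hYc : Continuous Y :=
    intervalIntegral.continuous_parametric_intervalIntegral_of_continuous'
      (μ := volume) (f := fun (μ : ℝ) (y : ℝ) => gevSeries s 0 y * cexp (-I * μ * y))
      (by unfold Function.uncurry; fun_prop) (-ε) ε
  have hYb : ∀ μ, ‖Y μ‖ ≤ S * (2 * ε) := fun μ => by
    refine (intervalIntegral.norm_integral_le_of_norm_le_const (C := S) fun y _ => ?_).trans_eq
      (by rw [sub_neg_eq_add, abs_of_pos (by linarith : 0 < ε + ε)]; ring)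
    have e : -I * μ * y = ((-(μ * y) : ℝ) : ℂ) * I := by push_cast; ring
    rw [norm_mul, e, norm_exp_ofReal_mul_I, mul_one]
    exact hS y
  refine ((((expSmall_mul_exp hc').const_mul (mul_nonneg hA (by positivity : 0 ≤ S * (2 * ε)))).add
    ((expSmall_mul_exp (by norm_num : (0 : ℝ) < 1 / 16)).const_mul
      (by positivity : 0 ≤ ‖m‖ * (S * (4 * Real.pi) * (2 * ε))))).add
    ((expSmall_mul_exp (by positivity : (0 : ℝ) < ε ^ 2 / 4)).const_mul
      (by positivity : 0 ≤ ‖m‖ * (S * (4 * Real.pi))))).mono fun M hM => ?_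
  have hM0 : 0 < M := by linarith
  have hle : M / 2 ≤ 3 * M / 2 := by linarith
  have hwt := continuous_gaussWt M
  set G : ℝ → ℂ := fun y => (√(2 * Real.pi * M) : ℝ) * cexp (-I * M * y - M * y ^ 2 / 2) with hG
  set V : ℝ → ℂ := fun y => ∫ μ : ℝ in (M / 2)..(3 * M / 2),
    cexp (-((μ : ℂ) - M) ^ 2 / (2 * M)) * cexp (-I * μ * y) with hV
  have hVc : Continuous V :=
    intervalIntegral.continuous_parametric_intervalIntegral_of_continuous'
      (μ := volume) (f := fun (y : ℝ) (μ : ℝ) => cexp (-((μ : ℂ) - M) ^ 2 / (2 * M)) *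
        cexp (-I * μ * y)) (by unfold Function.uncurry; fun_prop) (M / 2) (3 * M / 2)
  have e1 : (∫ μ : ℝ in (M / 2)..(3 * M / 2), cexp (-(μ - M) ^ 2 / (2 * M)) *
      ∫ z : ℝ × ℝ, ((z.1 : ℂ) ^ k * gevSeries s 0 z.2) *
        waveKer ζ Φ (k + 1) 0 z.1 z.2 (√μ : ℝ)
        ∂(volume.restrict (Set.Ioc (-ε) ε ×ˢ Set.Ioc (-ε) ε))) =
      (∫ μ : ℝ in (M / 2)..(3 * M / 2), cexp (-(μ - M) ^ 2 / (2 * M)) * ((X μ - m) * Y μ)) +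
        m * ∫ μ : ℝ in (M / 2)..(3 * M / 2), cexp (-(μ - M) ^ 2 / (2 * M)) * Y μ := by
    rw [← intervalIntegral.integral_const_mul, ← intervalIntegral.integral_add]
    · refine intervalIntegral.integral_congr fun μ hμ => ?_
      rw [Set.uIcc_of_le hle] at hμ
      rw [integral_box_eq ζ _ k hε (by linarith [hμ.1])]
      ring
    · exact Continuous.intervalIntegrable (by fun_prop) _ _
    · exact Continuous.intervalIntegrable (by fun_prop) _ _
  have e2 : ∫ μ : ℝ in (M / 2)..(3 * M / 2), cexp (-(μ - M) ^ 2 / (2 * M)) * Y μ =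
      ∫ y in (-ε)..ε, gevSeries s 0 y * V y := by
    simp only [hYdef, hV, ← intervalIntegral.integral_const_mul]
    rw [intervalIntegral_intervalIntegral_swap]
    · refine intervalIntegral.integral_congr fun y _ => ?_
      refine intervalIntegral.integral_congr fun μ _ => ?_
      ring
    · refine (ContinuousOn.integrableOn_compact
        (isCompact_uIcc.prod isCompact_uIcc) (Continuous.continuousOn ?_)).mono_set
        (Set.prod_mono Set.uIoc_subset_uIcc Set.uIoc_subset_uIcc)
      unfold Function.uncurry
      fun_prop
  have h1 : ‖∫ μ : ℝ in (M / 2)..(3 * M / 2), cexp (-(μ - M) ^ 2 / (2 * M)) *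
      ((X μ - m) * Y μ)‖ ≤ A * (S * (2 * ε)) * (M * Real.exp (-c' * M)) := by
    refine (intervalIntegral.norm_integral_le_of_norm_le_const
      (C := 1 * (A * Real.exp (-c' * M) * (S * (2 * ε)))) fun μ hμ => ?_).trans_eq ?_
    · rw [Set.uIoc_of_le hle] at hμ
      rw [norm_mul, norm_mul]
      exact mul_le_mul (norm_gaussWt_ofReal_le hM0.le μ) (mul_le_mul (hX M μ hM0.le hμ.1.le)
        (hYb μ) (norm_nonneg _) (by positivity)) (by positivity) zero_le_one
    · rw [abs_of_nonneg (by linarith)]; ring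
  have h2 : ‖∫ y in (-ε)..ε, gevSeries s 0 y * (V y - G y)‖ ≤
      S * (4 * Real.pi) * (2 * ε) * (M * Real.exp (-(1 / 16) * M)) := by
    refine (intervalIntegral.norm_integral_le_of_norm_le_const
      (C := S * (4 * Real.pi * (M * Real.exp (-(1 / 16) * M)))) fun y _ => ?_).trans_eq ?_
    · rw [norm_mul, norm_sub_rev]
      exact mul_le_mul (hS y) (norm_integral_gaussWt_sub_le hM y) (norm_nonneg _) hS0
    · rw [sub_neg_eq_add, abs_of_pos (by linarith)]; ring
  have h3 := norm_gevGaussSum_sub_le hs hM hε hS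
  rw [← norm_neg, neg_sub] at h3
  have e3 : ∫ y in (-ε)..ε, gevSeries s 0 y * V y =
      (∫ y in (-ε)..ε, gevSeries s 0 y * (V y - G y)) + ∫ y in (-ε)..ε, gevSeries s 0 y * G y := by
    rw [← intervalIntegral.integral_add]
    · refine intervalIntegral.integral_congr fun y _ => ?_
      ring
    · exact Continuous.intervalIntegrable (by fun_prop) _ _
    · exact Continuous.intervalIntegrable (by fun_prop) _ _
  rw [e1, e2, e3]
  have e4 : ∀ a b d g : ℂ, a + m * (b + d) - m * g = a + (m * b + m * (d - g)) := by intros; ring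
  rw [e4, add_assoc]
  refine (norm_add_le _ _).trans (add_le_add h1 ((norm_add_le _ _).trans (add_le_add ?_ ?_)))
  · rw [norm_mul, mul_assoc]; exact mul_le_mul_of_nonneg_left h2 (norm_nonneg m)
  · rw [norm_mul, mul_assoc]; exact mul_le_mul_of_nonneg_left h3 (norm_nonneg m)

end MainTerm

section SliceBounds

variable {N : ℕ} {i₀ i₁ i₂ : Fin N}

lemma TestFn.add {q p : (Fin N → ℝ) → ℂ} (hq : TestFn q) (hp : TestFn p) :
    TestFn fun x => q x + p x :=
  ⟨hq.smooth.add hp.smooth, hq.compactSupport.add hp.compactSupport⟩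

lemma TestFn.sub {q p : (Fin N → ℝ) → ℂ} (hq : TestFn q) (hp : TestFn p) :
    TestFn fun x => q x - p x :=
  ⟨hq.smooth.sub hp.smooth, hq.compactSupport.sub hp.compactSupport⟩

lemma TestFn.pop {n : ℕ} {g : (Fin (n + 1) → ℝ) → ℂ} (hg : TestFn g) (b : ℝ) :
    TestFn (Pop n b g) := by
  have h1 : ContDiff ℝ (⊤ : ℕ∞) fun x : Fin (n + 1) → ℝ => (↑(x 1) : ℂ) :=
    ofRealCLM.contDiff.comp (contDiff_apply ℝ ℝ 1)
  exact (((hg.dop 0).dop 0).dop 0).sub ((((hg.dop 0).dop 1).dop 1).add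
    ((((hg.dop 0).dop (Fin.last n)).dop (Fin.last n)).mul (h1.pow 2))) |>.sub
    ((((hg.dop (Fin.last n)).dop (Fin.last n)).dop (Fin.last n)).mul
      (contDiff_const.mul (h1.pow 3)))

lemma sliceInt_eq_setIntegral (h₀₁ : i₀ ≠ i₁) (h₀₂ : i₀ ≠ i₂) (h₁₂ : i₁ ≠ i₂)
    {q : (Fin N → ℝ) → ℂ} {R : ℝ} (hR : ∀ x, R < ‖x‖ → q x = 0) (Φ : ℂ → ℂ) (ρ t : ℝ) :
    sliceInt i₀ i₁ i₂ Φ q ρ t = ∫ z in Metric.closedBall (0 : ℝ × ℝ) R,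
      q (slicePt i₀ i₁ i₂ t z) * (Φ (ρ * z.1 : ℝ) * cexp (-I * (ρ ^ 2 : ℝ) * z.2)) := by
  refine (setIntegral_eq_integral_of_forall_compl_eq_zero fun z hz => ?_).symm
  rw [mem_closedBall_zero_iff, not_le] at hz
  rw [hR _ (hz.trans_le (norm_le_norm_slicePt h₀₁ h₀₂ h₁₂ t z)), zero_mul]

lemma pow_mul_sliceInt (h₀₁ : i₀ ≠ i₁) (h₀₂ : i₀ ≠ i₂) (h₁₂ : i₁ ≠ i₂)
    {q : (Fin N → ℝ) → ℂ} {R : ℝ} (hR : ∀ x, R < ‖x‖ → q x = 0) (ζ : ℂ) (Φ : ℂ → ℂ) (p : ℕ)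
    (ρ t : ℝ) :
    (ρ : ℂ) ^ p * (cexp (-I * ζ * ρ * t) * sliceInt i₀ i₁ i₂ Φ q ρ t) =
      ∫ z in Metric.closedBall (0 : ℝ × ℝ) R,
        q (slicePt i₀ i₁ i₂ t z) * waveKer ζ Φ p t z.1 z.2 ρ := by
  rw [sliceInt_eq_setIntegral h₀₁ h₀₂ h₁₂ hR, ← integral_const_mul, ← integral_const_mul]
  congr 1
  funext z
  rw [waveKer]
  push_cast
  ring

lemma TestFn.exists_norm_sliceInt_le (h₀₁ : i₀ ≠ i₁) (h₀₂ : i₀ ≠ i₂) (h₁₂ : i₁ ≠ i₂)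
    {q : (Fin N → ℝ) → ℂ} (hq : TestFn q) {Φ : ℂ → ℂ} {C : ℝ} (hΦ : ∀ x : ℝ, ‖Φ x‖ ≤ C) :
    ∃ B : ℝ, 0 ≤ B ∧ ∀ ρ t, ‖sliceInt i₀ i₁ i₂ Φ q ρ t‖ ≤ B := by
  obtain ⟨R, hR, hb, h0⟩ := hq.exists_bound
  have hC : 0 ≤ C := (norm_nonneg _).trans (hΦ 0)
  refine ⟨R * C * volume.real (Metric.closedBall (0 : ℝ × ℝ) R), by positivity, fun ρ t => ?_⟩
  rw [sliceInt_eq_setIntegral h₀₁ h₀₂ h₁₂ h0]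
  refine norm_setIntegral_le_of_norm_le_const measure_closedBall_lt_top fun z _ => ?_
  have e : -I * (ρ ^ 2 : ℝ) * z.2 = ((-(ρ ^ 2 * z.2) : ℝ) : ℂ) * I := by push_cast; ring
  rw [norm_mul, norm_mul, e, norm_exp_ofReal_mul_I, mul_one]
  exact mul_le_mul (hb _) (hΦ _) (norm_nonneg _) hR.le

end SliceBounds

lemma norm_pow_mul_sector_le {W : ℂ → ℂ} {κ c C : ℝ} (hc : 0 < c) (hC : 0 < C)
    (hb : ∀ z : ℂ, |z.im| ≤ κ * |z.re| → ‖W z‖ ≤ C * Real.exp (-c * ‖z‖ ^ 2)) (k : ℕ) :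
    ∃ A : ℝ, 0 < A ∧ ∀ z : ℂ, |z.im| ≤ κ * |z.re| →
      ‖z ^ k * W z‖ ≤ A * Real.exp (-(c / 2) * ‖z‖ ^ 2) := by
  obtain ⟨A, hA, h⟩ := exists_pow_mul_exp_neg_le k hc
  refine ⟨(1 + A) * C, by positivity, fun z hz => ?_⟩
  have h1 := h (‖z‖ ^ 2) (sq_nonneg _)
  have h2 : ‖z‖ ^ k ≤ 1 + (‖z‖ ^ 2) ^ k := by
    rcases le_total ‖z‖ 1 with hx | hx
    · have h3 := pow_le_one₀ (n := k) (norm_nonneg z) hx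
      have h4 : (0 : ℝ) ≤ (‖z‖ ^ 2) ^ k := by positivity
      linarith
    · have : ‖z‖ ≤ ‖z‖ ^ 2 := by nlinarith
      linarith [pow_le_pow_left₀ (norm_nonneg z) this k]
  have h3 : Real.exp (-c * ‖z‖ ^ 2) ≤ Real.exp (-(c / 2) * ‖z‖ ^ 2) :=
    Real.exp_le_exp.2 (by nlinarith [mul_nonneg hc.le (sq_nonneg ‖z‖)])
  rw [norm_mul, norm_pow]
  calc ‖z‖ ^ k * ‖W z‖ ≤ (1 + (‖z‖ ^ 2) ^ k) * (C * Real.exp (-c * ‖z‖ ^ 2)) :=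
        mul_le_mul h2 (hb z hz) (norm_nonneg _) (by positivity)
    _ = C * (Real.exp (-c * ‖z‖ ^ 2) + (‖z‖ ^ 2) ^ k * Real.exp (-c * ‖z‖ ^ 2)) := by ring
    _ ≤ C * (Real.exp (-(c / 2) * ‖z‖ ^ 2) + A * Real.exp (-(c / 2) * ‖z‖ ^ 2)) :=
        mul_le_mul_of_nonneg_left (add_le_add h3 h1) hC.le
    _ = _ := by ring

lemma norm_le_of_sector {W : ℂ → ℂ} {κ c C : ℝ} (hκ : 0 < κ)
    (hb : ∀ z : ℂ, |z.im| ≤ κ * |z.re| → ‖W z‖ ≤ C * Real.exp (-c * ‖z‖ ^ 2)) (x : ℝ) :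
    ‖W x‖ ≤ C * Real.exp (-c * x ^ 2) := by
  have h := hb x (by rw [ofReal_im, abs_zero]; positivity)
  rwa [norm_real, Real.norm_eq_abs, sq_abs] at h

lemma norm_le_const_of_sector {W : ℂ → ℂ} {κ c C : ℝ} (hκ : 0 < κ) (hc : 0 < c) (hC : 0 < C)
    (hb : ∀ z : ℂ, |z.im| ≤ κ * |z.re| → ‖W z‖ ≤ C * Real.exp (-c * ‖z‖ ^ 2)) (x : ℝ) :
    ‖W x‖ ≤ C := by
  refine (norm_le_of_sector hκ hb x).trans (mul_le_of_le_one_right hC.le ?_)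
  rw [Real.exp_le_one_iff]
  nlinarith [mul_nonneg hc.le (sq_nonneg x)]

lemma fin_ne_of_two_le {n : ℕ} (hn : 2 ≤ n) :
    (0 : Fin (n + 1)) ≠ 1 ∧ (0 : Fin (n + 1)) ≠ Fin.last n ∧ (1 : Fin (n + 1)) ≠ Fin.last n := by
  have h1 : (1 : Fin (n + 1)).val = 1 := by rw [Fin.val_one']; exact Nat.mod_eq_of_lt (by omega)
  refine ⟨fun hh => ?_, fun hh => ?_, fun hh => ?_⟩
  · have := congrArg Fin.val hh; rw [h1] at this; simp at this
  · have := congrArg Fin.val hh; simp at this; omega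
  · have := congrArg Fin.val hh; rw [h1] at this; simp at this; omega

/-- At a positive time the boundary term of the Green identity decays exponentially. -/
lemma exists_norm_greenTerm_le {n : ℕ} (hn : 2 ≤ n) (b : ℝ) {ζ : ℂ} (hζ : ζ.im < 0) {W : ℂ → ℂ}
    {κ c C : ℝ} (hκ : 0 < κ) (hc : 0 < c) (hC : 0 < C)
    (hb : ∀ z : ℂ, |z.im| ≤ κ * |z.re| → ‖W z‖ ≤ C * Real.exp (-c * ‖z‖ ^ 2))
    {g : (Fin (n + 1) → ℝ) → ℂ} (hg : TestFn g) (p : ℕ) {T : ℝ} (hT : 0 < T) :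
    ∃ A : ℝ, 0 ≤ A ∧ ∃ c' : ℝ, 0 < c' ∧ ∀ ρ : ℝ, 0 ≤ ρ →
      ‖(ρ : ℂ) ^ p * (cexp (-I * ζ * ρ * T) * greenTerm n b ζ W g ρ T)‖ ≤
        A * Real.exp (-c' * ρ) := by
  obtain ⟨h₀₁, h₀₂, h₁₂⟩ := fin_ne_of_two_le hn
  obtain ⟨C₃, hC₃, hb₃⟩ := norm_pow_mul_sector_le hc hC hb 3
  obtain ⟨B₁, hB₁, h₁⟩ := ((hg.dop 0).dop 0).exists_norm_sliceInt_le h₀₁ h₀₂ h₁₂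
    (norm_le_const_of_sector hκ hc hC hb)
  obtain ⟨B₂, hB₂, h₂⟩ := (hg.dop 0).exists_norm_sliceInt_le h₀₁ h₀₂ h₁₂
    (norm_le_const_of_sector hκ hc hC hb)
  obtain ⟨B₃, hB₃, h₃⟩ := hg.exists_norm_sliceInt_le h₀₁ h₀₂ h₁₂
    (Φ := fun y => y ^ 3 * W y) (norm_le_const_of_sector (W := fun y => y ^ 3 * W y) hκ (half_pos hc) hC₃
      hb₃)
  have hγ : 0 < -ζ.im * T := by nlinarith
  obtain ⟨A₁, hA₁, e₁⟩ := exists_pow_mul_exp_neg_le p hγ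
  obtain ⟨A₂, hA₂, e₂⟩ := exists_pow_mul_exp_neg_le (p + 1) hγ
  obtain ⟨A₃, hA₃, e₃⟩ := exists_pow_mul_exp_neg_le (p + 2) hγ
  refine ⟨A₁ * B₁ + A₂ * (‖ζ‖ * B₂) + A₃ * (‖(b : ℂ) / ζ‖ * B₃), by positivity, -ζ.im * T / 2,
    half_pos hγ, fun ρ hρ => ?_⟩
  have hG : ‖greenTerm n b ζ W g ρ T‖ ≤ B₁ + ‖ζ‖ * ρ * B₂ + ‖(b : ℂ) / ζ‖ * ρ ^ 2 * B₃ := by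
    unfold greenTerm
    refine (norm_add₃_le).trans (add_le_add_three (h₁ _ _) ?_ ?_)
    · rw [norm_mul, norm_mul, norm_real, Real.norm_of_nonneg hρ]
      exact mul_le_mul_of_nonneg_left (h₂ _ _) (by positivity)
    · rw [norm_mul, norm_mul, norm_pow, norm_real, Real.norm_of_nonneg hρ]
      exact mul_le_mul_of_nonneg_left (h₃ _ _) (by positivity)
  have hE : ‖cexp (-I * ζ * ρ * T)‖ = Real.exp (-(-ζ.im * T) * ρ) := by
    rw [Complex.norm_exp]
    congr 1
    have : -I * ζ * ρ * T = -(I * ζ) * ((ρ * T : ℝ) : ℂ) := by push_cast; ring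
    rw [this, re_mul_ofReal, neg_re, I_mul_re]
    ring
  rw [norm_mul, norm_mul, norm_pow, norm_real, Real.norm_of_nonneg hρ, hE]
  have hx := Real.exp_pos (-(-ζ.im * T) * ρ)
  calc _ ≤ ρ ^ p * (Real.exp (-(-ζ.im * T) * ρ) *
        (B₁ + ‖ζ‖ * ρ * B₂ + ‖(b : ℂ) / ζ‖ * ρ ^ 2 * B₃)) := by gcongr
    _ = (ρ ^ p * Real.exp (-(-ζ.im * T) * ρ)) * B₁ +
        (ρ ^ (p + 1) * Real.exp (-(-ζ.im * T) * ρ)) * (‖ζ‖ * B₂) +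
        (ρ ^ (p + 2) * Real.exp (-(-ζ.im * T) * ρ)) * (‖(b : ℂ) / ζ‖ * B₃) := by ring
    _ ≤ (A₁ * Real.exp (-(-ζ.im * T / 2) * ρ)) * B₁ +
        (A₂ * Real.exp (-(-ζ.im * T / 2) * ρ)) * (‖ζ‖ * B₂) +
        (A₃ * Real.exp (-(-ζ.im * T / 2) * ρ)) * (‖(b : ℂ) / ζ‖ * B₃) := by
        refine add_le_add_three ?_ ?_ ?_
        · exact mul_le_mul_of_nonneg_right (e₁ ρ hρ) hB₁
        · exact mul_le_mul_of_nonneg_right (e₂ ρ hρ) (by positivity)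
        · exact mul_le_mul_of_nonneg_right (e₃ ρ hρ) (by positivity)
    _ = _ := by ring

/-- The averaged boundary term is small in terms of the square root of the frequency. -/
lemma exists_norm_average_le {E : ℝ → ℂ} {A c : ℝ} (hA : 0 ≤ A) (hc : 0 < c)
    (hE : ∀ ρ : ℝ, 0 ≤ ρ → ‖E ρ‖ ≤ A * Real.exp (-c * ρ)) :
    ∃ A' : ℝ, 0 ≤ A' ∧ ∃ c' : ℝ, 0 < c' ∧ ∀ M : ℝ, 0 ≤ M →
      ‖∫ μ : ℝ in (M / 2)..(3 * M / 2), cexp (-(μ - M) ^ 2 / (2 * M)) * E √μ‖ ≤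
        A' * Real.exp (-c' * √M) := by
  obtain ⟨A₂, hA₂, h₂⟩ := exists_pow_mul_exp_neg_le 2 (half_pos hc)
  refine ⟨A * A₂, by positivity, c / 2 / 2, by positivity, fun M hM => ?_⟩
  refine (intervalIntegral.norm_integral_le_of_norm_le_const
    (C := 1 * (A * Real.exp (-(c / 2) * √M))) fun μ hμ => ?_).trans ?_
  · rw [Set.uIoc_of_le (by linarith)] at hμ
    rw [norm_mul]
    refine mul_le_mul (norm_gaussWt_ofReal_le hM μ) ((hE _ (Real.sqrt_nonneg _)).trans
      (mul_le_mul_of_nonneg_left (Real.exp_le_exp.2 ?_) hA)) (norm_nonneg _) zero_le_one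
    have : √M / 2 ≤ √μ := by
      refine Real.le_sqrt_of_sq_le ?_
      rw [div_pow, Real.sq_sqrt hM]
      linarith [hμ.1]
    nlinarith
  · have := h₂ √M (Real.sqrt_nonneg _)
    rw [Real.sq_sqrt hM] at this
    rw [abs_of_nonneg (by linarith), one_mul, mul_assoc, mul_assoc]
    refine mul_le_mul_of_nonneg_left ?_ hA
    linarith

section Combine

/-- Gaussian average over frequencies in `[M / 2, 3 * M / 2]`. -/
noncomputable def gaussAvg (f : ℝ → ℂ) (M : ℝ) : ℂ :=
  ∫ μ : ℝ in (M / 2)..(3 * M / 2), cexp (-(μ - M) ^ 2 / (2 * M)) * f μ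

/-- The Gaussian weight times `f` is integrable on all averaging intervals. -/
def GaussIntegrable (f : ℝ → ℂ) : Prop :=
  ∀ M : ℝ, 0 < M → IntervalIntegrable
    (fun μ : ℝ => cexp (-((μ : ℂ) - M) ^ 2 / (2 * M)) * f μ) volume (M / 2) (3 * M / 2)

lemma GaussIntegrable.add {f g : ℝ → ℂ} (hf : GaussIntegrable f) (hg : GaussIntegrable g) :
    GaussIntegrable fun μ => f μ + g μ := fun M hM => by
  simp only [mul_add]
  exact (hf M hM).add (hg M hM)

lemma GaussIntegrable.const_mul {f : ℝ → ℂ} (hf : GaussIntegrable f) (a : ℂ) :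
    GaussIntegrable fun μ => a * f μ := fun M hM => by
  simp only [mul_left_comm _ a]
  exact (hf M hM).const_mul a

lemma gaussAvg_add {f g : ℝ → ℂ} (hf : GaussIntegrable f) (hg : GaussIntegrable g) {M : ℝ}
    (hM : 0 < M) : gaussAvg (fun μ => f μ + g μ) M = gaussAvg f M + gaussAvg g M := by
  simp only [gaussAvg, mul_add]
  exact intervalIntegral.integral_add (hf M hM) (hg M hM)

lemma gaussAvg_const_mul (f : ℝ → ℂ) (a : ℂ) (M : ℝ) :
    gaussAvg (fun μ => a * f μ) M = a * gaussAvg f M := by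
  simp only [gaussAvg, mul_left_comm _ a]
  exact intervalIntegral.integral_const_mul _ _

lemma gaussAvg_congr {f g : ℝ → ℂ} (h : ∀ μ, 0 < μ → f μ = g μ) {M : ℝ} (hM : 0 < M) :
    gaussAvg f M = gaussAvg g M := by
  refine intervalIntegral.integral_congr fun μ hμ => ?_
  rw [Set.uIcc_of_le (by linarith)] at hμ
  simp only [h μ (by linarith [hμ.1])]

/-- Functions with exponentially small Gaussian averages. -/
def AvgSmall (f : ℝ → ℂ) : Prop := GaussIntegrable f ∧ ExpSmall fun M => ‖gaussAvg f M‖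

lemma AvgSmall.add {f g : ℝ → ℂ} (hf : AvgSmall f) (hg : AvgSmall g) :
    AvgSmall fun μ => f μ + g μ :=
  ⟨hf.1.add hg.1, (hf.2.add hg.2).mono fun M hM => by
    rw [gaussAvg_add hf.1 hg.1 (by linarith)]; exact norm_add_le _ _⟩

lemma AvgSmall.const_mul {f : ℝ → ℂ} (hf : AvgSmall f) (a : ℂ) : AvgSmall fun μ => a * f μ :=
  ⟨hf.1.const_mul a, (hf.2.const_mul (norm_nonneg a)).mono fun M _ => by
    rw [gaussAvg_const_mul, norm_mul]⟩

lemma exists_norm_le_of_average {D L E : ℝ → ℂ} {G : ℝ → ℂ} {A c : ℝ} (hA : 0 ≤ A)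
    (hc : 0 < c) (hE : ∀ ρ : ℝ, 0 ≤ ρ → ‖E ρ‖ ≤ A * Real.exp (-c * ρ))
    (hkey : ∀ μ : ℝ, 0 < μ → D μ + L μ = E √μ) (hD : GaussIntegrable D) (hL : AvgSmall L)
    (hG : ExpSmall fun M => ‖gaussAvg D M - G M‖) :
    ∃ A' : ℝ, 0 ≤ A' ∧ ∃ c' : ℝ, 0 < c' ∧ ∀ M : ℝ, 1 ≤ M → ‖G M‖ ≤ A' * Real.exp (-c' * √M) := by
  obtain ⟨A₁, hA₁, c₁, hc₁, h₁⟩ := exists_norm_average_le hA hc hE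
  obtain ⟨A₂, hA₂, c₂, hc₂, h₂⟩ := hL.2.add hG
  refine ⟨A₁ + A₂, by positivity, min c₁ c₂, lt_min hc₁ hc₂, fun M hM => ?_⟩
  have hM0 : 0 < M := by linarith
  have e : gaussAvg D M = gaussAvg (fun μ => E √μ) M - gaussAvg L M := by
    rw [← gaussAvg_congr hkey hM0, gaussAvg_add hD hL.1 hM0, add_sub_cancel_right]
  have hsq : √M ≤ M := by
    rw [Real.sqrt_le_left hM0.le]; nlinarith
  have e1 : Real.exp (-c₁ * √M) ≤ Real.exp (-(min c₁ c₂) * √M) := Real.exp_le_exp.2 <| by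
    linarith [mul_le_mul_of_nonneg_right (min_le_left c₁ c₂) (Real.sqrt_nonneg M)]
  have e2 : Real.exp (-c₂ * M) ≤ Real.exp (-(min c₁ c₂) * √M) := Real.exp_le_exp.2 <| by
    linarith [mul_le_mul_of_nonneg_right (min_le_right c₁ c₂) (Real.sqrt_nonneg M),
      mul_le_mul_of_nonneg_left hsq hc₂.le]
  have h3 : ‖gaussAvg (fun μ => E √μ) M‖ ≤ A₁ * Real.exp (-c₁ * √M) := h₁ M hM0.le
  have h4 := h₂ M hM
  beta_reduce at h4
  have h5 : G M = gaussAvg (fun μ => E √μ) M - (gaussAvg L M + (gaussAvg D M - G M)) := by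
    rw [e]; ring
  have h6 : ‖G M‖ ≤ ‖gaussAvg (fun μ => E √μ) M‖ + (‖gaussAvg L M‖ + ‖gaussAvg D M - G M‖) :=
    calc ‖G M‖ = ‖gaussAvg (fun μ => E √μ) M - (gaussAvg L M + (gaussAvg D M - G M))‖ :=
          congrArg norm h5
      _ ≤ _ := (norm_sub_le _ _).trans (add_le_add_right (norm_add_le _ _) _)
  rw [add_mul]
  exact h6.trans (add_le_add (h3.trans (mul_le_mul_of_nonneg_left e1 hA₁))
    (h4.trans (mul_le_mul_of_nonneg_left e2 hA₂)))

end Combine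

section Wave

variable {X : Type*} [MeasurableSpace X] {ν : Measure X} [IsFiniteMeasure ν]

lemma avgSmall_wave {ζ : ℂ} (hζ : ζ.im < 0) {Φ : ℂ → ℂ} (hΦ : Differentiable ℂ Φ)
    {κ c C : ℝ} (hκ : 0 < κ) (hc : 0 < c) (hC : 0 < C)
    (hb : ∀ z : ℂ, |z.im| ≤ κ * |z.re| → ‖Φ z‖ ≤ C * Real.exp (-c * ‖z‖ ^ 2)) (p : ℕ) {ε : ℝ}
    (hε : 0 < ε) {t x y : X → ℝ} (ht : Measurable t) (hx : Measurable x) (hy : Measurable y)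
    {F : X → ℂ} (hF : AEStronglyMeasurable F ν) {B : ℝ} (hFB : ∀ z, ‖F z‖ ≤ B)
    (ht0 : ∀ᵐ z ∂ν, 0 ≤ t z)
    (hF0 : ∀ᵐ z ∂ν, |x z| < ε → |y z| < ε → F z = 0) :
    AvgSmall fun μ => ∫ z, F z * waveKer ζ Φ p (t z) (x z) (y z) (√μ : ℝ) ∂ν := by
  refine ⟨fun M hM => intervalIntegrable_gaussWt_mul_wave hζ hΦ.continuous hκ hc hC hb p ht hx hy hF
    hFB ht0 hM, exists_far_bound hζ hΦ hκ hc hC hb p hε ht hx hy hF hFB ?_⟩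
  filter_upwards [ht0, hF0] with z h1 h2
  refine ⟨h1, ?_⟩
  by_contra! h
  exact h.1 (h2 h.2.1 h.2.2)

end Wave

instance isFiniteMeasure_restrict_closedBall (R : ℝ) :
    IsFiniteMeasure (volume.restrict (Metric.closedBall (0 : ℝ × ℝ) R)) :=
  isFiniteMeasure_restrict.2 measure_closedBall_lt_top.ne

instance isFiniteMeasure_restrict_cylinder (T R : ℝ) : IsFiniteMeasure
    (volume.restrict (Set.Ioc 0 T ×ˢ Metric.closedBall (0 : ℝ × ℝ) R)) := by
  refine isFiniteMeasure_restrict.2 (ne_of_lt ?_)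
  rw [Measure.volume_eq_prod, Measure.prod_prod]
  exact ENNReal.mul_lt_top measure_Ioc_lt_top measure_closedBall_lt_top

instance isFiniteMeasure_restrict_square (ε : ℝ) : IsFiniteMeasure
    (volume.restrict (Set.Ioc (-ε) ε ×ˢ Set.Ioc (-ε) ε)) := by
  refine isFiniteMeasure_restrict.2 (ne_of_lt ?_)
  rw [Measure.volume_eq_prod, Measure.prod_prod]
  exact ENNReal.mul_lt_top measure_Ioc_lt_top measure_Ioc_lt_top

section Core

variable {n : ℕ} {b : ℝ} {ζ : ℂ} {W W' : ℂ → ℂ} {κ c C : ℝ} {g : (Fin (n + 1) → ℝ) → ℂ}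

lemma continuous_waveKer (hW : Continuous W) (p : ℕ) (ρ : ℂ) :
    Continuous fun q : ℝ × (ℝ × ℝ) => waveKer ζ W p q.1 q.2.1 q.2.2 ρ := by
  unfold waveKer; fun_prop

/-- The Green identity in terms of wave packets. -/
lemma green_wave (hn : 2 ≤ n) (hζ : ζ ≠ 0)
    (h : SolPair (fun y => y ^ 2 + b * y ^ 3 / ζ - ζ ^ 2) W W') (hg : TestFn g) {R : ℝ}
    (hRP : ∀ x, R < ‖x‖ → Pop n b g x = 0) (hR0 : ∀ x, R < ‖x‖ → g x = 0)
    (hR1 : ∀ x, R < ‖x‖ → Dop 0 g x = 0) (hR2 : ∀ x, R < ‖x‖ → Dop 0 (Dop 0 g) x = 0) (p : ℕ)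
    {T ρ : ℝ} (hT : 0 ≤ T) (hρ : 0 < ρ) :
    I * (∫ q in Set.Ioc 0 T ×ˢ Metric.closedBall (0 : ℝ × ℝ) R,
        Pop n b g (slicePt 0 1 (Fin.last n) q.1 q.2) * waveKer ζ W p q.1 q.2.1 q.2.2 ρ) =
      (ρ : ℂ) ^ p * (cexp (-I * ζ * ρ * T) * greenTerm n b ζ W g ρ T) -
      ((∫ z in Metric.closedBall (0 : ℝ × ℝ) R,
          Dop 0 (Dop 0 g) (slicePt 0 1 (Fin.last n) 0 z) * waveKer ζ W p 0 z.1 z.2 ρ) +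
        ζ * (∫ z in Metric.closedBall (0 : ℝ × ℝ) R,
          Dop 0 g (slicePt 0 1 (Fin.last n) 0 z) * waveKer ζ W (p + 1) 0 z.1 z.2 ρ) +
        b / ζ * ∫ z in Metric.closedBall (0 : ℝ × ℝ) R,
          g (slicePt 0 1 (Fin.last n) 0 z) *
            waveKer ζ (fun y => y ^ 3 * W y) (p + 2) 0 z.1 z.2 ρ) := by
  obtain ⟨h₀₁, h₀₂, h₁₂⟩ := fin_ne_of_two_le hn
  have hW := h.continuous_fst
  have hP := (hg.pop b).continuous
  have hgreen := green_identity hn hζ h hg hρ T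
  have e0 : cexp (-I * ζ * ρ * (0 : ℝ)) = 1 := by rw [ofReal_zero, mul_zero, Complex.exp_zero]
  have e1 := pow_mul_sliceInt h₀₁ h₀₂ h₁₂ hR2 ζ W p ρ 0
  have e2 := pow_mul_sliceInt h₀₁ h₀₂ h₁₂ hR1 ζ W (p + 1) ρ 0
  have e3 := pow_mul_sliceInt h₀₁ h₀₂ h₁₂ hR0 ζ (fun y => y ^ 3 * W y) (p + 2) ρ 0
  rw [e0, one_mul] at e1 e2 e3
  have hcont : Continuous fun q : ℝ × (ℝ × ℝ) =>
      Pop n b g (slicePt 0 1 (Fin.last n) q.1 q.2) * waveKer ζ W p q.1 q.2.1 q.2.2 ρ :=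
    (hP.comp continuous_slicePt).mul (continuous_waveKer hW p ρ)
  have e4 : ∫ q in Set.Ioc 0 T ×ˢ Metric.closedBall (0 : ℝ × ℝ) R,
      Pop n b g (slicePt 0 1 (Fin.last n) q.1 q.2) * waveKer ζ W p q.1 q.2.1 q.2.2 ρ =
      (ρ : ℂ) ^ p * ∫ t in (0 : ℝ)..T, cexp (-I * ζ * ρ * t) *
        sliceInt 0 1 (Fin.last n) W (Pop n b g) ρ t := by
    rw [Measure.volume_eq_prod, setIntegral_prod, ← intervalIntegral.integral_const_mul,
      intervalIntegral.integral_of_le hT]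
    · simp only [pow_mul_sliceInt h₀₁ h₀₂ h₁₂ hRP]
    · exact (hcont.continuousOn.integrableOn_compact
        (isCompact_Icc.prod (isCompact_closedBall _ _))).mono_set
        (Set.prod_mono Set.Ioc_subset_Icc_self subset_rfl)
  rw [e4, ← e1, ← e2, ← e3, mul_left_comm, hgreen]
  simp only [greenTerm]
  ring

lemma TestFn.bound_mono {N : ℕ} {q : (Fin N → ℝ) → ℂ} {R R' : ℝ}
    (h : (∀ x, ‖q x‖ ≤ R) ∧ ∀ x, R < ‖x‖ → q x = 0) (hR : R ≤ R') :
    (∀ x, ‖q x‖ ≤ R') ∧ ∀ x, R' < ‖x‖ → q x = 0 :=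
  ⟨fun x => (h.1 x).trans hR, fun x hx => h.2 x (hR.trans_lt hx)⟩

/-- A local solution with data `x₁ ^ k * θ(xₙ)` forces the averaged Fourier coefficients of `θ` to
decay exponentially in the square root of the frequency. -/
theorem exists_norm_gevGaussSum_le (hn : 2 ≤ n) (hζ : ζ.im < 0)
    (h : SolPair (fun y => y ^ 2 + b * y ^ 3 / ζ - ζ ^ 2) W W') (hκ : 0 < κ) (hc : 0 < c)
    (hC : 0 < C) (hb : ∀ z : ℂ, |z.im| ≤ κ * |z.re| → ‖W z‖ ≤ C * Real.exp (-c * ‖z‖ ^ 2))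
    (hg : TestFn g) (k : ℕ) {s ε : ℝ} (hs : 0 < s) (hε : 0 < ε)
    (hP : ∀ t z, 0 ≤ t → t ≤ ε → ‖z‖ ≤ ε → Pop n b g (slicePt 0 1 (Fin.last n) t z) = 0)
    (h0 : ∀ z, ‖z‖ ≤ ε → g (slicePt 0 1 (Fin.last n) 0 z) = 0)
    (h1 : ∀ z, ‖z‖ ≤ ε → Dop 0 g (slicePt 0 1 (Fin.last n) 0 z) = 0)
    (h2 : ∀ z : ℝ × ℝ, ‖z‖ ≤ ε → Dop 0 (Dop 0 g) (slicePt 0 1 (Fin.last n) 0 z) =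
      (z.1 : ℂ) ^ k * gevSeries s 0 z.2) :
    ∃ A : ℝ, 0 ≤ A ∧ ∃ c' : ℝ, 0 < c' ∧ ∀ M : ℝ, 1 ≤ M →
      ‖(∫ x : ℝ, (x : ℂ) ^ k * W x) * gevGaussSum s M‖ ≤ A * Real.exp (-c' * √M) := by
  have hζ0 : ζ ≠ 0 := fun h => by simp [h] at hζ
  have hWd : Differentiable ℂ W := fun z => (h.deriv_fst z).differentiableAt
  have hW3 : Differentiable ℂ fun y => y ^ 3 * W y := (differentiable_id.pow 3).mul hWd
  obtain ⟨C₃, hC₃, hb₃⟩ := norm_pow_mul_sector_le hc hC hb 3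
  obtain ⟨R, hεR, hRP, hR0, hR1, hR2⟩ : ∃ R, ε ≤ R ∧
      ((∀ x, ‖Pop n b g x‖ ≤ R) ∧ ∀ x, R < ‖x‖ → Pop n b g x = 0) ∧
      ((∀ x, ‖g x‖ ≤ R) ∧ ∀ x, R < ‖x‖ → g x = 0) ∧
      ((∀ x, ‖Dop 0 g x‖ ≤ R) ∧ ∀ x, R < ‖x‖ → Dop 0 g x = 0) ∧
      ((∀ x, ‖Dop 0 (Dop 0 g) x‖ ≤ R) ∧ ∀ x, R < ‖x‖ → Dop 0 (Dop 0 g) x = 0) := by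
    obtain ⟨R₁, h₁, h₁'⟩ := (hg.pop b).exists_bound
    obtain ⟨R₂, h₂, h₂'⟩ := hg.exists_bound
    obtain ⟨R₃, h₃, h₃'⟩ := (hg.dop 0).exists_bound
    obtain ⟨R₄, h₄, h₄'⟩ := ((hg.dop 0).dop 0).exists_bound
    exact ⟨ε + R₁ + R₂ + R₃ + R₄, by linarith, TestFn.bound_mono h₁' (by linarith),
      TestFn.bound_mono h₂' (by linarith), TestFn.bound_mono h₃' (by linarith),
      TestFn.bound_mono h₄' (by linarith)⟩
  have hθ := (contDiff_gevSeries hs 0).continuous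
  obtain ⟨S, hS⟩ : ∃ S, ∀ y, ‖gevSeries s 0 y‖ ≤ S := ⟨_, norm_gevSeries_le hs 0⟩
  have hS0 : 0 ≤ S := (norm_nonneg _).trans (hS 0)
  set K := Metric.closedBall (0 : ℝ × ℝ) R with hK
  set Q : Set (ℝ × ℝ) := Set.Ioc (-ε) ε ×ˢ Set.Ioc (-ε) ε with hQ
  have hQm : MeasurableSet Q := measurableSet_Ioc.prod measurableSet_Ioc
  have hQε : ∀ z ∈ Q, ‖z‖ ≤ ε := fun z hz => by
    rw [Prod.norm_def, max_le_iff, Real.norm_eq_abs, Real.norm_eq_abs, abs_le, abs_le]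
    exact ⟨⟨hz.1.1.le, hz.1.2⟩, ⟨hz.2.1.le, hz.2.2⟩⟩
  have hQK : Q ⊆ K := fun z hz => mem_closedBall_zero_iff.2 ((hQε z hz).trans hεR)
  have hnear : ∀ z : ℝ × ℝ, |z.1| < ε → |z.2| < ε → z ∈ Q := fun z hx hy => by
    rw [abs_lt] at hx hy
    exact ⟨⟨hx.1, hx.2.le⟩, ⟨hy.1, hy.2.le⟩⟩
  set f : ℝ × ℝ → ℂ := fun z => (z.1 : ℂ) ^ k * gevSeries s 0 z.2 with hf
  have hfc : Continuous f := by rw [hf]; fun_prop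
  set u₂ : ℝ × ℝ → ℂ := fun z => Dop 0 (Dop 0 g) (slicePt 0 1 (Fin.last n) 0 z) with hu₂
  have hu₂c : Continuous u₂ := continuous_slice ((hg.dop 0).dop 0).continuous 0
  have hindb : ∀ z, ‖Q.indicator f z‖ ≤ ε ^ k * S := fun z => by
    by_cases hz : z ∈ Q
    · rw [Set.indicator_of_mem hz, hf, norm_mul, norm_pow, norm_real]
      exact mul_le_mul (pow_le_pow_left₀ (norm_nonneg _) ((norm_fst_le z).trans (hQε z hz)) k)
        (hS _) (norm_nonneg _) (by positivity)
    · rw [Set.indicator_of_notMem hz, norm_zero]; positivity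
  set L : ℝ → ℂ := fun μ => ∫ q in Set.Ioc 0 ε ×ˢ K,
    Pop n b g (slicePt 0 1 (Fin.last n) q.1 q.2) *
      waveKer ζ W (k + 1) q.1 q.2.1 q.2.2 (√μ : ℝ) with hL
  set D : ℝ → ℂ := fun μ => ∫ z in Q, f z * waveKer ζ W (k + 1) 0 z.1 z.2 (√μ : ℝ) with hD
  set B₂ : ℝ → ℂ := fun μ => ∫ z in K, (u₂ z - Q.indicator f z) *
    waveKer ζ W (k + 1) 0 z.1 z.2 (√μ : ℝ) with hB₂
  set B₁ : ℝ → ℂ := fun μ => ∫ z in K, Dop 0 g (slicePt 0 1 (Fin.last n) 0 z) *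
    waveKer ζ W (k + 1 + 1) 0 z.1 z.2 (√μ : ℝ) with hB₁
  set B₀ : ℝ → ℂ := fun μ => ∫ z in K, g (slicePt 0 1 (Fin.last n) 0 z) *
    waveKer ζ (fun y => y ^ 3 * W y) (k + 1 + 2) 0 z.1 z.2 (√μ : ℝ) with hB₀
  have sL : AvgSmall L := by
    refine avgSmall_wave hζ hWd hκ hc hC hb (k + 1) hε measurable_fst
      (measurable_fst.comp measurable_snd) (measurable_snd.comp measurable_snd)
      (F := fun q => Pop n b g (slicePt 0 1 (Fin.last n) q.1 q.2))
      ((hg.pop b).continuous.comp continuous_slicePt).aestronglyMeasurable (fun q => hRP.1 _) ?_ ?_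
    · refine (ae_restrict_mem (measurableSet_Ioc.prod measurableSet_closedBall)).mono fun q hq => ?_
      exact hq.1.1.le
    · refine (ae_restrict_mem (measurableSet_Ioc.prod measurableSet_closedBall)).mono
        fun q hq hx hy => ?_
      exact hP q.1 q.2 hq.1.1.le hq.1.2 (hQε _ (hnear _ hx hy))
  have sB₂ : AvgSmall B₂ := by
    refine avgSmall_wave hζ hWd hκ hc hC hb (k + 1) hε measurable_const measurable_fst
      measurable_snd (F := fun z => u₂ z - Q.indicator f z) (B := R + ε ^ k * S)
      (hu₂c.aestronglyMeasurable.sub (hfc.aestronglyMeasurable.indicator hQm))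
      (fun z => (norm_sub_le _ _).trans (add_le_add (hR2.1 _) (hindb z)))
      (Filter.Eventually.of_forall fun z => le_rfl) (Filter.Eventually.of_forall fun z hx hy => ?_)
    have hz := hnear z hx hy
    rw [Set.indicator_of_mem hz, hu₂]
    exact sub_eq_zero.2 (h2 z (hQε z hz))
  have sB₁ : AvgSmall B₁ :=
    avgSmall_wave hζ hWd hκ hc hC hb (k + 1 + 1) hε measurable_const measurable_fst measurable_snd
      (F := fun z => Dop 0 g (slicePt 0 1 (Fin.last n) 0 z))
      (continuous_slice (hg.dop 0).continuous 0).aestronglyMeasurable (fun z => hR1.1 _)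
      (Filter.Eventually.of_forall fun z => le_rfl)
      (Filter.Eventually.of_forall fun z hx hy => h1 z (hQε z (hnear z hx hy)))
  have sB₀ : AvgSmall B₀ :=
    avgSmall_wave hζ hW3 hκ (half_pos hc) hC₃ hb₃ (k + 1 + 2) hε measurable_const measurable_fst
      measurable_snd (F := fun z => g (slicePt 0 1 (Fin.last n) 0 z))
      (continuous_slice hg.continuous 0).aestronglyMeasurable (fun z => hR0.1 _)
      (Filter.Eventually.of_forall fun z => le_rfl)
      (Filter.Eventually.of_forall fun z hx hy => h0 z (hQε z (hnear z hx hy)))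
  have iD : GaussIntegrable D := fun M hM => by
    have hDi : D = fun μ => ∫ z in Q, Q.indicator f z *
        waveKer ζ W (k + 1) 0 z.1 z.2 (√μ : ℝ) := by
      funext μ
      refine setIntegral_congr_fun hQm fun z hz => ?_
      simp only [Set.indicator_of_mem hz]
    rw [hDi]
    exact intervalIntegrable_gaussWt_mul_wave hζ hWd.continuous hκ hc hC hb (k + 1)
      measurable_const measurable_fst measurable_snd
      (hfc.aestronglyMeasurable.indicator hQm) hindb
      (Filter.Eventually.of_forall fun z => le_rfl) hM
  obtain ⟨A, hA, c', hc', hE⟩ := exists_norm_greenTerm_le hn b hζ hκ hc hC hb hg (k + 1) hε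
  have sAll := ((sB₂.add (sB₁.const_mul ζ)).add (sB₀.const_mul (b / ζ))).add (sL.const_mul I)
  refine exists_norm_le_of_average hA hc' hE (fun μ hμ => ?_) iD sAll
    (expSmall_main_term ζ hWd.continuous hc hC.le (norm_le_of_sector hκ hb) k hs hε)
  have hid := green_wave hn hζ0 h hg hRP.2 hR0.2 hR1.2 hR2.2 (k + 1) hε.le (Real.sqrt_pos.2 hμ)
  have hwc : Continuous fun z : ℝ × ℝ => waveKer ζ W (k + 1) 0 z.1 z.2 (√μ : ℝ) :=
    (continuous_waveKer hWd.continuous (k + 1) (√μ : ℝ)).comp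
      (continuous_const.prodMk continuous_id : Continuous fun z : ℝ × ℝ => ((0 : ℝ), z))
  have hKc : IsCompact K := isCompact_closedBall _ _
  have hsplit : ∫ z in K, u₂ z * waveKer ζ W (k + 1) 0 z.1 z.2 (√μ : ℝ) = B₂ μ + D μ := by
    have e1 : D μ = ∫ z in K, Q.indicator
        (fun z => f z * waveKer ζ W (k + 1) 0 z.1 z.2 (√μ : ℝ)) z := by
      rw [setIntegral_indicator hQm, Set.inter_eq_right.2 hQK]
    rw [e1, hB₂, ← integral_add]
    · congr 1
      funext z
      by_cases hz : z ∈ Q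
      · simp only [Set.indicator_of_mem hz]; ring
      · simp only [Set.indicator_of_notMem hz]; ring
    · have e2 : (fun z => (u₂ z - Q.indicator f z) * waveKer ζ W (k + 1) 0 z.1 z.2 (√μ : ℝ)) =
          fun z => u₂ z * waveKer ζ W (k + 1) 0 z.1 z.2 (√μ : ℝ) -
            Q.indicator (fun z => f z * waveKer ζ W (k + 1) 0 z.1 z.2 (√μ : ℝ)) z := by
        funext z
        by_cases hz : z ∈ Q
        · simp only [Set.indicator_of_mem hz]; ring
        · simp only [Set.indicator_of_notMem hz]; ring
      rw [e2]
      exact ((hu₂c.mul hwc).continuousOn.integrableOn_compact hKc).sub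
        (((hfc.mul hwc).continuousOn.integrableOn_compact hKc).indicator hQm)
    · exact ((hfc.mul hwc).continuousOn.integrableOn_compact hKc).indicator hQm
  have hsplit' : ∫ z in Metric.closedBall (0 : ℝ × ℝ) R,
      Dop 0 (Dop 0 g) (slicePt 0 1 (Fin.last n) 0 z) * waveKer ζ W (k + 1) 0 z.1 z.2 (√μ : ℝ) =
      B₂ μ + D μ := hsplit
  rw [hsplit'] at hid
  have hid' : I * L μ = (√μ : ℝ) ^ (k + 1) * (cexp (-I * ζ * (√μ : ℝ) * ε) *
      greenTerm n b ζ W g √μ ε) - (B₂ μ + D μ + ζ * B₁ μ + b / ζ * B₀ μ) := hid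
  linear_combination hid'

end Core

lemma not_forall_mul_exp_neg_rpow_le {s m A c : ℝ} (hs : 2 < s) (hm : 0 < m) (hc : 0 < c)
    (h : ∀ M : ℕ, 0 < M → m * Real.exp (-((M : ℝ) ^ (1 / s))) ≤ A * Real.exp (-c * √M)) :
    False := by
  have hs' : 0 < 1 / 2 - 1 / s := sub_pos.2 (one_div_lt_one_div_of_lt two_pos hs)
  have h2 := (tendsto_rpow_neg_atTop hs').comp tendsto_natCast_atTop_atTop
  have h3 : Filter.Tendsto (fun M : ℕ => A * Real.exp (-(c / 2 * √(M : ℝ)))) Filter.atTop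
      (nhds (A * 0)) :=
    (Real.tendsto_exp_neg_atTop_nhds_zero.comp
      ((Real.tendsto_sqrt_atTop.comp tendsto_natCast_atTop_atTop).const_mul_atTop
        (half_pos hc))).const_mul A
  rw [mul_zero] at h3
  obtain ⟨M, hM, hM', hM0⟩ := ((h2.eventually (gt_mem_nhds (half_pos hc))).and
    ((h3.eventually (gt_mem_nhds hm)).and (Filter.eventually_gt_atTop 0))).exists
  have hM : (M : ℝ) ^ (1 / s) ≤ c / 2 * √(M : ℝ) := by
    have hMpos : (0 : ℝ) < M := by exact_mod_cast hM0
    rw [Real.sqrt_eq_rpow, show 1 / s = -(1 / 2 - 1 / s) + 1 / 2 by ring, Real.rpow_add hMpos]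
    exact mul_le_mul_of_nonneg_right hM.le (by positivity)
  have h4 := h M hM0
  have h5 : A * Real.exp (-c * √(M : ℝ)) =
      A * Real.exp (-(c / 2 * √(M : ℝ))) * Real.exp (-(c / 2 * √(M : ℝ))) := by
    rw [mul_assoc, ← Real.exp_add]; ring_nf
  have h6 : m * Real.exp (-(c / 2 * √(M : ℝ))) ≤ m * Real.exp (-((M : ℝ) ^ (1 / s))) :=
    mul_le_mul_of_nonneg_left (Real.exp_le_exp.2 (neg_le_neg hM)) hm.le
  have h7 := mul_lt_mul_of_pos_right hM' (Real.exp_pos (-(c / 2 * √(M : ℝ))))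
  linarith

section Germs

variable {N : ℕ} {f g : (Fin N → ℝ) → ℂ} {V : Set (Fin N → ℝ)}

lemma Dop_eqOn (hV : IsOpen V) (h : Set.EqOn f g V) (j : Fin N) :
    Set.EqOn (Dop j f) (Dop j g) V := fun x hx => by
  have : f =ᶠ[nhds x] g := Filter.eventuallyEq_of_mem (hV.mem_nhds hx) h
  simp only [Dop, pd, this.fderiv_eq]

lemma Pop_eqOn {n : ℕ} {f g : (Fin (n + 1) → ℝ) → ℂ} {V : Set (Fin (n + 1) → ℝ)}
    (hV : IsOpen V) (h : Set.EqOn f g V) (b : ℝ) : Set.EqOn (Pop n b f) (Pop n b g) V :=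
  fun x hx => by
    have hD {f g : (Fin (n + 1) → ℝ) → ℂ} (h : Set.EqOn f g V) (j : Fin (n + 1)) :=
      Dop_eqOn hV h j
    simp only [Pop, hD (hD (hD h 0) 0) 0 hx, hD (hD (hD h 0) 1) 1 hx,
      hD (hD (hD h 0) (Fin.last n)) (Fin.last n) hx,
      hD (hD (hD h (Fin.last n)) (Fin.last n)) (Fin.last n) hx]

/-- A function smooth near the origin has a globally defined test function as its germ there. -/
lemma exists_testFn_eqOn (hV : IsOpen V) (h0 : 0 ∈ V) (hf : ContDiffOn ℝ (⊤ : ℕ∞) f V) :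
    ∃ g, TestFn g ∧ ∃ V' ⊆ V, IsOpen V' ∧ (0 : Fin N → ℝ) ∈ V' ∧ Set.EqOn g f V' := by
  obtain ⟨r, hr, hrV⟩ := Metric.isOpen_iff.1 hV 0 h0
  let χ : ContDiffBump (0 : Fin N → ℝ) := ⟨r / 4, r / 2, by positivity, by linarith⟩
  have hts : tsupport χ ⊆ V := by
    rw [χ.tsupport_eq]
    exact (Metric.closedBall_subset_ball (half_lt_self hr)).trans hrV
  refine ⟨fun x => χ x • f x, ⟨?_, χ.hasCompactSupport.smul_right⟩, Metric.ball 0 (r / 4),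
    (Metric.ball_subset_ball (by linarith)).trans hrV, Metric.isOpen_ball,
    Metric.mem_ball_self (by positivity), fun x hx => ?_⟩
  · refine contDiff_iff_contDiffAt.2 fun x => ?_
    by_cases hx : x ∈ tsupport χ
    · exact χ.contDiff.contDiffAt.smul (hf.contDiffAt (hV.mem_nhds (hts hx)))
    · refine (contDiffAt_const (c := (0 : ℂ))).congr_of_eventuallyEq ?_
      filter_upwards [notMem_tsupport_iff_eventuallyEq.1 hx] with y hy
      simp [hy]
  · simp only [χ.one_of_mem_closedBall (Metric.ball_subset_closedBall hx), one_smul]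

end Germs

lemma exists_slicePt_mem {N : ℕ} {i₀ i₁ i₂ : Fin N} {V : Set (Fin N → ℝ)} (hV : IsOpen V)
    (h0 : 0 ∈ V) : ∃ ε > 0, ∀ t z, 0 ≤ t → t ≤ ε → ‖z‖ ≤ ε → slicePt i₀ i₁ i₂ t z ∈ V := by
  have hc := (continuous_slicePt (i₀ := i₀) (i₁ := i₁) (i₂ := i₂)).isOpen_preimage V hV
  obtain ⟨r, hr, hrV⟩ := Metric.isOpen_iff.1 hc 0 (by simpa [slicePt] using h0)
  refine ⟨r / 2, by positivity, fun t z ht ht' hz => ?_⟩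
  refine hrV (show ((t, z) : ℝ × (ℝ × ℝ)) ∈ _ from ?_)
  rw [mem_ball_zero_iff, Prod.norm_def, max_lt_iff, Real.norm_of_nonneg ht]
  exact ⟨by linarith, by linarith⟩

lemma exists_cons_eq_slicePt {n : ℕ} (hn : 2 ≤ n) (z : ℝ × ℝ) : ∃ x' : Fin n → ℝ,
    Fin.cons 0 x' = slicePt (0 : Fin (n + 1)) 1 (Fin.last n) 0 z ∧
      x' ⟨0, by omega⟩ = z.1 ∧ x' ⟨n - 1, by omega⟩ = z.2 := by
  obtain ⟨h01, h02, h12⟩ := fin_ne_of_two_le hn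
  have e1 : (⟨0, by omega⟩ : Fin n).succ = 1 := by
    ext; simp [Nat.mod_eq_of_lt (show 1 < n + 1 by omega)]
  have e2 : (⟨n - 1, by omega⟩ : Fin n).succ = Fin.last n := by
    ext; simp; omega
  refine ⟨fun j => slicePt (0 : Fin (n + 1)) 1 (Fin.last n) 0 z j.succ, ?_, ?_, ?_⟩
  · funext j
    refine Fin.cases ?_ (fun j => ?_) j
    · simp [slicePt, h01, h02]
    · simp
  · beta_reduce; rw [e1]; simp [slicePt, h12]
  · beta_reduce; rw [e2]; simp [slicePt, h12.symm]

/-- For `s > 2` there is a hyperbolic choice of `b₀` for which the Cauchy problem for `P`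
is not locally solvable at the origin in the Gevrey class `γ^(s)`. -/
theorem not_gevrey_s_solvable (n : ℕ) (hn : 2 ≤ n) (s : ℝ) (hs : 2 < s) :
    ∃ b₀ : ℝ, 0 < b₀ ∧ b₀ < 2 / (3 * Real.sqrt 3) ∧
      ∃ u₀ u₁ u₂ : (Fin n → ℝ) → ℂ,
        GevreyOn s u₀ ∧ GevreyOn s u₁ ∧ GevreyOn s u₂ ∧
        ∀ U : Set (Fin (n+1) → ℝ), IsOpen U → (0 : Fin (n+1) → ℝ) ∈ U →
          ¬ ∃ u : (Fin (n+1) → ℝ) → ℂ, ContDiffOn ℝ (⊤ : ℕ∞) u U ∧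
              (∀ x ∈ U, Pop n b₀ u x = 0) ∧
              (∀ x' : Fin n → ℝ, Fin.cons 0 x' ∈ U →
                u (Fin.cons 0 x') = u₀ x' ∧
                Dop 0 u (Fin.cons 0 x') = u₁ x' ∧
                Dop 0 (Dop 0 u) (Fin.cons 0 x') = u₂ x') := by
  obtain ⟨b, hb0, hb38, ζ, hζ, W, W', hW, hWne, κ, hκ, c, hc, C, hC, hWb⟩ :=
    exists_sector_solution
  obtain ⟨k, hk⟩ := hW.exists_moment_ne_zero hWne hc (norm_le_of_sector hκ hWb)
  have hil : (⟨0, by omega⟩ : Fin n) ≠ ⟨n - 1, by omega⟩ := by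
    rw [Ne, Fin.mk.injEq]; omega
  have hG0 := gevreyOn_gevProd (s := s) (by linarith) hil 0 (c := 0) (by simp)
  have hG2 := gevreyOn_gevProd (s := s) (by linarith) hil k (c := 1) (by simp)
  refine ⟨b, hb0, hb38.trans ?_, _, _, _, hG0, hG0, hG2, ?_⟩
  · have h3 : 0 < √(3 : ℝ) := by positivity
    rw [lt_div_iff₀ (by positivity)]
    nlinarith [Real.sq_sqrt (show (0 : ℝ) ≤ 3 by norm_num)]
  rintro U hU h0 ⟨u, hu, huP, hud⟩
  obtain ⟨g, hg, V, hVU, hV, hV0, hgu⟩ := exists_testFn_eqOn hU h0 hu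
  obtain ⟨ε, hε, hεV⟩ := exists_slicePt_mem (i₀ := 0) (i₁ := 1) (i₂ := Fin.last n) hV hV0
  have hdata (z : ℝ × ℝ) (hz : ‖z‖ ≤ ε) :
      g (slicePt 0 1 (Fin.last n) 0 z) = 0 ∧ Dop 0 g (slicePt 0 1 (Fin.last n) 0 z) = 0 ∧
      Dop 0 (Dop 0 g) (slicePt 0 1 (Fin.last n) 0 z) = (z.1 : ℂ) ^ k * gevSeries s 0 z.2 := by
    have hzV := hεV 0 z le_rfl hε.le hz
    obtain ⟨x', hx', h1, h2⟩ := exists_cons_eq_slicePt hn z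
    obtain ⟨d0, d1, d2⟩ := hud x' (by rw [hx']; exact hVU hzV)
    rw [hx'] at d0 d1 d2
    have hDg := Dop_eqOn hV hgu 0
    rw [hgu hzV, hDg hzV, Dop_eqOn hV hDg 0 hzV, d0, d1, d2]
    simp [gevProd, h1, h2]
  obtain ⟨A, -, c', hc', hA⟩ := exists_norm_gevGaussSum_le hn hζ hW hκ hc hC hWb hg k
    (s := s) (by linarith) hε
    (fun t z ht ht' hz => (Pop_eqOn hV hgu b (hεV t z ht ht' hz)).trans
      (huP _ (hVU (hεV t z ht ht' hz))))
    (fun z hz => (hdata z hz).1) (fun z hz => (hdata z hz).2.1) (fun z hz => (hdata z hz).2.2)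
  refine not_forall_mul_exp_neg_rpow_le (A := A) hs (norm_pos_iff.2 hk) hc' fun M hM => ?_
  refine le_trans ?_ (hA M (by exact_mod_cast hM))
  rw [norm_mul, norm_real]
  exact mul_le_mul_of_nonneg_left ((le_gevGaussSum (by linarith) hM).trans (le_abs_self _))
    (norm_nonneg _)
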